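/- There exist absolute constants c1, c2, c3 > 0 such that the following holds. Let T be an n-node ordered tree and let Γ0 and Γ1 be two order-preserving straight-line planar grid drawings of T. Set H = max{h(Γ0),h(Γ1)}, W = max{w(Γ0),w(Γ1)}, and D = max{H,W}. Then there exists a planar morph M from Γ0 to Γ1 with at most c1·n steps, all of whose drawings are grid drawings, such that the height of M is at most c2·D³·n·H and the width of M is at most c3·D³·n·W. -/

import Mathlib

open Real Set

/-- A finite rooted ordered tree: a root, a parent function (fixing the root),
well-foundedness (every node reaches the root by iterating `parent`), and a
rank function giving the left-to-right order among siblings. -/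
structure OTree (V : Type) [Fintype V] [DecidableEq V] where
  root : V
  parent : V → V
  parent_root : parent root = root
  reach : ∀ v : V, ∃ n : ℕ, parent^[n] v = root
  rank : V → ℕ
  rank_inj : ∀ u v : V, u ≠ root → v ≠ root →
    parent u = parent v → rank u = rank v → u = v

variable {V : Type} [Fintype V] [DecidableEq V]

/-- `c` is a child of `v`. -/
def OTree.IsChild (T : OTree V) (c v : V) : Prop := c ≠ T.root ∧ T.parent c = v

/-- A leaf is a node with no children. -/
def OTree.IsLeaf (T : OTree V) (v : V) : Prop := ∀ c, ¬ T.IsChild c v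

/-- `a` is an ancestor of `w`, or `a = w`. -/
def OTree.AncEq (T : OTree V) (a w : V) : Prop := ∃ n : ℕ, T.parent^[n] w = a

/-- A drawing is strictly upward if every non-root node lies strictly below its parent. -/
def IsUpwardD (T : OTree V) (Γ : V → ℝ × ℝ) : Prop :=
  ∀ v, v ≠ T.root → (Γ v).2 < (Γ (T.parent v)).2

/-- A straight-line drawing is planar if it is injective on nodes and any two distinct
edge segments meet only in (images of) shared endpoints. -/
def IsPlanarD (T : OTree V) (Γ : V → ℝ × ℝ) : Prop :=
  Function.Injective Γ ∧
  ∀ u v : V, u ≠ T.root → v ≠ T.root → u ≠ v →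
    segment ℝ (Γ u) (Γ (T.parent u)) ∩ segment ℝ (Γ v) (Γ (T.parent v)) ⊆
      Γ '' (({u, T.parent u} : Set V) ∩ {v, T.parent v})

/-- The angle of the direction from `p` to `q`. -/
noncomputable def dirAngle (p q : ℝ × ℝ) : ℝ :=
  Complex.arg (Complex.ofReal (q.1 - p.1) + Complex.ofReal (q.2 - p.2) * Complex.I)

/-- Normalization of an angle into the window `[a, a + 2π)`. -/
noncomputable def normAngle (a θ : ℝ) : ℝ := θ - 2 * π * (⌊(θ - a) / (2 * π)⌋ : ℤ)

/-- The angle of the direction from `Γ v` to `Γ w`, normalized into `[a, a + 2π)`. -/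
noncomputable def angFrom (Γ : V → ℝ × ℝ) (a : ℝ) (v w : V) : ℝ :=
  normAngle a (dirAngle (Γ v) (Γ w))

/-- A drawing is order-preserving if around every node the counterclockwise cyclic
order of the incident edges is: edge to the parent, then edges to the children in
left-to-right order. -/
def IsOrderPreservingD (T : OTree V) (Γ : V → ℝ × ℝ) : Prop :=
  ∀ v : V, ∃ a : ℝ,
    (∀ c₁ c₂ : V, T.IsChild c₁ v → T.IsChild c₂ v → T.rank c₁ < T.rank c₂ →
      angFrom Γ a v c₁ < angFrom Γ a v c₂) ∧
    (v ≠ T.root → ∀ c : V, T.IsChild c v →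
      angFrom Γ a v (T.parent v) < angFrom Γ a v c)

/-- A grid drawing places every node at integer coordinates. -/
def IsGridD (Γ : V → ℝ × ℝ) : Prop :=
  ∀ v, (∃ a : ℤ, (Γ v).1 = a) ∧ (∃ b : ℤ, (Γ v).2 = b)

/-- The width of a (grid) drawing: number of grid columns met by its bounding box. -/
noncomputable def gW (Γ : V → ℝ × ℝ) : ℝ :=
  sSup (Set.range fun v => (Γ v).1) - sInf (Set.range fun v => (Γ v).1) + 1

/-- The height of a (grid) drawing: number of grid rows met by its bounding box. -/
noncomputable def gH (Γ : V → ℝ × ℝ) : ℝ :=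
  sSup (Set.range fun v => (Γ v).2) - sInf (Set.range fun v => (Γ v).2) + 1

/-- The drawing at time `t` of the linear morph from `Γ₀` to `Γ₁`. -/
def lerpD (t : ℝ) (Γ₀ Γ₁ : V → ℝ × ℝ) : V → ℝ × ℝ :=
  fun v => (1 - t) • Γ₀ v + t • Γ₁ v

/-- The linear morph from `Γ₀` to `Γ₁` is planar. -/
def PlanarStep (T : OTree V) (Γ₀ Γ₁ : V → ℝ × ℝ) : Prop :=
  ∀ t ∈ Set.Icc (0:ℝ) 1, IsPlanarD T (lerpD t Γ₀ Γ₁)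

/-- The linear morph from `Γ₀` to `Γ₁` is upward. -/
def UpwardStep (T : OTree V) (Γ₀ Γ₁ : V → ℝ × ℝ) : Prop :=
  ∀ t ∈ Set.Icc (0:ℝ) 1, IsUpwardD T (lerpD t Γ₀ Γ₁)

namespace OTree

theorem AncEq.refl (T : OTree V) (a : V) : T.AncEq a a := ⟨0, rfl⟩

theorem AncEq.trans {T : OTree V} {a b c : V} (h : T.AncEq a b) (h' : T.AncEq b c) :
    T.AncEq a c := by
  obtain ⟨n, rfl⟩ := h
  obtain ⟨m, rfl⟩ := h'
  exact ⟨n + m, Function.iterate_add_apply _ _ _ _⟩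

theorem ancEq_parent (T : OTree V) (a : V) : T.AncEq (T.parent a) a := ⟨1, rfl⟩

theorem AncEq.eq_or {T : OTree V} {a w : V} (h : T.AncEq a w) :
    a = w ∨ (w ≠ T.root ∧ T.AncEq a (T.parent w)) := by
  obtain ⟨n, rfl⟩ := h
  by_cases hw : w = T.root
  · left
    subst hw
    exact Function.iterate_fixed T.parent_root n
  · cases n with
    | zero => left; rfl
    | succ n => right; exact ⟨hw, n, rfl⟩

theorem ancEq_root (T : OTree V) (a : V) : T.AncEq T.root a := T.reach a

theorem AncEq.comparable {T : OTree V} {a b w : V} (h : T.AncEq a w) (h' : T.AncEq b w) :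
    T.AncEq a b ∨ T.AncEq b a := by
  obtain ⟨n, rfl⟩ := h
  obtain ⟨m, rfl⟩ := h'
  rcases le_total n m with hnm | hnm
  · right
    exact ⟨m - n, by rw [← Function.iterate_add_apply, Nat.sub_add_cancel hnm]⟩
  · left
    exact ⟨n - m, by rw [← Function.iterate_add_apply, Nat.sub_add_cancel hnm]⟩

/-- The number of edges from a node to the root. -/
noncomputable def depth (T : OTree V) (v : V) : ℕ := Nat.find (T.reach v)

theorem depth_eq_succ (T : OTree V) {v : V} (hv : v ≠ T.root) :
    T.depth v = T.depth (T.parent v) + 1 := by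
  have h1 : T.parent^[T.depth (T.parent v)] (T.parent v) = T.root :=
    Nat.find_spec (T.reach (T.parent v))
  have h2 : T.parent^[T.depth v] v = T.root := Nat.find_spec (T.reach v)
  have h3 : T.depth v ≤ T.depth (T.parent v) + 1 := Nat.find_min' (T.reach v) h1
  cases hd : T.depth v with
  | zero => rw [hd] at h2; exact absurd h2 hv
  | succ k =>
    rw [hd] at h2
    have h4 : T.depth (T.parent v) ≤ k := Nat.find_min' (T.reach (T.parent v)) h2
    omega

theorem AncEq.depth_le {T : OTree V} {a w : V} (h : T.AncEq a w) :
    T.depth a ≤ T.depth w ∧ (T.depth a = T.depth w → a = w) := by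
  obtain ⟨n, hn⟩ := h
  induction n generalizing w with
  | zero => subst hn; exact ⟨le_rfl, fun _ => rfl⟩
  | succ n ih =>
    by_cases hw : w = T.root
    · have : a = w := by
        subst hw; rw [← hn]; exact Function.iterate_fixed T.parent_root _
      subst this; exact ⟨le_rfl, fun _ => rfl⟩
    · have h1 := ih (w := T.parent w) hn
      have h2 := T.depth_eq_succ hw
      exact ⟨by omega, fun h => by omega⟩

theorem AncEq.antisymm {T : OTree V} {a b : V} (h : T.AncEq a b) (h' : T.AncEq b a) : a = b :=
  h.depth_le.2 (le_antisymm h.depth_le.1 h'.depth_le.1)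

theorem AncEq.eq_of_depth {T : OTree V} {a b w : V} (h : T.AncEq a w) (h' : T.AncEq b w)
    (hd : T.depth a = T.depth b) : a = b := by
  rcases h.comparable h' with h1 | h1
  · exact h1.depth_le.2 hd
  · exact (h1.depth_le.2 hd.symm).symm

/-- `w` is a strict descendant of `v`. -/
def SDesc (T : OTree V) (v w : V) : Prop := T.AncEq v w ∧ w ≠ v

theorem SDesc.ne_root {T : OTree V} {v w : V} (h : T.SDesc v w) : w ≠ T.root := by
  rcases h.1.eq_or with h1 | h1
  · exact absurd h1.symm h.2
  · exact h1.1

theorem SDesc.parent {T : OTree V} {v w : V} (h : T.SDesc v w) : T.AncEq v (T.parent w) := by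
  rcases h.1.eq_or with h1 | h1
  · exact absurd h1.symm h.2
  · exact h1.2

theorem IsChild.sdesc {T : OTree V} {c v : V} (h : T.IsChild c v) : T.SDesc v c := by
  obtain ⟨h1, rfl⟩ := h
  refine ⟨T.ancEq_parent c, fun h => ?_⟩
  have := T.depth_eq_succ h1
  rw [← h] at this
  omega

theorem SDesc.trans_ancEq {T : OTree V} {v c w : V} (h : T.SDesc v c) (h' : T.AncEq c w) :
    T.SDesc v w := by
  refine ⟨h.1.trans h', ?_⟩
  rintro rfl
  exact h.2 (h'.antisymm h.1)

theorem IsChild.depth {T : OTree V} {c v : V} (h : T.IsChild c v) :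
    T.depth c = T.depth v + 1 := by
  obtain ⟨h1, rfl⟩ := h
  exact T.depth_eq_succ h1

theorem SDesc.exists_child {T : OTree V} {v w : V} (h : T.SDesc v w) :
    ∃ c, T.IsChild c v ∧ T.AncEq c w := by
  obtain ⟨⟨n, hn⟩, hne⟩ := h
  induction n generalizing w with
  | zero => exact absurd hn hne
  | succ n ih =>
    have hs : T.SDesc v w := ⟨⟨n + 1, hn⟩, hne⟩
    by_cases hp : T.parent w = v
    · exact ⟨w, ⟨hs.ne_root, hp⟩, AncEq.refl T w⟩
    · obtain ⟨c, hc, hcw⟩ := ih hp hn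
      exact ⟨c, hc, hcw.trans (T.ancEq_parent w)⟩

open Classical in
/-- The child of `v` whose subtree contains `w` (meaningful for strict descendants `w`). -/
noncomputable def branch (T : OTree V) (v w : V) : V :=
  if h : ∃ c, T.IsChild c v ∧ T.AncEq c w then h.choose else v

theorem SDesc.branch_spec {T : OTree V} {v w : V} (h : T.SDesc v w) :
    T.IsChild (T.branch v w) v ∧ T.AncEq (T.branch v w) w := by
  have h' := h.exists_child
  unfold branch
  rw [dif_pos h']
  exact h'.choose_spec

theorem branch_eq {T : OTree V} {v c w : V} (hc : T.IsChild c v) (h : T.AncEq c w) :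
    T.branch v w = c := by
  have h1 := (hc.sdesc.trans_ancEq h).branch_spec
  exact h1.2.eq_of_depth h (by rw [h1.1.depth, hc.depth])

/-- `z` lies in the subtree of a sibling preceding an ancestor of `w`. -/
def LeftOf (T : OTree V) (z w : V) : Prop :=
  ∃ a b, a ≠ T.root ∧ b ≠ T.root ∧ T.parent a = T.parent b ∧ T.rank a < T.rank b ∧
    T.AncEq a z ∧ T.AncEq b w

theorem LeftOf.irrefl {T : OTree V} {w : V} : ¬ T.LeftOf w w := by
  rintro ⟨a, b, ha, hb, hp, hr, h1, h2⟩
  have : a = b := h1.eq_of_depth h2 (by rw [T.depth_eq_succ ha, T.depth_eq_succ hb, hp])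
  subst this
  exact lt_irrefl _ hr

theorem LeftOf.mono {T : OTree V} {z w z' w' : V} (h : T.LeftOf z w) (hz : T.AncEq z z')
    (hw : T.AncEq w w') : T.LeftOf z' w' := by
  obtain ⟨a, b, ha, hb, hp, hr, h1, h2⟩ := h
  exact ⟨a, b, ha, hb, hp, hr, h1.trans hz, h2.trans hw⟩

theorem LeftOf.trans {T : OTree V} {x y z : V} (h : T.LeftOf x y) (h' : T.LeftOf y z) :
    T.LeftOf x z := by
  obtain ⟨a, b, ha, hb, hp, hr, h1, h2⟩ := h
  obtain ⟨a', b', ha', hb', hp', hr', h1', h2'⟩ := h'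
  rcases eq_or_ne b a' with hba | hba
  · subst hba
    exact ⟨a, b', ha, hb', hp.trans hp', hr.trans hr', h1, h2'⟩
  rcases h2.comparable h1' with hc | hc
  · refine ⟨a, b, ha, hb, hp, hr, h1, ?_⟩
    have : T.AncEq b (T.parent a') := SDesc.parent ⟨hc, fun h => hba h.symm⟩
    rw [hp'] at this
    exact (this.trans (T.ancEq_parent b')).trans h2'
  · refine ⟨a', b', ha', hb', hp', hr', ?_, h2'⟩
    have : T.AncEq a' (T.parent b) := SDesc.parent ⟨hc, hba⟩
    rw [← hp] at this
    exact (this.trans (T.ancEq_parent a)).trans h1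

theorem leftOf_or {T : OTree V} {u w : V} (hd : T.depth u = T.depth w) (hne : u ≠ w) :
    T.LeftOf u w ∨ T.LeftOf w u := by
  induction hk : T.depth u generalizing u w with
  | zero =>
    have key : ∀ x, T.depth x = 0 → x = T.root := by
      intro x hx
      by_contra h
      have := T.depth_eq_succ h
      omega
    exact absurd ((key u hk).trans (key w (hd ▸ hk)).symm) hne
  | succ k ih =>
    have key : ∀ x, T.depth x = k + 1 → x ≠ T.root := by
      rintro x hx rfl
      have h0 : T.depth T.root = 0 := by
        have := (T.ancEq_root T.root)
        unfold depth
        rw [Nat.find_eq_zero]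
        rfl
      omega
    have hu := key u hk
    have hw := key w (hd ▸ hk)
    have hu' := T.depth_eq_succ hu
    have hw' := T.depth_eq_succ hw
    by_cases hp : T.parent u = T.parent w
    · have hr : T.rank u ≠ T.rank w := fun h => hne (T.rank_inj u w hu hw hp h)
      rcases lt_or_gt_of_ne hr with h | h
      · exact Or.inl ⟨u, w, hu, hw, hp, h, AncEq.refl T u, AncEq.refl T w⟩
      · exact Or.inr ⟨w, u, hw, hu, hp.symm, h, AncEq.refl T w, AncEq.refl T u⟩
    · rcases ih (u := T.parent u) (w := T.parent w) (by omega) hp (by omega) with h | h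
      · exact Or.inl (h.mono (T.ancEq_parent u) (T.ancEq_parent w))
      · exact Or.inr (h.mono (T.ancEq_parent w) (T.ancEq_parent u))

open Classical in
/-- The abscissa of a node in the canonical drawing. -/
noncomputable def col (T : OTree V) (w : V) : ℕ :=
  (Finset.univ.filter fun z => T.LeftOf z w).card

theorem LeftOf.col_lt {T : OTree V} {z w : V} (h : T.LeftOf z w) : T.col z < T.col w := by
  classical
  apply Finset.card_lt_card
  rw [Finset.ssubset_iff_of_subset]
  · exact ⟨z, by simpa using h, by simpa using LeftOf.irrefl⟩
  · intro x hx
    simp only [Finset.mem_filter, Finset.mem_univ, true_and] at hx ⊢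
    exact hx.trans h

theorem col_le (T : OTree V) (w : V) : T.col w ≤ Fintype.card V := Finset.card_le_univ _

theorem depth_le_card (T : OTree V) (v : V) : T.depth v ≤ Fintype.card V := by
  have hlt : ∀ w k, k < T.depth w → T.depth (T.parent^[k] w) = T.depth w - k := by
    intro w k
    induction k with
    | zero => intro _; rfl
    | succ k ih =>
      intro hk
      have h1 := ih (by omega)
      have h2 : T.parent^[k] w ≠ T.root := fun h => Nat.find_min (T.reach w) (by
        change k < T.depth w
        omega) h
      rw [Function.iterate_succ_apply']
      have := T.depth_eq_succ h2
      omega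
  have hinj : Function.Injective (fun k : Fin (T.depth v) => T.parent^[k.1] v) := by
    intro a b hab
    have ha := hlt v a.1 a.2
    have hb := hlt v b.1 b.2
    simp only at hab
    rw [hab] at ha
    ext
    have := a.2
    have := b.2
    omega
  simpa using Fintype.card_le_of_injective _ hinj

/-- The canonical layered drawing. -/
noncomputable def canon (T : OTree V) (w : V) : ℝ × ℝ := ((T.col w : ℝ), -(T.depth w : ℝ))

end OTree

/-- The edges above `u` and `w` meet only at common endpoints. -/
def EdgesMeet (T : OTree V) (Γ : V → ℝ × ℝ) (u w : V) : Prop :=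
  ∀ p, p ∈ segment ℝ (Γ u) (Γ (T.parent u)) → p ∈ segment ℝ (Γ w) (Γ (T.parent w)) →
    ∃ z, (z = u ∨ z = T.parent u) ∧ (z = w ∨ z = T.parent w) ∧ Γ z = p

theorem isPlanarD_iff (T : OTree V) (Γ : V → ℝ × ℝ) :
    IsPlanarD T Γ ↔ Function.Injective Γ ∧
      ∀ u w, u ≠ T.root → w ≠ T.root → u ≠ w → EdgesMeet T Γ u w := by
  unfold IsPlanarD EdgesMeet
  refine and_congr_right fun _ => forall_congr' fun u => forall_congr' fun w =>
    imp_congr_right fun _ => imp_congr_right fun _ => imp_congr_right fun _ => ?_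
  constructor
  · intro h p h1 h2
    obtain ⟨z, ⟨hz1, hz2⟩, hz⟩ := h ⟨h1, h2⟩
    exact ⟨z, by simpa using hz1, by simpa using hz2, hz⟩
  · rintro h p ⟨h1, h2⟩
    obtain ⟨z, hz1, hz2, hz⟩ := h p h1 h2
    exact ⟨z, ⟨by simpa using hz1, by simpa using hz2⟩, hz⟩

theorem EdgesMeet.symm {T : OTree V} {Γ : V → ℝ × ℝ} {u w : V} (h : EdgesMeet T Γ u w) :
    EdgesMeet T Γ w u := fun p h1 h2 => by
  obtain ⟨z, a, b, c⟩ := h p h2 h1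
  exact ⟨z, b, a, c⟩

theorem EdgesMeet.congr {T : OTree V} {Γ Γ' : V → ℝ × ℝ} {u w : V} (h : EdgesMeet T Γ u w)
    (h1 : Γ' u = Γ u) (h2 : Γ' (T.parent u) = Γ (T.parent u)) (h3 : Γ' w = Γ w)
    (h4 : Γ' (T.parent w) = Γ (T.parent w)) : EdgesMeet T Γ' u w := by
  intro p hp hp'
  rw [h1, h2] at hp
  rw [h3, h4] at hp'
  obtain ⟨z, a, b, c⟩ := h p hp hp'
  refine ⟨z, a, b, ?_⟩
  rcases a with rfl | rfl
  · rw [h1, c]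
  · rw [h2, c]

/-- A drawing in which each node of the subtree of `v` is on a row determined by its depth, and
rows respect the left-to-right order, is planar on that subtree. -/
theorem layered_edgesMeet (T : OTree V) (v : V) (Γ : V → ℝ × ℝ) (row : ℕ → ℝ)
    (hrow : StrictAnti row)
    (hy : ∀ w, T.AncEq v w → (Γ w).2 = row (T.depth w))
    (hx : ∀ u w, T.AncEq v u → T.AncEq v w → T.depth u = T.depth w → T.LeftOf u w →
      (Γ u).1 < (Γ w).1) {u w : V} (hu : T.SDesc v u) (hw : T.SDesc v w) (huw : u ≠ w) :
    EdgesMeet T Γ u w := by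
  wlog hd : T.depth u ≤ T.depth w generalizing u w
  · exact (this hw hu huw.symm (by omega)).symm
  have hdu := T.depth_eq_succ hu.ne_root
  have hdw := T.depth_eq_succ hw.ne_root
  have hyu := hy u hu.1
  have hyw := hy w hw.1
  have hyu' := hy _ hu.parent
  have hyw' := hy _ hw.parent
  have hxeq : ∀ a b, T.AncEq v a → T.AncEq v b → T.depth a = T.depth b →
      (Γ a).1 = (Γ b).1 → a = b := by
    intro a b ha hb hd h
    by_contra hne
    rcases T.leftOf_or hd hne with h1 | h1
    · exact absurd h (hx a b ha hb hd h1).ne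
    · exact absurd h (hx b a hb ha hd.symm h1).ne'
  rintro p ⟨s, t, hs, ht, hst, hp⟩ ⟨s', t', hs', ht', hst', hp'⟩
  have e1 : s * (Γ u).1 + t * (Γ (T.parent u)).1 = p.1 := by rw [← hp]; simp
  have e2 : s * (Γ u).2 + t * (Γ (T.parent u)).2 = p.2 := by rw [← hp]; simp
  have e3 : s' * (Γ w).1 + t' * (Γ (T.parent w)).1 = p.1 := by rw [← hp']; simp
  have e4 : s' * (Γ w).2 + t' * (Γ (T.parent w)).2 = p.2 := by rw [← hp']; simp
  rw [hyu, hyu'] at e2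
  rw [hyw, hyw'] at e4
  rcases Nat.lt_or_ge (T.depth u) (T.depth w) with hlt | hge
  · have r1 : row (T.depth u) < row (T.depth (T.parent u)) := hrow (by omega)
    have r2 : row (T.depth w) < row (T.depth (T.parent w)) := hrow (by omega)
    have r3 : row (T.depth (T.parent w)) ≤ row (T.depth u) := hrow.antitone (by omega)
    have q1 : p.2 = row (T.depth u) + t * (row (T.depth (T.parent u)) - row (T.depth u)) := by
      rw [← e2, show s = 1 - t by linarith]; ring
    have q2 : p.2 = row (T.depth (T.parent w)) -
        s' * (row (T.depth (T.parent w)) - row (T.depth w)) := by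
      rw [← e4, show t' = 1 - s' by linarith]; ring
    have q3 := mul_nonneg ht (sub_pos.2 r1).le
    have q4 := mul_nonneg hs' (sub_pos.2 r2).le
    have t0 : t = 0 := by
      by_contra h
      have := mul_pos (lt_of_le_of_ne ht (Ne.symm h)) (sub_pos.2 r1)
      linarith
    have s0 : s' = 0 := by
      by_contra h
      have := mul_pos (lt_of_le_of_ne hs' (Ne.symm h)) (sub_pos.2 r2)
      linarith
    have s1 : s = 1 := by linarith
    have t1 : t' = 1 := by linarith
    subst t0 s0 s1 t1
    have r4 : row (T.depth (T.parent w)) = row (T.depth u) := by linarith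
    have := hrow.injective r4
    have h5 : T.parent w = u := hxeq _ _ hw.parent hu.1 this (by linarith)
    exact ⟨u, Or.inl rfl, Or.inr h5.symm, by rw [← hp]; simp⟩
  · have hde : T.depth u = T.depth w := le_antisymm hd hge
    have hdp : T.depth (T.parent u) = T.depth (T.parent w) := by omega
    rw [← hde, ← hdp] at e4
    have r1 : row (T.depth u) < row (T.depth (T.parent u)) := hrow (by omega)
    have htt : t = t' := by
      have h1 : s = 1 - t := by linarith
      have h2 : s' = 1 - t' := by linarith
      subst h1 h2
      have : (t - t') * (row (T.depth (T.parent u)) - row (T.depth u)) = 0 := by linarith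
      rcases mul_eq_zero.1 this with h | h <;> linarith
    have hss : s = s' := by linarith
    subst htt hss
    have key : ∀ a b, T.SDesc v a → T.SDesc v b → T.depth a = T.depth b → T.LeftOf a b →
        s * (Γ a).1 + t * (Γ (T.parent a)).1 = s * (Γ b).1 + t * (Γ (T.parent b)).1 →
        s = 0 ∧ T.parent a = T.parent b := by
      intro a b ha hb hab hl heq
      have hda := T.depth_eq_succ ha.ne_root
      have hdb := T.depth_eq_succ hb.ne_root
      have x1 := hx a b ha.1 hb.1 hab hl
      by_cases hpab : T.parent a = T.parent b
      · refine ⟨?_, hpab⟩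
        rw [hpab] at heq
        have : s * ((Γ b).1 - (Γ a).1) = 0 := by linarith
        rcases mul_eq_zero.1 this with h | h <;> linarith
      · exfalso
        have hl' : T.LeftOf (T.parent a) (T.parent b) := by
          rcases T.leftOf_or (by omega) hpab with h | h
          · exact h
          · exact absurd (hl.trans (h.mono (T.ancEq_parent b) (T.ancEq_parent a)))
              OTree.LeftOf.irrefl
        have x2 := hx _ _ ha.parent hb.parent (by omega) hl'
        have : s * ((Γ b).1 - (Γ a).1) + t * ((Γ (T.parent b)).1 - (Γ (T.parent a)).1) = 0 := by
          linarith
        rcases hs.lt_or_eq with h | h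
        · nlinarith [mul_nonneg ht (sub_pos.2 x2).le, mul_pos h (sub_pos.2 x1)]
        · nlinarith [mul_nonneg hs (sub_pos.2 x1).le]
    have hfin : s = 0 ∧ T.parent u = T.parent w := by
      rcases T.leftOf_or hde huw with h | h
      · exact key u w hu hw hde h (by linarith)
      · obtain ⟨a, b⟩ := key w u hw hu hde.symm h (by linarith)
        exact ⟨a, b.symm⟩
    refine ⟨T.parent u, Or.inr rfl, Or.inr hfin.2, ?_⟩
    have t1 : t = 1 := by linarith [hfin.1]
    rw [← hp, hfin.1, t1]; simp

theorem layered_injOn (T : OTree V) (v : V) (Γ : V → ℝ × ℝ) (row : ℕ → ℝ)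
    (hrow : StrictAnti row)
    (hy : ∀ w, T.AncEq v w → (Γ w).2 = row (T.depth w))
    (hx : ∀ u w, T.AncEq v u → T.AncEq v w → T.depth u = T.depth w → T.LeftOf u w →
      (Γ u).1 < (Γ w).1) {u w : V} (hu : T.AncEq v u) (hw : T.AncEq v w) (h : Γ u = Γ w) :
    u = w := by
  have h2 : row (T.depth u) = row (T.depth w) := by rw [← hy u hu, ← hy w hw, h]
  have hd := hrow.injective h2
  by_contra hne
  rcases T.leftOf_or hd hne with h1 | h1
  · exact absurd (congrArg Prod.fst h) (hx _ _ hu hw hd h1).ne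
  · exact absurd (congrArg Prod.fst h) (hx _ _ hw hu hd.symm h1).ne'

theorem canon_edgesMeet (T : OTree V) {u w : V} (hu : u ≠ T.root) (hw : w ≠ T.root)
    (huw : u ≠ w) : EdgesMeet T T.canon u w :=
  layered_edgesMeet T T.root T.canon (fun d => -(d : ℝ))
    (fun a b h => by simpa using h) (fun _ _ => rfl)
    (fun _ _ _ _ _ h => by simpa [OTree.canon] using h.col_lt)
    ⟨T.ancEq_root u, hu⟩ ⟨T.ancEq_root w, hw⟩ huw

theorem canon_injective (T : OTree V) : Function.Injective T.canon := fun u w h =>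
  layered_injOn T T.root T.canon (fun d => -(d : ℝ))
    (fun a b h => by simpa using h) (fun _ _ => rfl)
    (fun _ _ _ _ _ h => by simpa [OTree.canon] using h.col_lt)
    (T.ancEq_root u) (T.ancEq_root w) h

/-- The cross product of two plane vectors. -/
def cross2 (p q : ℝ × ℝ) : ℝ := p.1 * q.2 - p.2 * q.1

/-- The dot product of two plane vectors. -/
def dot2 (p q : ℝ × ℝ) : ℝ := p.1 * q.1 + p.2 * q.2

/-- Complex multiplication: the similarity of the plane encoded by `o`, applied to `p`. -/
def rot (o p : ℝ × ℝ) : ℝ × ℝ := (o.1 * p.1 - o.2 * p.2, o.2 * p.1 + o.1 * p.2)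

/-- Points at sup-distance at most `r`. -/
def Near (r : ℝ) (p q : ℝ × ℝ) : Prop := |p.1 - q.1| ≤ r ∧ |p.2 - q.2| ≤ r

/-- Points with integer coordinates. -/
def IsIntPt (p : ℝ × ℝ) : Prop := ∃ a b : ℤ, p = ((a : ℝ), (b : ℝ))

/-- Vectors of sup-norm at most `N`. -/
def Bdd (N : ℝ) (p : ℝ × ℝ) : Prop := |p.1| ≤ N ∧ |p.2| ≤ N

theorem mem_segment_iff {a b p : ℝ × ℝ} :
    p ∈ segment ℝ a b ↔ ∃ t : ℝ, 0 ≤ t ∧ t ≤ 1 ∧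
      p = (a.1 + t * (b.1 - a.1), a.2 + t * (b.2 - a.2)) := by
  rw [segment_eq_image']
  constructor
  · rintro ⟨t, ⟨h0, h1⟩, rfl⟩
    exact ⟨t, h0, h1, by ext <;> simp⟩
  · rintro ⟨t, h0, h1, rfl⟩
    exact ⟨t, ⟨h0, h1⟩, by ext <;> simp⟩

theorem exists_unit_ratio {M E : ℤ} {s : ℝ} (hE : E ≠ 0) (h0 : 0 ≤ s) (h1 : s ≤ 1)
    (h : |(M : ℝ) + s * E| < 1) : ∃ s' : ℝ, 0 ≤ s' ∧ s' ≤ 1 ∧ (M : ℝ) + s' * E = 0 := by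
  rw [abs_lt] at h
  have hE' : (E : ℝ) ≠ 0 := by exact_mod_cast hE
  refine ⟨-M / E, ?_, ?_, by field_simp; ring⟩
  · rcases lt_or_gt_of_ne hE with hn | hp
    · have hn' : (E : ℝ) < 0 := by exact_mod_cast hn
      have : (-1 : ℝ) < M := by nlinarith
      have : -1 < M := by exact_mod_cast this
      have : (0 : ℝ) ≤ M := by exact_mod_cast (by omega : 0 ≤ M)
      exact div_nonneg_of_nonpos (by linarith) hn'.le
    · have hp' : (0 : ℝ) < E := by exact_mod_cast hp
      have : (M : ℝ) < 1 := by nlinarith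
      have : M < 1 := by exact_mod_cast this
      have : (M : ℝ) ≤ 0 := by exact_mod_cast (by omega : M ≤ 0)
      exact div_nonneg (by linarith) hp'.le
  · rcases lt_or_gt_of_ne hE with hn | hp
    · have hn' : (E : ℝ) < 0 := by exact_mod_cast hn
      rw [div_le_one_of_neg hn']
      have : (M : ℝ) + E < 1 := by nlinarith
      have : M + E < 1 := by exact_mod_cast this
      have : (M : ℝ) + E ≤ 0 := by exact_mod_cast (by omega : M + E ≤ 0)
      linarith
    · have hp' : (0 : ℝ) < E := by exact_mod_cast hp
      rw [div_le_one hp']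
      have : (-1 : ℝ) < M + E := by nlinarith
      have : -1 < M + E := by exact_mod_cast this
      have : (0 : ℝ) ≤ M + E := by exact_mod_cast (by omega : 0 ≤ M + E)
      linarith

theorem exists_unit_ratio₂ {A E F : ℤ} {s t : ℝ} (hE : 0 < E) (hs0 : 0 ≤ s) (hs1 : s ≤ 1)
    (ht0 : 0 ≤ t) (ht1 : t ≤ 1) (h : |(A : ℝ) + s * E - t * F| < 1) :
    ∃ s' t' : ℝ, 0 ≤ s' ∧ s' ≤ 1 ∧ 0 ≤ t' ∧ t' ≤ 1 ∧ (A : ℝ) + s' * E - t' * F = 0 := by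
  rw [abs_lt] at h
  have hE' : (0 : ℝ) < E := by exact_mod_cast hE
  have q1 : 0 ≤ s * E := mul_nonneg hs0 hE'.le
  have q2 : s * E ≤ E := by nlinarith
  have first : A ≤ 0 → 0 ≤ A + E →
      ∃ s' t' : ℝ, 0 ≤ s' ∧ s' ≤ 1 ∧ 0 ≤ t' ∧ t' ≤ 1 ∧ (A : ℝ) + s' * E - t' * F = 0 := by
    intro hA hAE
    have hA' : (A : ℝ) ≤ 0 := by exact_mod_cast hA
    have hAE' : (0 : ℝ) ≤ A + E := by exact_mod_cast hAE
    refine ⟨-A / E, 0, div_nonneg (by linarith) hE'.le, ?_, le_rfl, zero_le_one, ?_⟩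
    · rw [div_le_one hE']; linarith
    · field_simp; ring
  rcases le_or_gt 0 F with hF | hF
  · have hF' : (0 : ℝ) ≤ F := by exact_mod_cast hF
    have q3 : 0 ≤ t * F := mul_nonneg ht0 hF'
    have q4 : t * F ≤ F := by nlinarith
    have c1 : A - F < 1 := by exact_mod_cast (by linarith : (A : ℝ) - F < 1)
    have c2 : -1 < A + E := by exact_mod_cast (by linarith : (-1 : ℝ) < A + E)
    rcases le_or_gt A 0 with hA | hA
    · exact first hA (by omega)
    · have hFp : (0 : ℝ) < F := by exact_mod_cast (by omega : 0 < F)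
      have hA' : (0 : ℝ) < A := by exact_mod_cast hA
      have hAF : (A : ℝ) ≤ F := by exact_mod_cast (by omega : A ≤ F)
      refine ⟨0, A / F, le_rfl, zero_le_one, div_nonneg hA'.le hFp.le, ?_, ?_⟩
      · rw [div_le_one hFp]; exact hAF
      · field_simp; ring
  · have hF' : (F : ℝ) < 0 := by exact_mod_cast hF
    have q3 : t * F ≤ 0 := by nlinarith
    have q4 : (F : ℝ) ≤ t * F := by nlinarith
    have c1 : A < 1 := by exact_mod_cast (by linarith : (A : ℝ) < 1)
    have c2 : -1 < A + E - F := by exact_mod_cast (by linarith : (-1 : ℝ) < A + E - F)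
    rcases le_or_gt 0 (A + E) with hA | hA
    · exact first (by omega) hA
    · have hA' : (A : ℝ) + E < 0 := by exact_mod_cast hA
      have hAF : (F : ℝ) ≤ A + E := by exact_mod_cast (by omega : F ≤ A + E)
      refine ⟨1, (A + E) / F, zero_le_one, le_rfl, div_nonneg_of_nonpos hA'.le hF'.le, ?_, ?_⟩
      · rw [div_le_one_of_neg hF']; exact hAF
      · field_simp [hF'.ne]; ring

theorem abs_cross_lt {x y z w N r : ℝ} (hx : |x| ≤ r) (hy : |y| ≤ r) (hz : |z| ≤ N)
    (hw : |w| ≤ N) : |x * z + y * w| ≤ 2 * N * r := by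
  have h1 : |x * z| ≤ r * N := by
    rw [abs_mul]; exact mul_le_mul hx hz (abs_nonneg _) ((abs_nonneg _).trans hx)
  have h2 : |y * w| ≤ r * N := by
    rw [abs_mul]; exact mul_le_mul hy hw (abs_nonneg _) ((abs_nonneg _).trans hy)
  calc _ ≤ |x * z| + |y * w| := abs_add_le _ _
    _ ≤ _ := by linarith

/-- Disjoint lattice segments are not too close to each other. -/
theorem lattice_segments_clearance {a b c d p q : ℝ × ℝ} {N r : ℝ} (ha : IsIntPt a)
    (hb : IsIntPt b) (hc : IsIntPt c) (hd : IsIntPt d) (hab : a ≠ b)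
    (hab1 : |b.1 - a.1| ≤ N) (hab2 : |b.2 - a.2| ≤ N)
    (hcd1 : |d.1 - c.1| ≤ N) (hcd2 : |d.2 - c.2| ≤ N) (hr : 2 * N * r < 1)
    (hdis : ∀ x, x ∈ segment ℝ a b → x ∈ segment ℝ c d → False)
    (hp : p ∈ segment ℝ a b) (hq : q ∈ segment ℝ c d) (hpq : Near r p q) : False := by
  obtain ⟨a1, a2, rfl⟩ := ha
  obtain ⟨b1, b2, rfl⟩ := hb
  obtain ⟨c1, c2, rfl⟩ := hc
  obtain ⟨d1, d2, rfl⟩ := hd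
  obtain ⟨s, hs0, hs1, rfl⟩ := mem_segment_iff.1 hp
  obtain ⟨t, ht0, ht1, rfl⟩ := mem_segment_iff.1 hq
  obtain ⟨n1, n2⟩ := hpq
  simp only at *
  have fin : ∀ s' t' : ℝ, 0 ≤ s' → s' ≤ 1 → 0 ≤ t' → t' ≤ 1 →
      (a1 : ℝ) + s' * (b1 - a1) = c1 + t' * (d1 - c1) →
      (a2 : ℝ) + s' * (b2 - a2) = c2 + t' * (d2 - c2) → False := by
    intro s' t' h0 h1 h2 h3 e1 e2
    refine hdis _ (mem_segment_iff.2 ⟨s', h0, h1, rfl⟩) (mem_segment_iff.2 ⟨t', h2, h3, ?_⟩)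
    simp only [e1, e2]
  have hE : 0 < (b1 - a1) ^ 2 + (b2 - a2) ^ 2 := by
    by_contra h
    have h1 : b1 - a1 = 0 := by nlinarith [sq_nonneg (b1 - a1), sq_nonneg (b2 - a2)]
    have h2 : b2 - a2 = 0 := by nlinarith [sq_nonneg (b1 - a1), sq_nonneg (b2 - a2)]
    apply hab
    rw [sub_eq_zero.1 h1, sub_eq_zero.1 h2]
  by_cases hD : (b1 - a1) * (d2 - c2) - (b2 - a2) * (d1 - c1) = 0
  · have hD' : ((b1 : ℝ) - a1) * (d2 - c2) - (b2 - a2) * (d1 - c1) = 0 := by exact_mod_cast hD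
    have hM : (b1 - a1) * (a2 - c2) - (b2 - a2) * (a1 - c1) = 0 := by
      rw [← Int.abs_lt_one_iff]
      have h1 := abs_cross_lt n2 n1 hab1 (show |-((b2 : ℝ) - a2)| ≤ N by rwa [abs_neg])
      have h2 : |(((b1 - a1) * (a2 - c2) - (b2 - a2) * (a1 - c1) : ℤ) : ℝ)| < 1 := by
        refine lt_of_le_of_lt (le_of_eq ?_) (h1.trans_lt hr)
        congr 1
        push_cast
        linear_combination t * hD'
      exact_mod_cast h2
    have hM' : ((b1 : ℝ) - a1) * (a2 - c2) - (b2 - a2) * (a1 - c1) = 0 := by exact_mod_cast hM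
    have h3 := abs_cross_lt n1 n2 hab1 hab2
    obtain ⟨s', t', h0, h1, h2, h3, h4⟩ := exists_unit_ratio₂ (s := s) (t := t)
      (A := (b1 - a1) * (a1 - c1) + (b2 - a2) * (a2 - c2))
      (F := (b1 - a1) * (d1 - c1) + (b2 - a2) * (d2 - c2)) hE hs0 hs1 ht0 ht1 (by
        refine lt_of_le_of_lt (le_of_eq ?_) (h3.trans_lt hr)
        congr 1
        push_cast
        ring)
    push_cast at h4
    have hE' : 0 < ((b1 : ℝ) - a1) ^ 2 + (b2 - a2) ^ 2 := by exact_mod_cast hE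
    refine fin s' t' h0 h1 h2 h3 ?_ ?_
    · have : (((b1 : ℝ) - a1) ^ 2 + (b2 - a2) ^ 2) *
          ((a1 : ℝ) + s' * (b1 - a1) - (c1 + t' * (d1 - c1))) = 0 := by
        linear_combination ((b1 : ℝ) - a1) * h4 - ((b2 : ℝ) - a2) * hM' + t' * ((b2 : ℝ) - a2) * hD'
      rcases mul_eq_zero.1 this with h | h <;> linarith
    · have : (((b1 : ℝ) - a1) ^ 2 + (b2 - a2) ^ 2) *
          ((a2 : ℝ) + s' * (b2 - a2) - (c2 + t' * (d2 - c2))) = 0 := by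
        linear_combination ((b2 : ℝ) - a2) * h4 + ((b1 : ℝ) - a1) * hM' - t' * ((b1 : ℝ) - a1) * hD'
      rcases mul_eq_zero.1 this with h | h <;> linarith
  · have h1 := abs_cross_lt n1 n2 hcd2 (show |-((d1 : ℝ) - c1)| ≤ N by rwa [abs_neg])
    have h2 := abs_cross_lt n1 n2 hab2 (show |-((b1 : ℝ) - a1)| ≤ N by rwa [abs_neg])
    obtain ⟨s', hs0', hs1', hs'⟩ := exists_unit_ratio (s := s)
      (M := (a1 - c1) * (d2 - c2) - (a2 - c2) * (d1 - c1)) hD hs0 hs1 (by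
        refine lt_of_le_of_lt (le_of_eq ?_) (h1.trans_lt hr)
        congr 1
        push_cast
        ring)
    obtain ⟨t', ht0', ht1', ht'⟩ := exists_unit_ratio (s := t)
      (M := (a1 - c1) * (b2 - a2) - (a2 - c2) * (b1 - a1)) hD ht0 ht1 (by
        refine lt_of_le_of_lt (le_of_eq ?_) (h2.trans_lt hr)
        congr 1
        push_cast
        ring)
    push_cast at hs' ht'
    have hD' : ((b1 : ℝ) - a1) * (d2 - c2) - (b2 - a2) * (d1 - c1) ≠ 0 := by exact_mod_cast hD
    refine fin s' t' hs0' hs1' ht0' ht1' ?_ ?_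
    · have : (((b1 : ℝ) - a1) * (d2 - c2) - (b2 - a2) * (d1 - c1)) *
          ((a1 : ℝ) + s' * (b1 - a1) - (c1 + t' * (d1 - c1))) = 0 := by
        linear_combination ((b1 : ℝ) - a1) * hs' - ((d1 : ℝ) - c1) * ht'
      rcases mul_eq_zero.1 this with h | h
      · exact absurd h hD'
      · linarith
    · have : (((b1 : ℝ) - a1) * (d2 - c2) - (b2 - a2) * (d1 - c1)) *
          ((a2 : ℝ) + s' * (b2 - a2) - (c2 + t' * (d2 - c2))) = 0 := by
        linear_combination ((b2 : ℝ) - a2) * hs' - ((d2 : ℝ) - c2) * ht'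
      rcases mul_eq_zero.1 this with h | h
      · exact absurd h hD'
      · linarith

/-- Two vectors point in the same direction. -/
def SameDir (p q : ℝ × ℝ) : Prop := cross2 p q = 0 ∧ 0 < dot2 p q

theorem ne_zero_of_near_int {e g : ℝ × ℝ} {ε : ℝ} (he : IsIntPt e) (he0 : e ≠ 0) (hε : ε < 1)
    (hg : Near ε g e) : g ≠ 0 := by
  rintro rfl
  obtain ⟨a, b, rfl⟩ := he
  obtain ⟨h1, h2⟩ := hg
  simp only [Prod.fst_zero, Prod.snd_zero, zero_sub, abs_neg] at h1 h2
  have h1 : |a| < 1 := by exact_mod_cast h1.trans_lt hε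
  have h2 : |b| < 1 := by exact_mod_cast h2.trans_lt hε
  rw [Int.abs_lt_one_iff] at h1 h2
  exact he0 (by rw [h1, h2]; simp)

/-- Slight perturbations of lattice vectors with distinct directions have distinct directions. -/
theorem not_parallel_of_near_int {e e' g g' : ℝ × ℝ} {N ε l m : ℝ} (he : IsIntPt e)
    (he' : IsIntPt e') (he0 : e ≠ 0) (he0' : e' ≠ 0) (hN : 1 ≤ N) (hb : Bdd N e) (hb' : Bdd N e')
    (hε : 8 * N * ε ≤ 1) (hne : ¬ SameDir e e') (hg : Near ε g e) (hg' : Near ε g' e')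
    (hl : 0 < l) (hm : 0 < m) (h : l • g = m • g') : False := by
  have hε0 : 0 ≤ ε := (abs_nonneg _).trans hg.1
  have hε1 : ε ≤ 1 / 8 := by nlinarith
  have hgne := ne_zero_of_near_int he he0 (by linarith) hg
  have k1 : l * g.1 = m * g'.1 := by simpa using congrArg Prod.fst h
  have k2 : l * g.2 = m * g'.2 := by simpa using congrArg Prod.snd h
  have kc : g.1 * g'.2 - g.2 * g'.1 = 0 := by
    have : l * m * (g.1 * g'.2 - g.2 * g'.1) = 0 := by
      linear_combination m * g'.2 * k1 - m * g'.1 * k2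
    rcases mul_eq_zero.1 this with h | h
    · exact absurd h (mul_pos hl hm).ne'
    · exact h
  have kd : 0 < g.1 * g'.1 + g.2 * g'.2 := by
    have h1 : m * (g.1 * g'.1 + g.2 * g'.2) = l * (g.1 ^ 2 + g.2 ^ 2) := by
      linear_combination -g.1 * k1 - g.2 * k2
    have h2 : 0 < g.1 ^ 2 + g.2 ^ 2 := by
      by_contra hh
      apply hgne
      ext
      · simp; nlinarith [sq_nonneg g.1, sq_nonneg g.2]
      · simp; nlinarith [sq_nonneg g.1, sq_nonneg g.2]
    have h3 := mul_pos hl h2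
    rw [← h1] at h3
    exact (mul_pos_iff_of_pos_left hm).1 h3
  have hN0 : 0 ≤ N := by linarith
  have err : ∀ x y z w : ℝ, |x| ≤ ε → |y| ≤ ε → |z| ≤ N → |w| ≤ N → |x * z + y * w| ≤ 1 / 4 := by
    intro x y z w h1 h2 h3 h4
    exact (abs_cross_lt h1 h2 h3 h4).trans (by linarith)
  have err2 : ∀ x y z w : ℝ, |x| ≤ ε → |y| ≤ ε → |z| ≤ ε → |w| ≤ ε → |x * z + y * w| ≤ 1 / 4 := by
    intro x y z w h1 h2 h3 h4
    exact (abs_cross_lt h1 h2 h3 h4).trans (by nlinarith)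
  obtain ⟨a, b, rfl⟩ := he
  obtain ⟨a', b', rfl⟩ := he'
  obtain ⟨g1, g2⟩ := g
  obtain ⟨g1', g2'⟩ := g'
  obtain ⟨p1, p2⟩ := hg
  obtain ⟨p1', p2'⟩ := hg'
  obtain ⟨b1, b2⟩ := hb
  obtain ⟨b1', b2'⟩ := hb'
  simp only [SameDir, cross2, dot2] at *
  have p1m : |-(g1 - (a : ℝ))| ≤ ε := by rwa [abs_neg]
  have p1m' : |-(g1' - (a' : ℝ))| ≤ ε := by rwa [abs_neg]
  have p2m : |-(g2 - (b : ℝ))| ≤ ε := by rwa [abs_neg]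
  have c1 := abs_le.1 (err _ _ _ _ p1 p2m b2' b1')
  have c2 := abs_le.1 (err _ _ _ _ p2' p1m' b1 b2)
  have c3 := abs_le.1 (err2 _ _ _ _ p1 p2m p2' p1')
  have hcr : |((a * b' - b * a' : ℤ) : ℝ)| < 1 := by
    push_cast
    rw [abs_lt]
    constructor <;> nlinarith
  have hcr0 : a * b' - b * a' = 0 := by
    rw [← Int.abs_lt_one_iff]; exact_mod_cast hcr
  have hcr0' : (a : ℝ) * b' - b * a' = 0 := by exact_mod_cast hcr0
  have hdt : ¬ (0 < (a : ℝ) * a' + b * b') := fun h => hne ⟨hcr0', h⟩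
  have hdt' : a * a' + b * b' ≤ 0 := by
    have := not_lt.1 hdt
    exact_mod_cast this
  have hsq : (a * a' + b * b') ^ 2 = (a ^ 2 + b ^ 2) * (a' ^ 2 + b' ^ 2) := by
    linear_combination (-(a * b' - b * a')) * hcr0
  have pos : ∀ x y : ℤ, ((x : ℝ), (y : ℝ)) ≠ 0 → 0 < x ^ 2 + y ^ 2 := by
    intro x y hxy
    by_contra hh
    apply hxy
    have h1 : x = 0 := by nlinarith [sq_nonneg x, sq_nonneg y]
    have h2 : y = 0 := by nlinarith [sq_nonneg x, sq_nonneg y]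
    rw [h1, h2]; simp
  have hdne : a * a' + b * b' ≠ 0 := by
    intro h
    rw [h] at hsq
    have := mul_pos (pos a b he0) (pos a' b' he0')
    rw [← hsq] at this
    norm_num at this
  have hdle : a * a' + b * b' ≤ -1 := by omega
  have hdle' : (a : ℝ) * a' + b * b' ≤ -1 := by exact_mod_cast hdle
  have d1 := abs_le.1 (err _ _ _ _ p1 p2 b1' b2')
  have d2 := abs_le.1 (err _ _ _ _ p1' p2' b1 b2)
  have d3 := abs_le.1 (err2 _ _ _ _ p1 p2 p1' p2')
  nlinarith

/-- The side of the ray `u` on which a non-descending vector lies (`0` for descending vectors). -/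
noncomputable def sideSign (u e : ℝ × ℝ) : ℝ :=
  if e.2 < 0 then 0 else if 0 ≤ cross2 u e then 1 else -1

/-- Shear the upper half plane away from the ray `u` (amount `a`), then pull points
downwards proportionally to their distance from the vertical axis (amount `b`). -/
noncomputable def bend (u : ℝ × ℝ) (a b : ℝ) (e : ℝ × ℝ) : ℝ × ℝ :=
  (e.1 - 3 * a * sideSign u e * e.2, e.2 - b * |e.1 - 3 * a * sideSign u e * e.2|)

/-- A left inverse of `bend u a b`, defined on the whole plane by collapsing the gap. -/
noncomputable def unfold (u : ℝ × ℝ) (a b : ℝ) (p : ℝ × ℝ) : ℝ × ℝ :=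
  (p.1 - max (-(3 * a * max (p.2 + b * |p.1|) 0))
      (min (3 * a * max (p.2 + b * |p.1|) 0) (p.1 - u.1 / u.2 * (p.2 + b * |p.1|))),
    p.2 + b * |p.1|)

theorem unfold_smul (u : ℝ × ℝ) (a b : ℝ) (p : ℝ × ℝ) {l : ℝ} (hl : 0 ≤ l) :
    unfold u a b (l • p) = l • unfold u a b p := by
  have e1 : l * p.2 + b * |l * p.1| = l * (p.2 + b * |p.1|) := by
    rw [abs_mul, abs_of_nonneg hl]; ring
  have e2 : max (l * (p.2 + b * |p.1|)) 0 = l * max (p.2 + b * |p.1|) 0 := by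
    rw [mul_max_of_nonneg _ _ hl, mul_zero]
  ext
  · simp only [unfold, Prod.smul_fst, Prod.smul_snd, smul_eq_mul, e1, e2]
    rw [mul_sub, mul_max_of_nonneg (-_) _ hl, mul_min_of_nonneg _ _ hl]
    congr 3 <;> ring
  · simp only [unfold, Prod.smul_fst, Prod.smul_snd, smul_eq_mul, e1]

theorem abs_clamp_sub_le {A A' x x' d : ℝ} (hA : |A - A'| ≤ d) (hx : |x - x'| ≤ d) :
    |max (-A) (min A x) - max (-A') (min A' x')| ≤ d := by
  refine (abs_max_sub_max_le_max _ _ _ _).trans (max_le ?_ ?_)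
  · rwa [neg_sub_neg, abs_sub_comm]
  · exact (abs_min_sub_min_le_max _ _ _ _).trans (max_le hA hx)

theorem Near.unfold {u p q : ℝ × ℝ} {a b r : ℝ} (h : Near r p q) (hu : 0 < u.2) (hu1 : |u.1| ≤ u.2)
    (ha0 : 0 ≤ a) (ha1 : a ≤ 1) (hb0 : 0 ≤ b) (hb1 : b ≤ 1) :
    Near (7 * r) (unfold u a b p) (unfold u a b q) := by
  obtain ⟨h1, h2⟩ := h
  have hr : 0 ≤ r := (abs_nonneg _).trans h1
  have hx : |(|p.1| - |q.1|)| ≤ r := (abs_abs_sub_abs_le_abs_sub _ _).trans h1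
  have hy : |(p.2 + b * |p.1|) - (q.2 + b * |q.1|)| ≤ 2 * r := by
    rw [abs_le] at hx h2 ⊢
    constructor <;> nlinarith
  have hm : |u.1 / u.2| ≤ 1 := by
    rw [abs_div, abs_of_pos hu]; exact (div_le_one hu).2 hu1
  set y := p.2 + b * |p.1| with hyd
  set y' := q.2 + b * |q.1| with hyd'
  have hmax : |max y 0 - max y' 0| ≤ 2 * r := (abs_max_sub_max_le_abs _ _ _).trans hy
  have hA : |3 * a * max y 0 - 3 * a * max y' 0| ≤ 6 * r := by
    rw [← mul_sub, abs_mul, abs_of_nonneg (by positivity)]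
    nlinarith [abs_nonneg (max y 0 - max y' 0)]
  have hX : |(p.1 - u.1 / u.2 * y) - (q.1 - u.1 / u.2 * y')| ≤ 6 * r := by
    have : |u.1 / u.2 * (y - y')| ≤ 2 * r := by
      rw [abs_mul]; nlinarith [abs_nonneg (y - y'), abs_nonneg (u.1 / u.2)]
    rw [abs_le] at this h1 ⊢
    constructor <;> nlinarith
  have hc := abs_clamp_sub_le hA hX
  constructor
  · simp only [_root_.unfold]
    rw [abs_le] at hc h1 ⊢
    constructor <;> linarith
  · simp only [_root_.unfold]
    linarith

theorem unfold_bend {u : ℝ × ℝ} (e : ℝ × ℝ) {a : ℝ} (b : ℝ) (hu : 0 < u.2) (ha0 : 0 ≤ a) :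
    unfold u a b (bend u a b e) = e := by
  have e1 : (bend u a b e).2 + b * |(bend u a b e).1| = e.2 := by simp [bend]
  ext
  · simp only [unfold, e1]
    simp only [bend, sideSign]
    split_ifs with h1 h2
    · simp [max_eq_right h1.le]
    · push Not at h1
      have : e.1 ≤ u.1 / u.2 * e.2 := by
        rw [div_mul_eq_mul_div, le_div_iff₀ hu]; simp only [cross2] at h2; linarith
      have hA : 0 ≤ 3 * a * e.2 := by positivity
      rw [max_eq_left h1, min_eq_right (by linarith), max_eq_left (by linarith)]
      ring
    · push Not at h1 h2
      have : u.1 / u.2 * e.2 ≤ e.1 := by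
        rw [div_mul_eq_mul_div, div_le_iff₀ hu]; simp only [cross2] at h2; linarith
      have hA : 0 ≤ 3 * a * e.2 := by positivity
      rw [max_eq_left h1, min_eq_left (by linarith), max_eq_right (by linarith)]
      ring
  · simp only [unfold, e1]

theorem unfold_axis {u : ℝ × ℝ} {a b : ℝ} (hu : 0 < u.2) (hu1 : |u.1| ≤ u.2) (ha0 : 0 ≤ a)
    (hb0 : 0 ≤ b) (hb1 : b ≤ 1) (h : b = 0 ∨ a = 1) :
    ∃ s : ℝ, 0 < s ∧ unfold u a b u = s • u := by
  have hy : 0 < u.2 + b * |u.1| := by positivity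
  refine ⟨(u.2 + b * |u.1|) / u.2, by positivity, ?_⟩
  have hc : max (-(3 * a * max (u.2 + b * |u.1|) 0))
      (min (3 * a * max (u.2 + b * |u.1|) 0) (u.1 - u.1 / u.2 * (u.2 + b * |u.1|))) =
      u.1 - u.1 / u.2 * (u.2 + b * |u.1|) := by
    have e : u.1 - u.1 / u.2 * (u.2 + b * |u.1|) = -(u.1 / u.2 * b * |u.1|) := by
      field_simp; ring
    have hb : |u.1 - u.1 / u.2 * (u.2 + b * |u.1|)| ≤ 3 * a * max (u.2 + b * |u.1|) 0 := by
      rw [max_eq_left hy.le, e, abs_neg]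
      rcases h with rfl | rfl
      · simp; positivity
      · rw [abs_mul, abs_mul, abs_abs, abs_of_nonneg hb0]
        have : |u.1 / u.2| ≤ 1 := by
          rw [abs_div, abs_of_pos hu]; exact (div_le_one hu).2 hu1
        have h2 : |u.1 / u.2| * b ≤ 1 := by nlinarith [abs_nonneg (u.1 / u.2)]
        nlinarith [abs_nonneg u.1, mul_nonneg hb0 (abs_nonneg u.1)]
    rw [abs_le] at hb
    rw [min_eq_right hb.2, max_eq_right hb.1]
  ext
  · simp only [unfold, hc, Prod.smul_fst, smul_eq_mul]
    ring
  · simp only [unfold, Prod.smul_snd, smul_eq_mul]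
    field_simp

theorem near_inv_smul {p e : ℝ × ℝ} {k R : ℝ} (hk : 0 < k) (h : Near R p (k • e)) :
    Near (R / k) ((1 / k) • p) e := by
  obtain ⟨h1, h2⟩ := h
  simp only [Prod.smul_fst, Prod.smul_snd, smul_eq_mul] at h1 h2
  constructor
  · rw [Prod.smul_fst, smul_eq_mul, show 1 / k * p.1 - e.1 = (p.1 - k * e.1) / k by field_simp,
      abs_div, abs_of_pos hk]
    gcongr
  · rw [Prod.smul_snd, smul_eq_mul, show 1 / k * p.2 - e.2 = (p.2 - k * e.2) / k by field_simp,
      abs_div, abs_of_pos hk]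
    gcongr

theorem Near.unfold_of_bend {u e p : ℝ × ℝ} {a b k R : ℝ} (hu : 0 < u.2) (hu1 : |u.1| ≤ u.2)
    (ha0 : 0 ≤ a) (ha1 : a ≤ 1) (hb0 : 0 ≤ b) (hb1 : b ≤ 1) (hk : 0 < k)
    (h : Near R p (k • bend u a b e)) :
    Near (7 * R / k) ((1 / k) • _root_.unfold u a b p) e := by
  have := h.unfold hu hu1 ha0 ha1 hb0 hb1
  rw [unfold_smul _ _ _ _ hk.le, unfold_bend _ _ hu ha0] at this
  exact near_inv_smul hk this

theorem Near.weaken {r s : ℝ} {p q : ℝ × ℝ} (h : Near r p q) (hrs : r ≤ s) : Near s p q :=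
  ⟨h.1.trans hrs, h.2.trans hrs⟩

/-- Points close to bent copies of non-parallel lattice vectors lie on different rays. -/
theorem bend_separated {u e e' p q : ℝ × ℝ} {a b k k' K N R l m : ℝ} (hu : 0 < u.2)
    (hu1 : |u.1| ≤ u.2) (ha0 : 0 ≤ a) (ha1 : a ≤ 1) (hb0 : 0 ≤ b) (hb1 : b ≤ 1)
    (hK : 0 < K) (hk : K ≤ k) (hk' : K ≤ k') (hKN : 56 * N * R ≤ K) (hN : 1 ≤ N) (hR : 0 ≤ R)
    (he : IsIntPt e) (he' : IsIntPt e') (he0 : e ≠ 0) (he0' : e' ≠ 0)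
    (hb : Bdd N e) (hb' : Bdd N e') (hne : ¬ SameDir e e')
    (hp : Near R p (k • bend u a b e)) (hq : Near R q (k' • bend u a b e'))
    (hl : 0 < l) (hm : 0 < m) (h : l • p = m • q) : False := by
  have hk0 := hK.trans_le hk
  have hk0' := hK.trans_le hk'
  have hp' := (hp.unfold_of_bend hu hu1 ha0 ha1 hb0 hb1 hk0).weaken
    (show _ ≤ 7 * R / K by gcongr)
  have hq' := (hq.unfold_of_bend hu hu1 ha0 ha1 hb0 hb1 hk0').weaken
    (show _ ≤ 7 * R / K by gcongr)
  refine not_parallel_of_near_int (l := l * k) (m := m * k') he he' he0 he0' hN hb hb' ?_ hne hp' hq'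
    (by positivity) (by positivity) ?_
  · rw [mul_div_assoc', div_le_one hK]; linarith
  · rw [smul_smul, smul_smul, mul_assoc, mul_assoc, mul_one_div_cancel hk0.ne',
      mul_one_div_cancel hk0'.ne', mul_one, mul_one, ← unfold_smul _ _ _ _ hl.le, h,
      unfold_smul _ _ _ _ hm.le]

theorem bend_separated_zero {u e p : ℝ × ℝ} {a b k K R : ℝ} (hu : 0 < u.2)
    (hu1 : |u.1| ≤ u.2) (ha0 : 0 ≤ a) (ha1 : a ≤ 1) (hb0 : 0 ≤ b) (hb1 : b ≤ 1)
    (hK : 0 < K) (hk : K ≤ k) (hKN : 7 * R < K) (hR : 0 ≤ R)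
    (he : IsIntPt e) (he0 : e ≠ 0)
    (hp : Near R p (k • bend u a b e)) : p ≠ 0 := by
  rintro rfl
  have hk0 := hK.trans_le hk
  have hp' := (hp.unfold_of_bend hu hu1 ha0 ha1 hb0 hb1 hk0).weaken
    (show _ ≤ 7 * R / K by gcongr)
  refine ne_zero_of_near_int he he0 ((div_lt_one hK).2 hKN) hp' ?_
  have := unfold_smul u a b 0 (le_refl (0 : ℝ))
  simp only [zero_smul] at this
  rw [this, smul_zero]

theorem bend_separated_axis {u e p : ℝ × ℝ} {a b k K N R l m : ℝ} (hu : 0 < u.2)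
    (hu1 : |u.1| ≤ u.2) (ha0 : 0 ≤ a) (ha1 : a ≤ 1) (hb0 : 0 ≤ b) (hb1 : b ≤ 1)
    (hab : b = 0 ∨ a = 1)
    (hK : 0 < K) (hk : K ≤ k) (hKN : 56 * N * R ≤ K) (hN : 1 ≤ N) (hR : 0 ≤ R)
    (he : IsIntPt e) (hui : IsIntPt u) (he0 : e ≠ 0)
    (hb : Bdd N e) (hb' : Bdd N u) (hne : ¬ SameDir e u)
    (hp : Near R p (k • bend u a b e))
    (hl : 0 < l) (hm : 0 < m) (h : l • p = m • u) : False := by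
  have hk0 := hK.trans_le hk
  have hp' := (hp.unfold_of_bend hu hu1 ha0 ha1 hb0 hb1 hk0).weaken
    (show _ ≤ 7 * R / K by gcongr)
  obtain ⟨s, hs, hsu⟩ := unfold_axis hu hu1 ha0 hb0 hb1 hab
  refine not_parallel_of_near_int (l := l * k) (m := m * s) (g' := u) he hui he0 ?_ hN hb hb' ?_ hne
    hp' ?_ (by positivity) (by positivity) ?_
  · rintro rfl; simp at hu
  · rw [mul_div_assoc', div_le_one hK]; linarith
  · constructor <;> simp <;> positivity
  · rw [smul_smul, mul_assoc, mul_one_div_cancel hk0.ne', mul_one, ← unfold_smul _ _ _ _ hl.le, h,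
      unfold_smul _ _ _ _ hm.le, hsu, smul_smul]

theorem bend_zero (u e : ℝ × ℝ) : bend u 0 0 e = e := by
  ext <;> simp [bend]

theorem lerp_bend_fst (u e : ℝ × ℝ) (t : ℝ) :
    (1 - t) • e + t • bend u 1 0 e = bend u t 0 e := by
  ext <;> simp [bend] <;> ring

theorem lerp_bend_snd (u e : ℝ × ℝ) (t : ℝ) :
    (1 - t) • bend u 1 0 e + t • bend u 1 1 e = bend u 1 t e := by
  ext <;> simp [bend] <;> ring

/-- `e` makes a counterclockwise angle in `[0, π)` with `u`. -/
def UpTurn (u e : ℝ × ℝ) : Prop := 0 < cross2 u e ∨ (cross2 u e = 0 ∧ 0 < dot2 u e)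

/-- Rotating counterclockwise from `u`, the direction of `e` is met before that of `e'`. -/
def Before (u e e' : ℝ × ℝ) : Prop :=
  (UpTurn u e ∧ ¬ UpTurn u e') ∨ ((UpTurn u e ↔ UpTurn u e') ∧ 0 < cross2 e e')

theorem normAngle_mem (a θ : ℝ) : a ≤ normAngle a θ ∧ normAngle a θ < a + 2 * π := by
  have h := Int.floor_le ((θ - a) / (2 * π))
  have h' := Int.lt_floor_add_one ((θ - a) / (2 * π))
  have hp := Real.two_pi_pos
  rw [le_div_iff₀ hp] at h
  rw [div_lt_iff₀ hp] at h'
  unfold normAngle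
  constructor <;> linarith

theorem exists_polar (a : ℝ) {p q : ℝ × ℝ} (h : p ≠ q) :
    ∃ r : ℝ, 0 < r ∧ q.1 - p.1 = r * Real.cos (normAngle a (dirAngle p q)) ∧
      q.2 - p.2 = r * Real.sin (normAngle a (dirAngle p q)) := by
  set z : ℂ := Complex.ofReal (q.1 - p.1) + Complex.ofReal (q.2 - p.2) * Complex.I with hz
  have hre : z.re = q.1 - p.1 := by simp [hz]
  have him : z.im = q.2 - p.2 := by simp [hz]
  have hz0 : z ≠ 0 := by
    intro h0
    apply h
    rw [h0] at hre him
    simp only [Complex.zero_re, Complex.zero_im] at hre him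
    ext <;> linarith
  refine ⟨‖z‖, norm_pos_iff.2 hz0, ?_, ?_⟩
  · rw [normAngle, mul_comm (2 * π), Real.cos_sub_int_mul_two_pi, dirAngle, ← hz, ← hre,
      Complex.norm_mul_cos_arg]
  · rw [normAngle, mul_comm (2 * π), Real.sin_sub_int_mul_two_pi, dirAngle, ← hz, ← him,
      Complex.norm_mul_sin_arg]

theorem upTurn_iff_of_polar {u e : ℝ × ℝ} {r s θ α : ℝ} (hr : 0 < r) (hs : 0 < s)
    (hu : u = (r * Real.cos θ, r * Real.sin θ)) (he : e = (s * Real.cos α, s * Real.sin α))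
    (h0 : θ ≤ α) (h1 : α < θ + 2 * π) : UpTurn u e ↔ α < θ + π := by
  have hc : cross2 u e = r * s * Real.sin (α - θ) := by
    subst hu he; simp only [cross2, Real.sin_sub]; ring
  have hd : dot2 u e = r * s * Real.cos (α - θ) := by
    subst hu he; simp only [dot2, Real.cos_sub]; ring
  have hrs := mul_pos hr hs
  unfold UpTurn
  rw [hc, hd]
  constructor
  · intro h
    by_contra hge
    push Not at hge
    have hsin : Real.sin (α - θ) ≤ 0 := by
      have := Real.sin_nonneg_of_nonneg_of_le_pi (x := α - θ - π) (by linarith) (by linarith)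
      rw [Real.sin_sub_pi] at this
      linarith
    rcases h with h | ⟨h2, h3⟩
    · nlinarith
    · have h2 : Real.sin (α - θ) = 0 := by
        rcases mul_eq_zero.1 h2 with h | h
        · exact absurd h hrs.ne'
        · exact h
      have h3 : 0 < Real.cos (α - θ) := by
        by_contra h; push Not at h; nlinarith
      rcases eq_or_lt_of_le hge with h4 | h4
      · rw [show α - θ = π by linarith, Real.cos_pi] at h3; linarith
      · have := Real.sin_pos_of_pos_of_lt_pi (x := α - θ - π) (by linarith) (by linarith)
        rw [Real.sin_sub_pi] at this
        linarith
  · intro h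
    rcases eq_or_lt_of_le h0 with h4 | h4
    · right
      rw [h4]; simp [hrs]
    · left
      exact mul_pos hrs (Real.sin_pos_of_pos_of_lt_pi (by linarith) (by linarith))

theorem before_of_polar {u e e' : ℝ × ℝ} {r s s' θ α β : ℝ} (hr : 0 < r) (hs : 0 < s) (hs' : 0 < s')
    (hu : u = (r * Real.cos θ, r * Real.sin θ)) (he : e = (s * Real.cos α, s * Real.sin α))
    (he' : e' = (s' * Real.cos β, s' * Real.sin β))
    (h0 : θ ≤ α) (hab : α < β) (h1 : β < θ + 2 * π) : Before u e e' := by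
  have i1 := upTurn_iff_of_polar hr hs hu he h0 (hab.trans h1)
  have i2 := upTurn_iff_of_polar hr hs' hu he' (h0.trans hab.le) h1
  have hc : cross2 e e' = s * s' * Real.sin (β - α) := by
    subst he he'; simp only [cross2, Real.sin_sub]; ring
  unfold Before
  rw [i1, i2, hc]
  by_cases ha : α < θ + π <;> by_cases hb : β < θ + π
  · right
    exact ⟨by simp [ha, hb], mul_pos (mul_pos hs hs')
      (Real.sin_pos_of_pos_of_lt_pi (by linarith) (by linarith))⟩
  · left; exact ⟨ha, hb⟩
  · exact absurd (hab.trans hb) ha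
  · right
    exact ⟨by simp [ha, hb], mul_pos (mul_pos hs hs')
      (Real.sin_pos_of_pos_of_lt_pi (by linarith) (by push Not at ha; linarith))⟩

theorem before_of_angFrom {W : Type} {Γ : W → ℝ × ℝ} (hΓ : Function.Injective Γ) {a : ℝ} {v w c c' : W}
    (hw : w ≠ v) (hc : c ≠ v) (hc' : c' ≠ v) (h0 : angFrom Γ a v w ≤ angFrom Γ a v c)
    (h1 : angFrom Γ a v c < angFrom Γ a v c') :
    Before (Γ w - Γ v) (Γ c - Γ v) (Γ c' - Γ v) := by
  obtain ⟨r, hr, r1, r2⟩ := exists_polar a (hΓ.ne hw.symm)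
  obtain ⟨s, hs, s1, s2⟩ := exists_polar a (hΓ.ne hc.symm)
  obtain ⟨s', hs', t1, t2⟩ := exists_polar a (hΓ.ne hc'.symm)
  refine before_of_polar hr hs hs' (Prod.ext r1 r2) (Prod.ext s1 s2) (Prod.ext t1 t2) h0 h1 ?_
  have h2 := (normAngle_mem a (dirAngle (Γ v) (Γ c'))).2
  have h3 := (normAngle_mem a (dirAngle (Γ v) (Γ w))).1
  linarith

/-- The four axis directions, as unit complex numbers. -/
def IsDir (o : ℝ × ℝ) : Prop := o = (1, 0) ∨ o = (0, 1) ∨ o = (-1, 0) ∨ o = (0, -1)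

/-- Complex conjugation. -/
def conj2 (o : ℝ × ℝ) : ℝ × ℝ := (o.1, -o.2)

theorem IsDir.sq {o : ℝ × ℝ} (h : IsDir o) : o.1 * o.1 + o.2 * o.2 = 1 := by
  rcases h with rfl | rfl | rfl | rfl <;> norm_num

theorem IsDir.abs_add {o : ℝ × ℝ} (h : IsDir o) : |o.1| + |o.2| = 1 := by
  rcases h with rfl | rfl | rfl | rfl <;> norm_num

theorem IsDir.conj {o : ℝ × ℝ} (h : IsDir o) : IsDir (conj2 o) := by
  rcases h with rfl | rfl | rfl | rfl <;> simp [IsDir, conj2]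

theorem IsDir.rot {o o' : ℝ × ℝ} (h : IsDir o) (h' : IsDir o') : IsDir (rot o o') := by
  rcases h with rfl | rfl | rfl | rfl <;> rcases h' with rfl | rfl | rfl | rfl <;>
    simp [IsDir, _root_.rot]

theorem rot_rot (o o' p : ℝ × ℝ) : rot o (rot o' p) = rot (rot o o') p := by
  ext <;> simp [rot] <;> ring

theorem rot_rot_conj {o : ℝ × ℝ} (h : IsDir o) (p : ℝ × ℝ) : rot o (rot (conj2 o) p) = p := by
  have := h.sq
  ext <;> simp only [rot, conj2]
  · linear_combination p.1 * this
  · linear_combination p.2 * this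

theorem cross2_rot {o : ℝ × ℝ} (h : IsDir o) (p q : ℝ × ℝ) :
    cross2 (rot o p) (rot o q) = cross2 p q := by
  have := h.sq
  simp only [rot, cross2]
  linear_combination (p.1 * q.2 - p.2 * q.1) * this

theorem dot2_rot {o : ℝ × ℝ} (h : IsDir o) (p q : ℝ × ℝ) :
    dot2 (rot o p) (rot o q) = dot2 p q := by
  have := h.sq
  simp only [rot, dot2]
  linear_combination (p.1 * q.1 + p.2 * q.2) * this

theorem Before.rot {o u e e' : ℝ × ℝ} (h : IsDir o) (hb : Before u e e') :
    Before (rot o u) (rot o e) (rot o e') := by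
  simpa only [Before, UpTurn, cross2_rot h, dot2_rot h] using hb

theorem SameDir.of_rot {o p q : ℝ × ℝ} (h : IsDir o) (hs : SameDir (rot o p) (rot o q)) :
    SameDir p q := by
  simpa only [SameDir, cross2_rot h, dot2_rot h] using hs

/-- The half-open quarter plane around the positive vertical axis. -/
def UpCone (u : ℝ × ℝ) : Prop := -u.2 ≤ u.1 ∧ u.1 < u.2

theorem exists_dir_upCone {u : ℝ × ℝ} (hu : u ≠ 0) : ∃ o, IsDir o ∧ UpCone (rot (conj2 o) u) := by
  by_cases h1 : u.1 < u.2 ∧ -u.2 ≤ u.1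
  · exact ⟨(1, 0), by simp [IsDir], by simp [UpCone, rot, conj2, h1]⟩
  by_cases h2 : u.1 ≤ u.2 ∧ u.2 < -u.1
  · refine ⟨(0, 1), by simp [IsDir], ?_⟩
    simp only [UpCone, rot, conj2]; constructor <;> linarith
  by_cases h3 : u.2 ≤ u.1 ∧ -u.1 < u.2
  · refine ⟨(0, -1), by simp [IsDir], ?_⟩
    simp only [UpCone, rot, conj2]; constructor <;> linarith
  refine ⟨(-1, 0), by simp [IsDir], ?_⟩
  simp only [UpCone, rot, conj2]
  rcases lt_trichotomy u.1 u.2 with h | h | h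
  · by_cases h' : -u.2 ≤ u.1
    · exact absurd ⟨h, h'⟩ h1
    · exact absurd ⟨h.le, by linarith⟩ h2
  · rcases lt_trichotomy u.1 0 with h' | h' | h'
    · exact absurd ⟨h.le, by linarith⟩ h2
    · exact absurd (Prod.ext h' (h ▸ h')) hu
    · exact absurd ⟨h.ge, by linarith⟩ h3
  · by_cases h' : -u.1 < u.2
    · exact absurd ⟨h.le, h'⟩ h3
    · constructor <;> linarith

theorem UpCone.pos {u : ℝ × ℝ} (h : UpCone u) : 0 < u.2 := by
  unfold UpCone at h; linarith [h.1, h.2]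

theorem UpCone.abs_le {u : ℝ × ℝ} (h : UpCone u) : |u.1| ≤ u.2 :=
  _root_.abs_le.2 ⟨h.1, h.2.le⟩

theorem le_of_cross_nonneg {u e : ℝ × ℝ} (hu : UpCone u) (he : 0 ≤ e.2) (h : 0 ≤ cross2 u e) :
    e.1 ≤ e.2 := by
  have := hu.pos
  unfold UpCone at hu; unfold cross2 at h
  by_contra hlt
  nlinarith [mul_nonneg he (sub_nonneg.2 hu.2.le)]

theorem neg_le_of_cross_neg {u e : ℝ × ℝ} (hu : UpCone u) (he : 0 ≤ e.2) (h : cross2 u e < 0) :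
    -e.2 ≤ e.1 := by
  have := hu.pos
  unfold UpCone at hu; unfold cross2 at h
  by_contra hlt
  nlinarith [mul_nonneg he (neg_le_iff_add_nonneg.1 hu.1)]

/-- Left upper, lower and right upper parts of the plane cut along `u`. -/
theorem sideSign_cases {u : ℝ × ℝ} (hu : UpCone u) (e : ℝ × ℝ) :
    (e.2 < 0 ∧ sideSign u e = 0) ∨
    (0 ≤ e.2 ∧ sideSign u e = 1 ∧ 0 ≤ cross2 u e ∧ e.1 ≤ e.2) ∨
    (0 ≤ e.2 ∧ sideSign u e = -1 ∧ cross2 u e < 0 ∧ -e.2 ≤ e.1) := by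
  unfold sideSign
  split_ifs with h1 h2
  · exact Or.inl ⟨h1, rfl⟩
  · push Not at h1
    exact Or.inr (Or.inl ⟨h1, rfl, h2, le_of_cross_nonneg hu h1 h2⟩)
  · push Not at h1 h2
    exact Or.inr (Or.inr ⟨h1, rfl, h2, neg_le_of_cross_neg hu h1 h2⟩)

theorem bend_snd_neg {u : ℝ × ℝ} (hu : UpCone u) {e : ℝ × ℝ} (he : e ≠ 0) :
    (bend u 1 1 e).2 < 0 := by
  have hne : e.2 = 0 → e.1 ≠ 0 := fun h2 h1 => he (Prod.ext h1 h2)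
  simp only [bend]
  rcases sideSign_cases hu e with ⟨h, hs⟩ | ⟨h, hs, -, h'⟩ | ⟨h, hs, -, h'⟩ <;> rw [hs]
  · have := abs_nonneg (e.1 - 3 * 1 * 0 * e.2); linarith
  · rw [abs_of_nonpos (by linarith)]
    rcases eq_or_lt_of_le h with h0 | h0
    · have := lt_of_le_of_ne (h'.trans h0.symm.le) (hne h0.symm); linarith
    · linarith
  · rw [abs_of_nonneg (by linarith)]
    rcases eq_or_lt_of_le h with h0 | h0
    · have := lt_of_le_of_ne (by linarith : 0 ≤ e.1) (hne h0.symm).symm; linarith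
    · linarith

theorem abs_bend_le {u : ℝ × ℝ} (hu : UpCone u) (e : ℝ × ℝ) :
    |(bend u 1 1 e).1| ≤ 2 * -(bend u 1 1 e).2 ∧ |e.2| ≤ -(bend u 1 1 e).2 ∧
      |e.1| ≤ 5 * -(bend u 1 1 e).2 := by
  simp only [bend]
  rcases sideSign_cases hu e with ⟨h, hs⟩ | ⟨h, hs, -, h'⟩ | ⟨h, hs, -, h'⟩ <;> rw [hs]
  · simp only [mul_zero, zero_mul, sub_zero, one_mul]
    rw [abs_of_neg h]
    have := abs_nonneg e.1
    refine ⟨?_, ?_, ?_⟩ <;> linarith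
  · rw [abs_of_nonpos (by linarith : e.1 - 3 * 1 * 1 * e.2 ≤ 0), abs_of_nonneg h]
    refine ⟨by linarith, by linarith, abs_le.2 ⟨by linarith, by linarith⟩⟩
  · rw [abs_of_nonneg (by linarith : 0 ≤ e.1 - 3 * 1 * -1 * e.2), abs_of_nonneg h]
    refine ⟨by linarith, by linarith, abs_le.2 ⟨by linarith, by linarith⟩⟩

theorem neg_bend_le {u e : ℝ × ℝ} {N : ℝ} (hb : Bdd N e) : -(bend u 1 1 e).2 ≤ 5 * N := by
  obtain ⟨h1, h2⟩ := hb
  rw [abs_le] at h1 h2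
  have hs : sideSign u e = 0 ∨ sideSign u e = 1 ∨ sideSign u e = -1 := by
    unfold sideSign; split_ifs <;> simp
  have h : |e.1 - 3 * 1 * sideSign u e * e.2| ≤ 4 * N := by
    rw [abs_le]
    rcases hs with hs | hs | hs <;> rw [hs] <;> constructor <;> linarith
  simp only [bend]
  linarith

theorem isIntPt_bend {u e : ℝ × ℝ} (he : IsIntPt e) : IsIntPt (bend u 1 1 e) := by
  obtain ⟨a, b, rfl⟩ := he
  have hs : ∃ z : ℤ, sideSign u ((a : ℝ), (b : ℝ)) = z := by
    unfold sideSign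
    split_ifs
    · exact ⟨0, by simp⟩
    · exact ⟨1, by simp⟩
    · exact ⟨-1, by simp⟩
  obtain ⟨z, hz⟩ := hs
  refine ⟨a - 3 * z * b, b - |a - 3 * z * b|, ?_⟩
  simp only [bend, hz]
  push_cast
  simp

theorem one_le_neg_bend {u : ℝ × ℝ} (hu : UpCone u) {e : ℝ × ℝ} (he : IsIntPt e) (he0 : e ≠ 0) :
    1 ≤ -(bend u 1 1 e).2 := by
  have h := bend_snd_neg hu he0
  obtain ⟨a, b, hab⟩ := isIntPt_bend (u := u) he
  rw [hab] at h ⊢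
  simp only at h ⊢
  have : b < 0 := by exact_mod_cast h
  have : (b : ℝ) ≤ -1 := by exact_mod_cast (by omega : b ≤ -1)
  linarith

theorem upTurn_of_cross_nonneg {u : ℝ × ℝ} (hu : UpCone u) {e : ℝ × ℝ} (he : e ≠ 0) (h : 0 ≤ e.2)
    (hc : 0 ≤ cross2 u e) : UpTurn u e := by
  rcases eq_or_lt_of_le hc with h0 | h0
  · right
    refine ⟨h0.symm, ?_⟩
    have hp := hu.pos
    unfold cross2 at h0
    have hx : e.1 = u.1 / u.2 * e.2 := by field_simp; linarith
    have hy : e.2 ≠ 0 := by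
      intro hy
      rw [hy, mul_zero] at hx
      exact he (Prod.ext hx hy)
    have hy : 0 < e.2 := lt_of_le_of_ne h hy.symm
    unfold dot2
    rw [hx]
    have : u.1 * (u.1 / u.2 * e.2) + u.2 * e.2 = e.2 * (u.1 ^ 2 + u.2 ^ 2) / u.2 := by
      field_simp
    rw [this]
    positivity
  · exact Or.inl h0

theorem UpTurn.cross_nonneg {u e : ℝ × ℝ} (h : UpTurn u e) : 0 ≤ cross2 u e := by
  rcases h with h | h
  · exact h.le
  · exact h.1.ge

theorem cross_nonpos_of_not_upTurn {u e : ℝ × ℝ} (h : ¬ UpTurn u e) : cross2 u e ≤ 0 := by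
  by_contra h'
  exact h (Or.inl (not_le.1 h'))

/-- Bending opens the plane along `u` and keeps the order of directions. -/
theorem cross_bend_nonneg {u : ℝ × ℝ} (hu : UpCone u) {e e' : ℝ × ℝ} (he : e ≠ 0) (he' : e' ≠ 0)
    (h : Before u e e') : 0 ≤ cross2 (bend u 1 1 e) (bend u 1 1 e') := by
  have hp := hu.pos
  have key : (UpTurn u e ∧ ¬ UpTurn u e') ∨ (UpTurn u e ∧ UpTurn u e' ∧ 0 < cross2 e e') ∨
      (¬ UpTurn u e ∧ ¬ UpTurn u e' ∧ 0 < cross2 e e') := by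
    rcases h with h | ⟨h, h'⟩
    · exact Or.inl h
    · by_cases h1 : UpTurn u e
      · exact Or.inr (Or.inl ⟨h1, h.1 h1, h'⟩)
      · exact Or.inr (Or.inr ⟨h1, fun h2 => h1 (h.2 h2), h'⟩)
  rcases sideSign_cases hu e with ⟨y1, s1⟩ | ⟨y1, s1, c1, x1⟩ | ⟨y1, s1, c1, x1⟩ <;>
  rcases sideSign_cases hu e' with ⟨y2, s2⟩ | ⟨y2, s2, c2, x2⟩ | ⟨y2, s2, c2, x2⟩ <;>
  simp only [bend, s1, s2]
  · -- both vectors descend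
    have hcr : 0 ≤ cross2 e e' := by
      rcases key with ⟨k1, k2⟩ | ⟨-, -, k⟩ | ⟨-, -, k⟩
      · have k1 := k1.cross_nonneg
        have k2 := cross_nonpos_of_not_upTurn k2
        simp only [cross2] at k1 k2 ⊢
        have : 0 ≤ u.2 * (e.1 * e'.2 - e.2 * e'.1) := by nlinarith
        exact nonneg_of_mul_nonneg_right this hp
      · exact k.le
      · exact k.le
    simp only [cross2] at hcr ⊢
    simp only [mul_zero, zero_mul, sub_zero, one_mul]
    rcases le_total e.1 0 with a1 | a1 <;> rcases le_total e'.1 0 with a2 | a2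
    · rw [abs_of_nonpos a1, abs_of_nonpos a2]; nlinarith
    · rw [abs_of_nonpos a1, abs_of_nonneg a2]; nlinarith
    · rw [abs_of_nonneg a1, abs_of_nonpos a2]
      nlinarith [mul_nonneg a1 (neg_nonneg.2 y2.le), mul_nonneg (neg_nonneg.2 y1.le)
        (neg_nonneg.2 a2), mul_nonneg a1 (neg_nonneg.2 a2)]
    · rw [abs_of_nonneg a1, abs_of_nonneg a2]; nlinarith
  · exfalso
    have t2 := upTurn_of_cross_nonneg hu he' y2 c2
    rcases key with ⟨-, k2⟩ | ⟨k1, -, k⟩ | ⟨-, k2, -⟩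
    · exact k2 t2
    · have k1 := k1.cross_nonneg
      simp only [cross2] at k1 c2 k
      have : u.2 * (e.1 * e'.2 - e.2 * e'.1) ≤ 0 := by nlinarith
      nlinarith
    · exact k2 t2
  · simp only [cross2]
    rw [abs_of_nonneg (by linarith : 0 ≤ e'.1 - 3 * 1 * -1 * e'.2)]
    rcases le_total e.1 0 with a1 | a1
    · rw [abs_of_nonpos (by linarith : e.1 - 3 * 1 * 0 * e.2 ≤ 0)]
      nlinarith [mul_nonneg (neg_nonneg.2 a1) (by linarith : 0 ≤ e'.1 + e'.2),
        mul_nonneg (neg_nonneg.2 a1) y2,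
        mul_nonneg (neg_nonneg.2 y1.le) (by linarith : 0 ≤ e'.1 + 3 * e'.2)]
    · rw [abs_of_nonneg (by linarith : 0 ≤ e.1 - 3 * 1 * 0 * e.2)]
      have t2 : ¬ UpTurn u e' := fun h => absurd h.cross_nonneg (not_le.2 c2)
      nlinarith [mul_nonneg a1 y2, mul_nonneg (neg_nonneg.2 y1.le)
        (by linarith : 0 ≤ e'.1 + 3 * e'.2)]
  · simp only [cross2]
    rw [abs_of_nonpos (by linarith : e.1 - 3 * 1 * 1 * e.2 ≤ 0)]
    rcases le_total e'.1 0 with a2 | a2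
    · rw [abs_of_nonpos (by linarith : e'.1 - 3 * 1 * 0 * e'.2 ≤ 0)]
      nlinarith [mul_nonneg y1 (neg_nonneg.2 a2), mul_nonneg (neg_nonneg.2 y2.le)
        (by linarith : 0 ≤ 3 * e.2 - e.1)]
    · rw [abs_of_nonneg (by linarith : 0 ≤ e'.1 - 3 * 1 * 0 * e'.2)]
      nlinarith [mul_nonneg (neg_nonneg.2 y2.le) (by linarith : 0 ≤ 3 * e.2 - e.1),
        mul_nonneg a2 (by linarith : 0 ≤ e.2 - e.1), mul_nonneg a2 y1]
  · have t1 := upTurn_of_cross_nonneg hu he y1 c1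
    have t2 := upTurn_of_cross_nonneg hu he' y2 c2
    have k : 0 < cross2 e e' := by
      rcases key with ⟨-, k2⟩ | ⟨-, -, k⟩ | ⟨-, -, k⟩
      · exact absurd t2 k2
      · exact k
      · exact k
    simp only [cross2] at k ⊢
    rw [abs_of_nonpos (by linarith : e.1 - 3 * 1 * 1 * e.2 ≤ 0),
      abs_of_nonpos (by linarith : e'.1 - 3 * 1 * 1 * e'.2 ≤ 0)]
    nlinarith
  · simp only [cross2]
    rw [abs_of_nonpos (by linarith : e.1 - 3 * 1 * 1 * e.2 ≤ 0),
      abs_of_nonneg (by linarith : 0 ≤ e'.1 - 3 * 1 * -1 * e'.2)]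
    nlinarith [mul_nonneg (by linarith : 0 ≤ e.2 - e.1) (by linarith : 0 ≤ e'.1 + e'.2),
      mul_nonneg y1 y2, mul_nonneg (by linarith : 0 ≤ e.2 - e.1) y2,
      mul_nonneg y1 (by linarith : 0 ≤ e'.1 + e'.2)]
  · exfalso
    have t1 : ¬ UpTurn u e := fun h => absurd h.cross_nonneg (not_le.2 c1)
    rcases key with ⟨k1, -⟩ | ⟨k1, -, -⟩ | ⟨-, k2, k⟩
    · exact t1 k1
    · exact t1 k1
    · have k2 := cross_nonpos_of_not_upTurn k2
      simp only [cross2] at k2 c1 k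
      have : u.2 * (e.1 * e'.2 - e.2 * e'.1) ≤ 0 := by nlinarith
      nlinarith
  · exfalso
    have t1 : ¬ UpTurn u e := fun h => absurd h.cross_nonneg (not_le.2 c1)
    have t2 := upTurn_of_cross_nonneg hu he' y2 c2
    rcases key with ⟨k1, -⟩ | ⟨k1, -, -⟩ | ⟨-, k2, -⟩
    · exact t1 k1
    · exact t1 k1
    · exact k2 t2
  · have t1 : ¬ UpTurn u e := fun h => absurd h.cross_nonneg (not_le.2 c1)
    have t2 : ¬ UpTurn u e' := fun h => absurd h.cross_nonneg (not_le.2 c2)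
    have k : 0 < cross2 e e' := by
      rcases key with ⟨k1, -⟩ | ⟨-, -, k⟩ | ⟨-, -, k⟩
      · exact absurd k1 t1
      · exact k
      · exact k
    simp only [cross2] at k ⊢
    rw [abs_of_nonneg (by linarith : 0 ≤ e.1 - 3 * 1 * -1 * e.2),
      abs_of_nonneg (by linarith : 0 ≤ e'.1 - 3 * 1 * -1 * e'.2)]
    nlinarith

/-- Coordinatewise integer part. -/
noncomputable def flr (p : ℝ × ℝ) : ℝ × ℝ := ((⌊p.1⌋ : ℝ), (⌊p.2⌋ : ℝ))

theorem isIntPt_flr (p : ℝ × ℝ) : IsIntPt (flr p) := ⟨⌊p.1⌋, ⌊p.2⌋, rfl⟩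

theorem near_flr (p : ℝ × ℝ) : Near 1 (flr p) p := by
  constructor <;> rw [abs_le] <;> simp only [flr] <;> constructor
  · linarith [Int.lt_floor_add_one p.1]
  · linarith [Int.floor_le p.1]
  · linarith [Int.lt_floor_add_one p.2]
  · linarith [Int.floor_le p.2]

theorem Near.lerp {r t : ℝ} {p q p' q' : ℝ × ℝ} (h0 : 0 ≤ t) (h1 : t ≤ 1) (h : Near r p q)
    (h' : Near r p' q') : Near r ((1 - t) • p + t • p') ((1 - t) • q + t • q') := by
  obtain ⟨a1, a2⟩ := h
  obtain ⟨b1, b2⟩ := h'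
  rw [abs_le] at a1 a2 b1 b2
  constructor <;> rw [abs_le] <;>
    simp only [Prod.fst_add, Prod.snd_add, Prod.smul_fst, Prod.smul_snd, smul_eq_mul] <;>
    constructor <;> nlinarith

theorem Near.triangle {r s : ℝ} {p q x : ℝ × ℝ} (h : Near r p q) (h' : Near s q x) :
    Near (r + s) p x :=
  ⟨(abs_sub_le _ q.1 _).trans (add_le_add h.1 h'.1),
    (abs_sub_le _ q.2 _).trans (add_le_add h.2 h'.2)⟩

theorem near_self {r : ℝ} (hr : 0 ≤ r) (p : ℝ × ℝ) : Near r p p := by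
  constructor <;> simpa using hr

theorem Near.symm {r : ℝ} {p q : ℝ × ℝ} (h : Near r p q) : Near r q p :=
  ⟨abs_sub_comm q.1 p.1 ▸ h.1, abs_sub_comm q.2 p.2 ▸ h.2⟩

/-- The ray from the origin through `p` is on the far side of a piece placed at `p`
with orientation `o`. -/
def Facing (o p : ℝ × ℝ) : Prop := 0 ≤ o.2 * p.1 - o.1 * p.2

theorem Facing.smul {o p : ℝ × ℝ} {l : ℝ} (hl : 0 ≤ l) (h : Facing o p) : Facing o (l • p) := by
  simp only [Facing, Prod.smul_fst, Prod.smul_snd, smul_eq_mul] at h ⊢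
  nlinarith [mul_nonneg hl h]

theorem Facing.flr {o p : ℝ × ℝ} (ho : IsDir o) (h : Facing o p) : Facing o (flr p) := by
  have k1 : ∀ x : ℝ, 0 ≤ x → (0 : ℝ) ≤ ⌊x⌋ := fun x hx => by exact_mod_cast Int.floor_nonneg.2 hx
  have k2 : ∀ x : ℝ, x ≤ 0 → (⌊x⌋ : ℝ) ≤ 0 := fun x hx => (Int.floor_le x).trans hx
  rcases ho with rfl | rfl | rfl | rfl <;> simp only [Facing, _root_.flr] at h ⊢
  · linarith [k2 p.2 (by linarith)]
  · linarith [k1 p.1 (by linarith)]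
  · linarith [k1 p.2 (by linarith)]
  · linarith [k2 p.1 (by linarith)]

theorem Facing.lerp_right {o p q : ℝ × ℝ} {t : ℝ} (h0 : 0 ≤ t) (h1 : t ≤ 1) (h : Facing o p)
    (h' : Facing o q) : Facing o ((1 - t) • p + t • q) := by
  simp only [Facing, Prod.fst_add, Prod.snd_add, Prod.smul_fst, Prod.smul_snd, smul_eq_mul] at *
  nlinarith [mul_nonneg h0 h', mul_nonneg (sub_nonneg.2 h1) h]

theorem Facing.lerp_left {o o' p : ℝ × ℝ} {t : ℝ} (h0 : 0 ≤ t) (h1 : t ≤ 1) (h : Facing o p)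
    (h' : Facing o' p) : Facing ((1 - t) • o + t • o') p := by
  simp only [Facing, Prod.fst_add, Prod.snd_add, Prod.smul_fst, Prod.smul_snd, smul_eq_mul] at *
  nlinarith [mul_nonneg h0 h', mul_nonneg (sub_nonneg.2 h1) h]

/-- An orientation for a piece at the end of `e`, never pointing straight up. -/
noncomputable def tilt (u e o : ℝ × ℝ) : ℝ × ℝ :=
  open Classical in if o = (-1, 0) then (0, -sideSign u e) else o

/-- The orientation `o` of a piece at the end of `e` has the origin in its upper cone. -/
def Attached (o e : ℝ × ℝ) : Prop := UpCone (rot (conj2 o) (-e))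

theorem Attached.cases {o e : ℝ × ℝ} (ho : IsDir o) (h : Attached o e) :
    (o = (1, 0) ∧ e.2 < e.1 ∧ e.1 ≤ -e.2) ∨ (o = (0, 1) ∧ -e.1 < e.2 ∧ e.2 ≤ e.1) ∨
    (o = (-1, 0) ∧ 0 < e.2) ∨ (o = (0, -1) ∧ e.1 ≤ e.2 ∧ e.2 < -e.1) := by
  rcases ho with rfl | rfl | rfl | rfl <;>
    simp only [Attached, UpCone, rot, conj2, Prod.fst_neg, Prod.snd_neg] at h
  · exact Or.inl ⟨rfl, by linarith, by linarith⟩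
  · exact Or.inr (Or.inl ⟨rfl, by linarith, by linarith⟩)
  · exact Or.inr (Or.inr (Or.inl ⟨rfl, by linarith⟩))
  · exact Or.inr (Or.inr (Or.inr ⟨rfl, by linarith, by linarith⟩))

theorem isDir_tilt {u e o : ℝ × ℝ} (ho : IsDir o) (h : Attached o e) : IsDir (tilt u e o) := by
  unfold tilt
  split_ifs with hd
  · rcases h.cases ho with ⟨rfl, -⟩ | ⟨rfl, -⟩ | ⟨-, h⟩ | ⟨rfl, -⟩
    · norm_num at hd
    · norm_num at hd
    · unfold sideSign
      rw [if_neg (not_lt.2 h.le)]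
      split_ifs <;> simp [IsDir]
    · norm_num at hd
  · exact ho

theorem tilt_ne {u e o : ℝ × ℝ} : tilt u e o ≠ (-1, 0) := by
  unfold tilt
  split_ifs with hd
  · simp
  · exact hd

theorem Attached.facing {o e : ℝ × ℝ} (ho : IsDir o) (h : Attached o e) : Facing o e := by
  rcases h.cases ho with ⟨rfl, h, h'⟩ | ⟨rfl, h, h'⟩ | ⟨rfl, h⟩ | ⟨rfl, h, h'⟩ <;>
    simp only [Facing] <;> linarith

theorem Attached.facing_shear {u o e : ℝ × ℝ} (hu : UpCone u) (ho : IsDir o) (h : Attached o e) :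
    Facing o (bend u 1 0 e) := by
  have hp := hu.pos
  rcases h.cases ho with ⟨rfl, h, h'⟩ | ⟨rfl, h, h'⟩ | ⟨rfl, h⟩ | ⟨rfl, h, h'⟩ <;>
    simp only [Facing, bend]
  · linarith
  · rcases sideSign_cases hu e with ⟨y, s⟩ | ⟨y, s, c, x⟩ | ⟨y, s, c, x⟩ <;> rw [s]
    · linarith
    · exfalso
      simp only [cross2] at c
      unfold UpCone at hu
      nlinarith [mul_nonneg y (sub_nonneg.2 h')]
    · linarith
  · linarith
  · rcases sideSign_cases hu e with ⟨y, s⟩ | ⟨y, s, c, x⟩ | ⟨y, s, c, x⟩ <;> rw [s]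
    · linarith
    · linarith
    · exfalso
      simp only [cross2] at c
      unfold UpCone at hu
      nlinarith [mul_nonneg y (neg_le_iff_add_nonneg.1 hu.1)]

theorem Attached.facing_tilt {u o e : ℝ × ℝ} (hu : UpCone u) (ho : IsDir o) (h : Attached o e)
    {b : ℝ} (hb : 0 ≤ b) : Facing (tilt u e o) (bend u 1 b e) := by
  have h0 := h.facing_shear hu ho
  unfold tilt
  split_ifs with hd
  · subst hd
    rcases h.cases ho with ⟨hd, -⟩ | ⟨hd, -⟩ | ⟨-, h⟩ | ⟨hd, -⟩
    · norm_num at hd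
    · norm_num at hd
    · simp only [Facing, bend]
      rcases sideSign_cases hu e with ⟨y, s⟩ | ⟨y, s, c, x⟩ | ⟨y, s, c, x⟩ <;> rw [s]
      · linarith
      · linarith
      · linarith
    · norm_num at hd
  · have ho' := ho
    rcases ho' with rfl | rfl | rfl | rfl
    · simp only [Facing, bend] at h0 ⊢
      nlinarith [mul_nonneg hb (abs_nonneg (e.1 - 3 * 1 * sideSign u e * e.2))]
    · simpa only [Facing, bend, zero_mul, sub_zero] using h0
    · norm_num at hd
    · simpa only [Facing, bend, zero_mul, sub_zero] using h0

theorem facing_down {u e : ℝ × ℝ} (hu : UpCone u) (he : e ≠ 0) :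
    Facing (1, 0) (bend u 1 1 e) := by
  have := bend_snd_neg hu he
  simp only [Facing]; linarith

theorem lerp_dir {o o' : ℝ × ℝ} (ho : IsDir o) (ho' : IsDir o') {t : ℝ} (h0 : 0 ≤ t)
    (h1 : t ≤ 1) : |((1 - t) • o + t • o').1| + |((1 - t) • o + t • o').2| ≤ 1 := by
  have a := ho.abs_add
  have b := ho'.abs_add
  simp only [Prod.fst_add, Prod.snd_add, Prod.smul_fst, Prod.smul_snd, smul_eq_mul]
  have k : ∀ x y : ℝ, |(1 - t) * x + t * y| ≤ (1 - t) * |x| + t * |y| := fun x y => by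
    refine (abs_add_le _ _).trans ?_
    rw [abs_mul, abs_mul, abs_of_nonneg h0, abs_of_nonneg (sub_nonneg.2 h1)]
  nlinarith [k o.1 o'.1, k o.2 o'.2]

theorem lerp_dir_ne {o o' : ℝ × ℝ} (ho : IsDir o) (ho' : IsDir o') (hne : o ≠ -o') {t : ℝ} :
    (1 - t) • o + t • o' ≠ 0 := by
  intro h
  rw [Prod.ext_iff] at h
  obtain ⟨x, y⟩ := h
  rcases ho with rfl | rfl | rfl | rfl <;> rcases ho' with rfl | rfl | rfl | rfl <;>
    simp at hne x y <;> linarith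

theorem lerp_dir_tilt_ne {u e o : ℝ × ℝ} (ho : IsDir o) (h : Attached o e) {t : ℝ} :
    (1 - t) • o + t • tilt u e o ≠ 0 := by
  refine lerp_dir_ne ho (isDir_tilt ho h) ?_
  intro heq
  unfold tilt at heq
  split_ifs at heq with hd
  · rw [hd] at heq; simp at heq
  · rcases ho with rfl | rfl | rfl | rfl <;> norm_num at heq

theorem lerp_tilt_down_ne {u e o : ℝ × ℝ} (ho : IsDir o) (h : Attached o e) {t : ℝ} :
    (1 - t) • tilt u e o + t • ((1, 0) : ℝ × ℝ) ≠ 0 := by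
  refine lerp_dir_ne (isDir_tilt ho h) (Or.inl rfl) ?_
  intro heq
  exact tilt_ne (heq.trans (by simp))

/-- Scaling factor bringing the bent vector `bend u 1 1 e` to depth `Y`. -/
noncomputable def depthScale (u : ℝ × ℝ) (Y : ℝ) (e : ℝ × ℝ) : ℝ := Y / -(bend u 1 1 e).2

/-- Successive positions of a piece at `e` while it is moved below the origin. -/
noncomputable def stagePos (u : ℝ × ℝ) (B Y : ℝ) (e : ℝ × ℝ) : ℕ → ℝ × ℝ
  | 0 => B • e
  | 1 => flr (depthScale u Y e • e)
  | 2 => flr (depthScale u Y e • bend u 1 0 e)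
  | 3 => flr (depthScale u Y e • bend u 1 0 e)
  | _ => flr (depthScale u Y e • bend u 1 1 e)

/-- Successive orientations of a piece at `e` while it is moved below the origin. -/
noncomputable def stageDir (u e o : ℝ × ℝ) : ℕ → ℝ × ℝ
  | 0 => o
  | 1 => o
  | 2 => o
  | 3 => tilt u e o
  | 4 => tilt u e o
  | _ => (1, 0)

section Stages

variable {W : Type}

/-- The vectors `e c` for `c` in `C` are distinct lattice directions, also distinct from `u`
if `cut` holds, and `o c` is an orientation of a piece at `e c`. -/
structure LatticeStar (C : W → Prop) (cut : Prop) (N : ℝ) (u : ℝ × ℝ) (e o : W → ℝ × ℝ) :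
    Prop where
  cone : UpCone u
  one_le : 1 ≤ N
  int : ∀ c, C c → IsIntPt (e c)
  ne_zero : ∀ c, C c → e c ≠ 0
  bdd : ∀ c, C c → Bdd N (e c)
  dir : ∀ c, C c → IsDir (o c)
  attached : ∀ c, C c → Attached (o c) (e c)
  ne : ∀ c c', C c → C c' → c ≠ c' → ¬ SameDir (e c) (e c')
  int_cut : cut → IsIntPt u ∧ Bdd N u
  ne_cut : cut → ∀ c, C c → ¬ SameDir (e c) u

/-- Pieces of size `R` at `P c` with orientation `o c` do not obstruct each other, the origin,
or the ray `u`. -/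
structure StarOK (C : W → Prop) (cut : Prop) (R : ℝ) (u : ℝ × ℝ) (P o : W → ℝ × ℝ) :
    Prop where
  facing : ∀ c, C c → Facing (o c) (P c)
  dir_ne : ∀ c, C c → o c ≠ 0
  dir_le : ∀ c, C c → |(o c).1| + |(o c).2| ≤ 1
  zero : ∀ c, C c → ∀ p, Near R p (P c) → p ≠ 0
  axis : cut → ∀ c, C c → ∀ p, Near R p (P c) → ∀ l m : ℝ, 0 < l → 0 < m → l • p ≠ m • u
  sep : ∀ c c', C c → C c' → c ≠ c' → ∀ p q, Near R p (P c) → Near R q (P c') →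
    ∀ l m : ℝ, 0 < l → 0 < m → l • p ≠ m • q

variable {C : W → Prop} {cut : Prop} {N : ℝ} {u : ℝ × ℝ} {e o : W → ℝ × ℝ}

theorem LatticeStar.starOK (h : LatticeStar C cut N u e o) {R K a b : ℝ} {P q : W → ℝ × ℝ}
    {k : W → ℝ} (hR : 0 ≤ R) (hKN : 56 * N * (R + 1) ≤ K) (ha0 : 0 ≤ a) (ha1 : a ≤ 1)
    (hb0 : 0 ≤ b) (hb1 : b ≤ 1) (hab : b = 0 ∨ a = 1) (hk : ∀ c, C c → K ≤ k c)
    (hP : ∀ c, C c → Near 1 (P c) (k c • bend u a b (e c)))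
    (hf : ∀ c, C c → Facing (q c) (P c)) (hq : ∀ c, C c → q c ≠ 0)
    (hq1 : ∀ c, C c → |(q c).1| + |(q c).2| ≤ 1) : StarOK C cut R u P q := by
  have hN := h.one_le
  have hu := h.cone.pos
  have hu1 := h.cone.abs_le
  have hNR : 56 * (R + 1) ≤ K := by nlinarith
  have hK : 0 < K := by linarith
  refine ⟨hf, hq, hq1, ?_, ?_, ?_⟩
  · intro c hc p hp
    exact bend_separated_zero hu hu1 ha0 ha1 hb0 hb1 hK (hk c hc) (by linarith) (by linarith)
      (h.int c hc) (h.ne_zero c hc) (hp.triangle (hP c hc))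
  · intro hcut c hc p hp l m hl hm heq
    exact bend_separated_axis hu hu1 ha0 ha1 hb0 hb1 hab hK (hk c hc) hKN hN (by linarith)
      (h.int c hc) (h.int_cut hcut).1 (h.ne_zero c hc) (h.bdd c hc) (h.int_cut hcut).2
      (h.ne_cut hcut c hc) (hp.triangle (hP c hc)) hl hm heq
  · intro c c' hc hc' hne p p' hp hp' l m hl hm heq
    exact bend_separated hu hu1 ha0 ha1 hb0 hb1 hK (hk c hc) (hk c' hc') hKN hN (by linarith)
      (h.int c hc) (h.int c' hc') (h.ne_zero c hc) (h.ne_zero c' hc') (h.bdd c hc) (h.bdd c' hc')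
      (h.ne c c' hc hc' hne) (hp.triangle (hP c hc)) (hp'.triangle (hP c' hc')) hl hm heq

theorem LatticeStar.depthScale_ge (h : LatticeStar C cut N u e o) {K Y : ℝ} (hY : 5 * N * K ≤ Y)
    (hY0 : 0 ≤ Y) {c : W} (hc : C c) : K ≤ depthScale u Y (e c) := by
  have h1 := one_le_neg_bend h.cone (h.int c hc) (h.ne_zero c hc)
  have h2 := neg_bend_le (u := u) (h.bdd c hc)
  unfold depthScale
  rw [le_div_iff₀ (by linarith)]
  rcases le_total K 0 with hK | hK
  · nlinarith
  · nlinarith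

theorem LatticeStar.depthScale_pos (h : LatticeStar C cut N u e o) {Y : ℝ} (hY0 : 0 < Y) {c : W}
    (hc : C c) : 0 < depthScale u Y (e c) := by
  have h1 := one_le_neg_bend h.cone (h.int c hc) (h.ne_zero c hc)
  exact div_pos hY0 (by linarith)

theorem stage_near (u : ℝ × ℝ) (e : W → ℝ × ℝ) (B Y : ℝ) {c : W} {t : ℝ} (h0 : 0 ≤ t)
    (h1 : t ≤ 1) {i : ℕ} (hi : 1 ≤ i) (hi' : i ≤ 4) :
    Near 1 ((1 - t) • stagePos u B Y (e c) i + t • stagePos u B Y (e c) (i + 1))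
      (depthScale u Y (e c) • bend u (if i = 1 then t else 1)
        (if i = 3 then t else if i = 4 then 1 else 0) (e c)) := by
  have hs : ∀ x : ℝ × ℝ, (1 - t) • x + t • x = x := fun x => by rw [← add_smul]; simp
  have hi4 : i = 1 ∨ i = 2 ∨ i = 3 ∨ i = 4 := by omega
  rcases hi4 with rfl | rfl | rfl | rfl <;> simp only [stagePos, if_true] <;> norm_num
  · rw [← lerp_bend_fst u (e c) t, smul_add, smul_comm _ (1 - t), smul_comm _ t]
    exact (near_flr _).lerp h0 h1 (near_flr _)
  · rw [hs]; exact near_flr _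
  · rw [← lerp_bend_snd u (e c) t, smul_add, smul_comm _ (1 - t), smul_comm _ t]
    exact (near_flr _).lerp h0 h1 (near_flr _)
  · rw [hs]; exact near_flr _

theorem stage_near_zero (B Y : ℝ) {e : ℝ × ℝ} {t : ℝ} (h0 : 0 ≤ t) (h1 : t ≤ 1) :
    Near 1 ((1 - t) • stagePos u B Y e 0 + t • stagePos u B Y e 1)
      (((1 - t) * B + t * depthScale u Y e) • bend u 0 0 e) := by
  simp only [stagePos]
  rw [bend_zero, add_smul, mul_smul, mul_smul]
  exact (near_self zero_le_one _).lerp h0 h1 (near_flr _)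

theorem LatticeStar.stage_facing (h : LatticeStar C cut N u e o) {B Y : ℝ} (hB : 0 ≤ B) (hY : 0 < Y)
    {c : W} (hc : C c) {i j : ℕ} (hij : i = j ∨ i = j + 1 ∨ j = i + 1) (hi : i ≤ 5) (hj : j ≤ 5) :
    Facing (stageDir u (e c) (o c) i) (stagePos u B Y (e c) j) := by
  have ho := h.dir c hc
  have ha := h.attached c hc
  have hd := (h.depthScale_pos hY hc).le
  have hcone := h.cone
  have f1 : ∀ {q}, IsDir q → Facing q (e c) → Facing q (flr (depthScale u Y (e c) • e c)) :=
    fun hq hf => (hf.smul hd).flr hq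
  have f2 : ∀ {q b}, IsDir q → Facing q (bend u 1 b (e c)) →
      Facing q (flr (depthScale u Y (e c) • bend u 1 b (e c))) :=
    fun hq hf => (hf.smul hd).flr hq
  have ht := isDir_tilt (u := u) ho ha
  have t0 := ha.facing_tilt (b := 0) hcone ho le_rfl
  have t1 := ha.facing_tilt (b := 1) hcone ho zero_le_one
  have s0 := ha.facing_shear hcone ho
  have d1 := facing_down hcone (h.ne_zero c hc)
  have z0 : Facing (o c) (B • e c) := (ha.facing ho).smul hB
  have z1 := f1 ho (ha.facing ho)
  have z2 := f2 ho s0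
  have z3 := f2 ht t0
  have z4 := f2 ht t1
  have z5 := f2 (Or.inl rfl) d1
  interval_cases i <;> interval_cases j <;> first | omega | assumption

theorem LatticeStar.stage_starOK (h : LatticeStar C cut N u e o) {R K B Y : ℝ} (hR : 0 ≤ R)
    (hKN : 56 * N * (R + 1) ≤ K) (hY : 5 * N * K ≤ Y) (hB : Y ≤ B) {i : ℕ} (hi : i ≤ 4) {t : ℝ}
    (h0 : 0 ≤ t) (h1 : t ≤ 1) :
    StarOK C cut R u
      (fun c => (1 - t) • stagePos u B Y (e c) i + t • stagePos u B Y (e c) (i + 1))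
      (fun c => (1 - t) • stageDir u (e c) (o c) i + t • stageDir u (e c) (o c) (i + 1)) := by
  have hN := h.one_le
  have hK : 0 < K := by nlinarith
  have hY0 : 0 < Y := by nlinarith
  have hB0 : 0 ≤ B := hY0.le.trans hB
  have hdir : ∀ c, C c → IsDir (tilt u (e c) (o c)) := fun c hc =>
    isDir_tilt (h.dir c hc) (h.attached c hc)
  have hconst : ∀ x : ℝ × ℝ, (1 - t) • x + t • x = x := fun x => by rw [← add_smul]; simp
  have hf : ∀ c, C c → Facing ((1 - t) • stageDir u (e c) (o c) i + t • stageDir u (e c) (o c) (i + 1))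
      ((1 - t) • stagePos u B Y (e c) i + t • stagePos u B Y (e c) (i + 1)) := by
    intro c hc
    refine Facing.lerp_right h0 h1 (Facing.lerp_left h0 h1 ?_ ?_) (Facing.lerp_left h0 h1 ?_ ?_) <;>
      refine h.stage_facing hB0 hY0 hc ?_ ?_ ?_ <;> omega
  have hle : ∀ c, C c →
      |((1 - t) • stageDir u (e c) (o c) i + t • stageDir u (e c) (o c) (i + 1)).1| +
      |((1 - t) • stageDir u (e c) (o c) i + t • stageDir u (e c) (o c) (i + 1)).2| ≤ 1 := by
    intro c hc
    have hd : ∀ j, IsDir (stageDir u (e c) (o c) j) := by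
      intro j
      unfold stageDir
      split
      · exact h.dir c hc
      · exact h.dir c hc
      · exact h.dir c hc
      · exact hdir c hc
      · exact hdir c hc
      · exact Or.inl rfl
    exact lerp_dir (hd _) (hd _) h0 h1
  have hne : ∀ c, C c →
      (1 - t) • stageDir u (e c) (o c) i + t • stageDir u (e c) (o c) (i + 1) ≠ 0 := by
    intro c hc
    have n1 : o c ≠ 0 := fun h' => by have := (h.dir c hc).sq; simp [h'] at this
    have n2 : tilt u (e c) (o c) ≠ 0 := fun h' => by have := (hdir c hc).sq; simp [h'] at this
    have n3 := lerp_dir_tilt_ne (u := u) (t := t) (h.dir c hc) (h.attached c hc)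
    have n4 := lerp_tilt_down_ne (u := u) (t := t) (h.dir c hc) (h.attached c hc)
    interval_cases i <;> simp only [stageDir, hconst] <;> assumption
  rcases Nat.eq_zero_or_pos i with rfl | hpos
  · refine h.starOK (K := K) (k := fun c => (1 - t) * B + t * depthScale u Y (e c)) (a := 0) (b := 0)
      hR hKN le_rfl zero_le_one le_rfl zero_le_one (Or.inl rfl) ?_
      (fun c _ => stage_near_zero B Y h0 h1) hf hne hle
    intro c hc
    have k1 := h.depthScale_ge hY hY0.le hc
    have k2 : K ≤ B := by nlinarith
    nlinarith
  · have hi4 : i = 1 ∨ i = 2 ∨ i = 3 ∨ i = 4 := by omega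
    refine h.starOK (K := K) (k := fun c => depthScale u Y (e c)) (a := if i = 1 then t else 1)
      (b := if i = 3 then t else if i = 4 then 1 else 0) hR hKN ?_ ?_ ?_ ?_ ?_
      (fun c hc => h.depthScale_ge hY hY0.le hc)
      (fun c _ => stage_near u e B Y h0 h1 hpos hi) hf hne hle <;>
    rcases hi4 with rfl | rfl | rfl | rfl <;> norm_num <;> assumption

theorem LatticeStar.stagePos_near (h : LatticeStar C cut N u e o) (B : ℝ) {Y : ℝ} (hY : 1 ≤ Y)
    {c : W} (hc : C c) (i : ℕ) :
    ∃ s : ℝ, 0 ≤ s ∧ s ≤ 1 ∧ Near (6 * Y) (stagePos u B Y (e c) i) (s • B • e c) := by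
  have hd := h.depthScale_pos (by linarith : 0 < Y) hc
  have hm : depthScale u Y (e c) * -(bend u 1 1 (e c)).2 = Y := by
    unfold depthScale
    have := bend_snd_neg h.cone (h.ne_zero c hc)
    field_simp [this.ne]
  obtain ⟨a1, a2, a3⟩ := abs_bend_le h.cone (e c)
  have key : ∀ x : ℝ, |x| ≤ 5 * -(bend u 1 1 (e c)).2 → |depthScale u Y (e c) * x| ≤ 5 * Y := by
    intro x hx
    rw [abs_mul, abs_of_pos hd]
    have := mul_le_mul_of_nonneg_left hx hd.le
    linarith
  have flr_near : ∀ p : ℝ × ℝ, |p.1| ≤ 5 * Y → |p.2| ≤ 5 * Y →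
      Near (6 * Y) (flr p) ((0 : ℝ) • B • e c) := by
    intro p h1 h2
    rw [zero_smul]
    have : Near (5 * Y) p 0 := ⟨by simpa using h1, by simpa using h2⟩
    exact ((near_flr p).triangle this).weaken (by linarith)
  have hneg : (0:ℝ) ≤ -(bend u 1 1 (e c)).2 := (abs_nonneg _).trans a2
  have n1 := key (e c).1 a3
  have n2 := key (e c).2 (by linarith)
  have n3 := key (bend u 1 1 (e c)).1 (by linarith)
  have n4 := key (bend u 1 1 (e c)).2 (by rw [abs_of_nonpos (by linarith)]; linarith)
  have b1 : (bend u 1 0 (e c)).1 = (bend u 1 1 (e c)).1 := rfl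
  have b2 : (bend u 1 0 (e c)).2 = (e c).2 := by simp [bend]
  unfold stagePos
  split
  · exact ⟨1, zero_le_one, le_rfl, by rw [one_smul]; exact near_self (by linarith) _⟩
  · exact ⟨0, le_rfl, zero_le_one, flr_near _ n1 n2⟩
  · refine ⟨0, le_rfl, zero_le_one, flr_near _ ?_ ?_⟩
    · rw [Prod.smul_fst, smul_eq_mul, b1]; exact n3
    · rw [Prod.smul_snd, smul_eq_mul, b2]; exact n2
  · refine ⟨0, le_rfl, zero_le_one, flr_near _ ?_ ?_⟩
    · rw [Prod.smul_fst, smul_eq_mul, b1]; exact n3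
    · rw [Prod.smul_snd, smul_eq_mul, b2]; exact n2
  · exact ⟨0, le_rfl, zero_le_one, flr_near _ n3 n4⟩

theorem LatticeStar.stagePos_five (h : LatticeStar C cut N u e o) (B : ℝ) (Y : ℕ)
    {c : W} (hc : C c) : (stagePos u B Y (e c) 5).2 = -(Y : ℝ) := by
  have hm : depthScale u Y (e c) * (bend u 1 1 (e c)).2 = ((-(Y : ℤ) : ℤ) : ℝ) := by
    unfold depthScale
    have := bend_snd_neg h.cone (h.ne_zero c hc)
    push_cast
    field_simp [this.ne]
  simp only [stagePos, flr, Prod.smul_snd, smul_eq_mul, hm, Int.floor_intCast]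
  push_cast
  rfl

theorem LatticeStar.stagePos_gap (h : LatticeStar C cut N u e o) {R K B : ℝ} {Y : ℕ} (hR : 0 ≤ R)
    (hKN : 56 * N * (R + 1) ≤ K) (hY : 5 * N * K ≤ Y) (hB : Y ≤ B) {c c' : W} (hc : C c)
    (hc' : C c') (hne : c ≠ c') (hbef : Before u (e c) (e c')) :
    (stagePos u B Y (e c) 5).1 + 2 * R < (stagePos u B Y (e c') 5).1 := by
  have hN := h.one_le
  have hK : 0 < K := by nlinarith
  have hY0 : (0 : ℝ) < Y := by nlinarith
  have hcr := cross_bend_nonneg h.cone (h.ne_zero c hc) (h.ne_zero c' hc') hbef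
  have y1 := bend_snd_neg h.cone (h.ne_zero c hc)
  have y2 := bend_snd_neg h.cone (h.ne_zero c' hc')
  have hle : (stagePos u B Y (e c) 5).1 ≤ (stagePos u B Y (e c') 5).1 := by
    simp only [stagePos, flr, Prod.smul_fst, smul_eq_mul]
    have : depthScale u Y (e c) * (bend u 1 1 (e c)).1 ≤
        depthScale u Y (e c') * (bend u 1 1 (e c')).1 := by
      unfold depthScale
      simp only [cross2] at hcr
      rw [div_mul_eq_mul_div, div_mul_eq_mul_div, div_le_div_iff₀ (by linarith) (by linarith)]
      nlinarith
    exact_mod_cast Int.floor_le_floor this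
  have hs := (h.stage_starOK (t := 1) hR hKN hY hB le_rfl zero_le_one le_rfl).sep c c' hc hc' hne
  by_contra hlt
  push Not at hlt
  have z1 := h.stagePos_five B Y hc
  have z2 := h.stagePos_five B Y hc'
  refine hs (((stagePos u B Y (e c) 5).1 + (stagePos u B Y (e c') 5).1) / 2, -(Y : ℝ))
    (((stagePos u B Y (e c) 5).1 + (stagePos u B Y (e c') 5).1) / 2, -(Y : ℝ)) ?_ ?_ 1 1 one_pos
    one_pos rfl
  · simp only [sub_self, zero_smul, one_smul, zero_add]
    refine ⟨abs_le.2 ⟨by simp only; linarith, by simp only; linarith⟩, ?_⟩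
    rw [z1]; simpa using hR
  · simp only [sub_self, zero_smul, one_smul, zero_add]
    refine ⟨abs_le.2 ⟨by simp only; linarith, by simp only; linarith⟩, ?_⟩
    rw [z2]; simpa using hR

end Stages

theorem rot_injective {o : ℝ × ℝ} (ho : o ≠ 0) {p q : ℝ × ℝ} (h : rot o p = rot o q) : p = q := by
  have hpos : 0 < o.1 ^ 2 + o.2 ^ 2 := by
    by_contra hn
    push Not at hn
    apply ho
    ext <;> simp <;> nlinarith [sq_nonneg o.1, sq_nonneg o.2]
  simp only [rot, Prod.mk.injEq] at h
  obtain ⟨h1, h2⟩ := h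
  have e1 : (o.1 ^ 2 + o.2 ^ 2) * (p.1 - q.1) = 0 := by linear_combination o.1 * h1 + o.2 * h2
  have e2 : (o.1 ^ 2 + o.2 ^ 2) * (p.2 - q.2) = 0 := by linear_combination o.1 * h2 - o.2 * h1
  ext
  · rcases mul_eq_zero.1 e1 with h | h <;> linarith
  · rcases mul_eq_zero.1 e2 with h | h <;> linarith

/-- The similarity `p ↦ A + o p`. -/
def sim (A o p : ℝ × ℝ) : ℝ × ℝ := A + rot o p

theorem sim_injective (A : ℝ × ℝ) {o : ℝ × ℝ} (ho : o ≠ 0) : Function.Injective (sim A o) :=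
  fun _ _ h => rot_injective ho (add_left_cancel h)

theorem mem_segment_sim {A o a b x : ℝ × ℝ} (h : x ∈ segment ℝ (sim A o a) (sim A o b)) :
    ∃ y ∈ segment ℝ a b, x = sim A o y := by
  obtain ⟨t, h0, h1, rfl⟩ := mem_segment_iff.1 h
  refine ⟨(a.1 + t * (b.1 - a.1), a.2 + t * (b.2 - a.2)), mem_segment_iff.2 ⟨t, h0, h1, rfl⟩, ?_⟩
  ext <;> simp [sim, rot] <;> ring

theorem EdgesMeet.sim {T : OTree V} {Γ Γ' : V → ℝ × ℝ} {u w : V} (h : EdgesMeet T Γ u w)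
    (A : ℝ × ℝ) {o : ℝ × ℝ} (ho : o ≠ 0) (h1 : Γ' u = _root_.sim A o (Γ u))
    (h2 : Γ' (T.parent u) = _root_.sim A o (Γ (T.parent u))) (h3 : Γ' w = _root_.sim A o (Γ w))
    (h4 : Γ' (T.parent w) = _root_.sim A o (Γ (T.parent w))) : EdgesMeet T Γ' u w := by
  intro p hp hp'
  rw [h1, h2] at hp
  rw [h3, h4] at hp'
  obtain ⟨y, hy, rfl⟩ := mem_segment_sim hp
  obtain ⟨y', hy', he⟩ := mem_segment_sim hp'
  rw [← sim_injective A ho he] at hy'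
  obtain ⟨z, a, b, c⟩ := h y hy hy'
  refine ⟨z, a, b, ?_⟩
  rcases a with rfl | rfl
  · rw [h1, c]
  · rw [h2, c]

theorem IsPlanarD.sim {T : OTree V} {Γ : V → ℝ × ℝ} (h : IsPlanarD T Γ) (A : ℝ × ℝ) {o : ℝ × ℝ}
    (ho : o ≠ 0) : IsPlanarD T fun w => _root_.sim A o (Γ w) := by
  rw [isPlanarD_iff] at h ⊢
  exact ⟨(sim_injective A ho).comp h.1, fun u w hu hw huw =>
    (h.2 u w hu hw huw).sim A ho rfl rfl rfl rfl⟩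

theorem abs_rot_le {o p : ℝ × ℝ} {r : ℝ} (ho : |o.1| + |o.2| ≤ 1) (h1 : |p.1| ≤ r)
    (h2 : |p.2| ≤ r) : |(rot o p).1| ≤ r ∧ |(rot o p).2| ≤ r := by
  have hr := (abs_nonneg _).trans h1
  have k : ∀ x y : ℝ, |x| ≤ r → |y| ≤ r → |o.1 * x| + |o.2 * y| ≤ r := by
    intro x y hx hy
    rw [abs_mul, abs_mul]
    nlinarith [mul_le_mul_of_nonneg_left hx (abs_nonneg o.1),
      mul_le_mul_of_nonneg_left hy (abs_nonneg o.2)]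
  constructor
  · exact (abs_sub _ _).trans (k _ _ h1 h2)
  · rw [rot, add_comm]; exact (abs_add_le _ _).trans (k _ _ h2 h1)

theorem near_of_mem_segment {r : ℝ} {a b p x : ℝ × ℝ} (ha : Near r a x) (hb : Near r b x)
    (hp : p ∈ segment ℝ a b) : Near r p x := by
  obtain ⟨s, t, hs, ht, hst, rfl⟩ := hp
  have := ha.lerp ht (by linarith) hb
  rwa [← add_smul, sub_add_cancel, one_smul, show 1 - t = s by linarith] at this

namespace OTree

theorem canon_sub_le (T : OTree V) (u w : V) :
    |(T.canon u - T.canon w).1| ≤ Fintype.card V ∧ |(T.canon u - T.canon w).2| ≤ Fintype.card V := by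
  have k : ∀ a b n : ℕ, a ≤ n → b ≤ n → |(a : ℝ) - b| ≤ n := by
    intro a b n ha hb
    have ha' : (a : ℝ) ≤ n := by exact_mod_cast ha
    have hb' : (b : ℝ) ≤ n := by exact_mod_cast hb
    rw [abs_le]
    constructor <;> linarith [Nat.cast_nonneg (α := ℝ) a, Nat.cast_nonneg (α := ℝ) b]
  constructor
  · exact k _ _ _ (T.col_le u) (T.col_le w)
  · rw [show (T.canon u - T.canon w).2 = (T.depth w : ℝ) - T.depth u by simp [canon]; ring]
    exact k _ _ _ (T.depth_le_card w) (T.depth_le_card u)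

theorem SDesc.branch_parent {T : OTree V} {v w : V} (h : T.SDesc v w) (hne : T.branch v w ≠ w) :
    T.SDesc v (T.parent w) ∧ T.branch v (T.parent w) = T.branch v w ∧
      T.AncEq (T.branch v w) (T.parent w) := by
  obtain ⟨hc, hcw⟩ := h.branch_spec
  have h1 : T.AncEq (T.branch v w) (T.parent w) := SDesc.parent ⟨hcw, hne.symm⟩
  exact ⟨hc.sdesc.trans_ancEq h1, branch_eq hc h1, h1⟩

theorem SDesc.parent_eq {T : OTree V} {v w : V} (h : T.SDesc v w) (he : T.branch v w = w) :
    T.parent w = v := by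
  have := h.branch_spec.1.2
  rwa [he] at this

end OTree

/-- The subtree of `v` drawn with `v` at the origin and the canonical drawing of the subtree of
each child `c` placed at `P c` with orientation `o c`. -/
noncomputable def starD (T : OTree V) (v : V) (P o : V → ℝ × ℝ) (w : V) : ℝ × ℝ :=
  if w = v then 0
  else P (T.branch v w) + rot (o (T.branch v w)) (T.canon w - T.canon (T.branch v w))

section Star

variable {T : OTree V} {v : V} {P o : V → ℝ × ℝ} {cut : Prop} {u : ℝ × ℝ}

theorem starD_self : starD T v P o v = 0 := if_pos rfl

theorem starD_of_sdesc {w : V} (h : T.SDesc v w) : starD T v P o w =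
    P (T.branch v w) + rot (o (T.branch v w)) (T.canon w - T.canon (T.branch v w)) := if_neg h.2

theorem starD_child {c : V} (h : T.IsChild c v) : starD T v P o c = P c := by
  rw [starD_of_sdesc h.sdesc, OTree.branch_eq h (OTree.AncEq.refl T c)]
  ext <;> simp [rot]

theorem starD_eq_sim {w : V} (h : T.SDesc v w) : starD T v P o w =
    sim (P (T.branch v w) - rot (o (T.branch v w)) (T.canon (T.branch v w)))
      (o (T.branch v w)) (T.canon w) := by
  rw [starD_of_sdesc h]
  ext <;> simp [sim, rot] <;> ring

theorem starD_near (h : StarOK (T.IsChild · v) cut (Fintype.card V) u P o) {w : V}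
    (hw : T.SDesc v w) : Near (Fintype.card V) (starD T v P o w) (P (T.branch v w)) := by
  rw [starD_of_sdesc hw]
  have hc := T.canon_sub_le w (T.branch v w)
  have := abs_rot_le (h.dir_le _ hw.branch_spec.1) hc.1 hc.2
  exact ⟨by simpa using this.1, by simpa using this.2⟩

/-- Each point of an edge of a star lies on a ray through the box of its branch. -/
theorem starD_ray (h : StarOK (T.IsChild · v) cut (Fintype.card V) u P o) {w : V}
    (hw : T.SDesc v w) {p : ℝ × ℝ}
    (hp : p ∈ segment ℝ (starD T v P o w) (starD T v P o (T.parent w))) :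
    ∃ (s : ℝ) (q : ℝ × ℝ), 0 ≤ s ∧ Near (Fintype.card V) q (P (T.branch v w)) ∧ p = s • q ∧
      (s = 0 → T.parent w = v) := by
  by_cases hb : T.branch v w = w
  · have hpar := hw.parent_eq hb
    rw [hpar, starD_self] at hp
    obtain ⟨t, h0, h1, rfl⟩ := mem_segment_iff.1 hp
    refine ⟨1 - t, _, sub_nonneg.2 h1, starD_near h hw, ?_, fun _ => hpar⟩
    ext <;> simp <;> ring
  · obtain ⟨h1, h2, -⟩ := hw.branch_parent hb
    refine ⟨1, p, zero_le_one, near_of_mem_segment (starD_near h hw) ?_ hp, (one_smul _ _).symm,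
      fun h => absurd h one_ne_zero⟩
    rw [← h2]
    exact starD_near h h1

theorem starD_ne_zero (h : StarOK (T.IsChild · v) cut (Fintype.card V) u P o) {w : V}
    (hw : T.SDesc v w) : starD T v P o w ≠ 0 :=
  h.zero _ hw.branch_spec.1 _ (starD_near h hw)

theorem starD_injOn (h : StarOK (T.IsChild · v) cut (Fintype.card V) u P o) {a w : V}
    (ha : T.AncEq v a) (hw : T.AncEq v w) (he : starD T v P o a = starD T v P o w) : a = w := by
  by_cases hav : a = v
  · subst hav
    by_contra hne
    exact starD_ne_zero h ⟨hw, Ne.symm hne⟩ (he.symm.trans starD_self)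
  by_cases hwv : w = v
  · subst hwv
    exact absurd (he.trans starD_self) (starD_ne_zero h ⟨ha, hav⟩)
  have ha' : T.SDesc v a := ⟨ha, hav⟩
  have hw' : T.SDesc v w := ⟨hw, hwv⟩
  by_cases hb : T.branch v a = T.branch v w
  · rw [starD_eq_sim ha', starD_eq_sim hw', hb] at he
    exact canon_injective T (sim_injective _ (h.dir_ne _ hw'.branch_spec.1) he)
  · exfalso
    exact h.sep _ _ ha'.branch_spec.1 hw'.branch_spec.1 hb _ _ (starD_near h ha') (starD_near h hw')
      1 1 one_pos one_pos (by rw [he])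

theorem starD_axis (h : StarOK (T.IsChild · v) cut (Fintype.card V) u P o) (hcut : cut) {w : V}
    (hw : T.SDesc v w) {p : ℝ × ℝ}
    (hp : p ∈ segment ℝ (starD T v P o w) (starD T v P o (T.parent w))) {m : ℝ} (hm : 0 ≤ m)
    (he : p = m • u) : p = 0 ∧ T.parent w = v := by
  obtain ⟨s, q, hs, hq, hpq, h0⟩ := starD_ray h hw hp
  have hq0 := h.zero _ hw.branch_spec.1 q hq
  rcases hs.lt_or_eq with hs | hs
  · rcases hm.lt_or_eq with hm | hm
    · exact absurd (hpq.symm.trans he) (h.axis hcut _ hw.branch_spec.1 q hq s m hs hm)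
    · rw [he, ← hm, zero_smul] at hpq
      exact absurd (smul_eq_zero.1 hpq.symm) (not_or.2 ⟨hs.ne', hq0⟩)
  · exact ⟨by rw [hpq, ← hs, zero_smul], h0 hs.symm⟩

theorem starD_edgesMeet_root (h : StarOK (T.IsChild · v) cut (Fintype.card V) u P o) {c w : V}
    (hc : T.IsChild c v) (hw : T.SDesc c w) : EdgesMeet T (starD T v P o) c w := by
  intro p hp hp'
  have hwv := hc.sdesc.trans_ancEq hw.1
  have hbw : T.branch v w = c := OTree.branch_eq hc hw.1
  have hpv := hc.sdesc.trans_ancEq hw.parent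
  have hbp : T.branch v (T.parent w) = c := OTree.branch_eq hc hw.parent
  rw [starD_child hc, hc.2, starD_self] at hp
  rw [starD_eq_sim hwv, starD_eq_sim hpv, hbw, hbp] at hp'
  obtain ⟨t, h0, h1, hpt⟩ := mem_segment_iff.1 hp
  obtain ⟨y, hy, hpy⟩ := mem_segment_sim hp'
  obtain ⟨t', h0', h1', hyt⟩ := mem_segment_iff.1 hy
  have hdw := T.depth_eq_succ hw.ne_root
  have hdc := OTree.AncEq.depth_le hw.parent
  have hdc' : (T.depth c : ℝ) ≤ T.depth (T.parent w) := by exact_mod_cast hdc.1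
  have y2 : y.2 = -(T.depth (T.parent w) : ℝ) - (1 - t') := by
    rw [hyt]; simp only [OTree.canon]; rw [hdw]; push_cast; ring
  have hf := h.facing c hc
  have ho := h.dir_ne c hc
  have hpos : 0 < (o c).1 ^ 2 + (o c).2 ^ 2 := by
    by_contra hn
    push Not at hn
    apply ho
    ext <;> simp <;> nlinarith [sq_nonneg (o c).1, sq_nonneg (o c).2]
  have e1 := congrArg Prod.fst (hpt.symm.trans hpy)
  have e2 := congrArg Prod.snd (hpt.symm.trans hpy)
  simp only [sim, rot, Prod.fst_add, Prod.snd_add, Prod.fst_sub, Prod.snd_sub, Prod.fst_zero,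
    Prod.snd_zero] at e1 e2
  unfold Facing at hf
  have e3 : t * ((o c).2 * (P c).1 - (o c).1 * (P c).2) =
      ((o c).1 ^ 2 + (o c).2 ^ 2) * (y.2 - (T.canon c).2) := by
    linear_combination -(o c).2 * e1 + (o c).1 * e2
  have hge : 0 ≤ y.2 - (T.canon c).2 := by
    by_contra hn
    push Not at hn
    nlinarith [mul_nonneg h0 hf]
  have hc2 : (T.canon c).2 = -(T.depth c : ℝ) := rfl
  rw [hc2, y2] at hge
  have ht1 : t' = 1 := by linarith
  have hdeq : (T.depth c : ℝ) = T.depth (T.parent w) := by linarith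
  have hpc : T.parent w = c := (hdc.2 (by exact_mod_cast hdeq)).symm
  refine ⟨c, Or.inl rfl, Or.inr hpc.symm, ?_⟩
  rw [starD_child hc, hpy, hyt, ht1, hpc]
  ext <;> simp [sim, rot]

theorem starD_edgesMeet (h : StarOK (T.IsChild · v) cut (Fintype.card V) u P o) {a w : V}
    (ha : T.SDesc v a) (hw : T.SDesc v w) (haw : a ≠ w) : EdgesMeet T (starD T v P o) a w := by
  by_cases hb : T.branch v a = T.branch v w
  · have hca := ha.branch_spec
    have hcw := hw.branch_spec
    by_cases h1 : T.branch v a = a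
    · rw [← hb, h1] at hcw
      exact starD_edgesMeet_root h hcw.1 ⟨hcw.2, haw.symm⟩
    by_cases h2 : T.branch v w = w
    · rw [hb, h2] at hca
      exact (starD_edgesMeet_root h hca.1 ⟨hca.2, haw⟩).symm
    obtain ⟨p1, p2, -⟩ := ha.branch_parent h1
    obtain ⟨q1, q2, -⟩ := hw.branch_parent h2
    refine (canon_edgesMeet T ha.ne_root hw.ne_root haw).sim _ (h.dir_ne _ hcw.1) ?_ ?_
      (starD_eq_sim hw) ?_
    · rw [starD_eq_sim ha, hb]
    · rw [starD_eq_sim p1, p2, hb]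
    · rw [starD_eq_sim q1, q2]
  · intro p hp hp'
    obtain ⟨s, q, hs, hq, hpq, h0⟩ := starD_ray h ha hp
    obtain ⟨s', q', hs', hq', hpq', h0'⟩ := starD_ray h hw hp'
    have hq0 := h.zero _ ha.branch_spec.1 q hq
    have hq0' := h.zero _ hw.branch_spec.1 q' hq'
    rcases hs.lt_or_eq with hs | hs
    · rcases hs'.lt_or_eq with hs' | hs'
      · exact absurd (hpq.symm.trans hpq')
          (h.sep _ _ ha.branch_spec.1 hw.branch_spec.1 hb q q' hq hq' s s' hs hs')
      · rw [hpq', ← hs', zero_smul] at hpq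
        exact absurd (smul_eq_zero.1 hpq.symm) (not_or.2 ⟨hs.ne', hq0⟩)
    · rcases hs'.lt_or_eq with hs' | hs'
      · rw [hpq, ← hs, zero_smul] at hpq'
        exact absurd (smul_eq_zero.1 hpq'.symm) (not_or.2 ⟨hs'.ne', hq0'⟩)
      · refine ⟨v, Or.inr (h0 hs.symm).symm, Or.inr (h0' hs'.symm).symm, ?_⟩
        rw [starD_self, hpq, ← hs, zero_smul]

end Star

/-- A drawing of the subtree of `v` with `v` at the origin that is planar and, if `cut` holds,
does not cross the ray spanned by `u`. -/
structure LocalOK (T : OTree V) (v : V) (cut : Prop) (u : ℝ × ℝ) (Δ : V → ℝ × ℝ) : Prop where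
  self : Δ v = 0
  inj : ∀ a w, T.AncEq v a → T.AncEq v w → Δ a = Δ w → a = w
  meet : ∀ a w, T.SDesc v a → T.SDesc v w → a ≠ w → EdgesMeet T Δ a w
  axis : cut → ∀ w, T.SDesc v w → ∀ p ∈ segment ℝ (Δ w) (Δ (T.parent w)), ∀ m : ℝ, 0 ≤ m →
    p = m • u → p = 0 ∧ T.parent w = v

section LocalDrawing

variable {T : OTree V} {v : V} {P o : V → ℝ × ℝ} {cut : Prop} {u : ℝ × ℝ}

theorem StarOK.localOK (h : StarOK (T.IsChild · v) cut (Fintype.card V) u P o) :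
    LocalOK T v cut u (starD T v P o) where
  self := starD_self
  inj _ _ ha hw he := starD_injOn h ha hw he
  meet _ _ ha hw haw := starD_edgesMeet h ha hw haw
  axis hcut _ hw _ hp _ hm he := starD_axis h hcut hw hp hm he

/-- Star drawings in which all pieces are upright, at the same height and in order. -/
theorem localOK_of_layered {y : ℝ} (hy : 0 < y) (hu : 0 < u.2)
    (ho : ∀ c, T.IsChild c v → o c = (1, 0)) (hP : ∀ c, T.IsChild c v → (P c).2 = -y)
    (hx : ∀ c c' w w', T.IsChild c v → T.IsChild c' v → T.rank c < T.rank c' → T.AncEq c w →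
      T.AncEq c' w' →
      (P c).1 + ((T.col w : ℝ) - T.col c) < (P c').1 + ((T.col w' : ℝ) - T.col c')) :
    LocalOK T v cut u (starD T v P o) := by
  set row : ℕ → ℝ := fun d =>
    if d ≤ T.depth v then (T.depth v : ℝ) - d else -y - ((d : ℝ) - T.depth v - 1) with hrowdef
  have hrow : StrictAnti row := by
    intro d d' hd
    have hd' : (d : ℝ) < d' := by exact_mod_cast hd
    simp only [hrowdef]
    split_ifs with h1 h2 h2
    · linarith
    · exfalso; omega
    · have h3 : (d' : ℝ) ≥ T.depth v + 1 := by exact_mod_cast not_le.1 h1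
      have h4 : (d : ℝ) ≤ T.depth v := by exact_mod_cast h2
      linarith
    · linarith
  have hval : ∀ w, T.SDesc v w → starD T v P o w =
      P (T.branch v w) + (T.canon w - T.canon (T.branch v w)) := by
    intro w hw
    rw [starD_of_sdesc hw, ho _ hw.branch_spec.1]
    ext <;> simp [rot]
  have hrowv : row (T.depth v) = 0 := by simp [hrowdef]
  have hyy : ∀ w, T.AncEq v w → (starD T v P o w).2 = row (T.depth w) := by
    intro w hw
    by_cases hwv : w = v
    · subst hwv
      rw [starD_self, hrowv]; rfl
    · have hs : T.SDesc v w := ⟨hw, hwv⟩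
      have hb := hs.branch_spec
      have hd := hb.1.depth
      have hle := OTree.AncEq.depth_le hb.2
      have hdR : (T.depth (T.branch v w) : ℝ) = T.depth v + 1 := by exact_mod_cast hd
      rw [hval w hs]
      have : ¬ T.depth w ≤ T.depth v := by omega
      simp only [hrowdef, if_neg this, Prod.snd_add, Prod.snd_sub, OTree.canon, hP _ hb.1]
      rw [hdR]; ring
  have hxx : ∀ a w, T.AncEq v a → T.AncEq v w → T.depth a = T.depth w → T.LeftOf a w →
      (starD T v P o a).1 < (starD T v P o w).1 := by
    intro a w ha hw hd hl
    have hav : a ≠ v := by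
      rintro rfl
      rw [hw.depth_le.2 hd] at hl
      exact OTree.LeftOf.irrefl hl
    have hwv : w ≠ v := by
      rintro rfl
      rw [ha.depth_le.2 hd.symm] at hl
      exact OTree.LeftOf.irrefl hl
    have ha' : T.SDesc v a := ⟨ha, hav⟩
    have hw' : T.SDesc v w := ⟨hw, hwv⟩
    have hba := ha'.branch_spec
    have hbw := hw'.branch_spec
    rw [hval a ha', hval w hw']
    simp only [Prod.fst_add, Prod.fst_sub, OTree.canon]
    by_cases hb : T.branch v a = T.branch v w
    · rw [hb]
      have : (T.col a : ℝ) < T.col w := by exact_mod_cast hl.col_lt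
      linarith
    · refine hx _ _ _ _ hba.1 hbw.1 ?_ hba.2 hbw.2
      have hne := mt (T.rank_inj _ _ hba.1.1 hbw.1.1 (hba.1.2.trans hbw.1.2.symm)) hb
      refine lt_of_le_of_ne ?_ hne
      by_contra hlt
      push Not at hlt
      have hl' : T.LeftOf w a :=
        ⟨_, _, hbw.1.1, hba.1.1, hbw.1.2.trans hba.1.2.symm, hlt, hbw.2, hba.2⟩
      exact OTree.LeftOf.irrefl (hl.trans hl')
  have hneg : ∀ w, T.SDesc v w → (starD T v P o w).2 < 0 := by
    intro w hw
    rw [hyy w hw.1, ← hrowv]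
    apply hrow
    have hb := hw.branch_spec
    have hd := hb.1.depth
    have hle := OTree.AncEq.depth_le hb.2
    omega
  refine ⟨starD_self, fun a w ha hw he => layered_injOn T v _ row hrow hyy hxx ha hw he,
    fun a w ha hw haw => layered_edgesMeet T v _ row hrow hyy hxx ha hw haw, ?_⟩
  rintro - w hw p hp m hm rfl
  obtain ⟨t, h0, h1, he⟩ := mem_segment_iff.1 hp
  have h2 := congrArg Prod.snd he
  simp only [Prod.smul_snd, smul_eq_mul] at h2
  have hpos := mul_nonneg hm hu.le
  have hw2 := hneg w hw
  by_cases hpar : T.parent w = v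
  · refine ⟨?_, hpar⟩
    rw [hpar, starD_self] at h2
    simp only [Prod.snd_zero] at h2
    have ht : m * u.2 = 0 := by nlinarith [mul_nonneg (sub_nonneg.2 h1) (neg_nonneg.2 hw2.le)]
    rcases mul_eq_zero.1 ht with hm0 | hu0
    · rw [hm0, zero_smul]
    · exact absurd hu0 hu.ne'
  · exfalso
    have hw3 := hneg _ ⟨hw.parent, hpar⟩
    rcases h0.lt_or_eq with h0 | h0
    · nlinarith
    · rw [← h0] at h2; linarith

theorem starD_lerp (P' o' : V → ℝ × ℝ) (t : ℝ) (w : V) :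
    (1 - t) • starD T v P o w + t • starD T v P' o' w =
      starD T v (fun c => (1 - t) • P c + t • P' c) (fun c => (1 - t) • o c + t • o' c) w := by
  unfold starD
  split_ifs
  · simp
  · ext <;> simp [rot] <;> ring

end LocalDrawing

/-- The drawing `Γ` with the subtree of `v` replaced by a placed copy of `Δ`. -/
noncomputable def graft (T : OTree V) (v : V) (A o : ℝ × ℝ) (Γ Δ : V → ℝ × ℝ) (w : V) : ℝ × ℝ :=
  open Classical in if T.AncEq v w then sim A o (Δ w) else Γ w

section Graft

variable {T : OTree V} {v : V} {A o : ℝ × ℝ} {Γ Δ : V → ℝ × ℝ}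

theorem graft_of_ancEq {w : V} (h : T.AncEq v w) : graft T v A o Γ Δ w = sim A o (Δ w) :=
  if_pos h

theorem graft_of_not {w : V} (h : ¬ T.AncEq v w) : graft T v A o Γ Δ w = Γ w := if_neg h

theorem lerpD_graft (Δ' : V → ℝ × ℝ) (t : ℝ) :
    lerpD t (graft T v A o Γ Δ) (graft T v A o Γ Δ') = graft T v A o Γ (lerpD t Δ Δ') := by
  funext w
  unfold lerpD graft
  split_ifs
  · ext <;> simp [sim, rot] <;> ring
  · rw [← add_smul, sub_add_cancel, one_smul]

theorem graft_planar {u : ℝ × ℝ} {B : ℝ} (hΓ : IsPlanarD T Γ) (hA : Γ v = A) (ho : o ≠ 0)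
    (hB : 0 ≤ B) (hΔ : LocalOK T v (v ≠ T.root) u Δ)
    (hu : v ≠ T.root → Γ (T.parent v) = sim A o (B • u))
    (hedge : ∀ a w, T.SDesc v w → ¬ T.AncEq v a → a ≠ T.root →
      ∀ p ∈ segment ℝ (graft T v A o Γ Δ w) (graft T v A o Γ Δ (T.parent w)),
        p ∉ segment ℝ (Γ a) (Γ (T.parent a)))
    (hnode : ∀ a w, T.SDesc v w → ¬ T.AncEq v a → graft T v A o Γ Δ w ≠ Γ a) :
    IsPlanarD T (graft T v A o Γ Δ) := by
  rw [isPlanarD_iff] at hΓ ⊢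
  obtain ⟨hinj, hmeet⟩ := hΓ
  have hs0 : sim A o 0 = A := by ext <;> simp [sim, rot]
  have hv : graft T v A o Γ Δ v = Γ v := by
    rw [graft_of_ancEq (OTree.AncEq.refl T v), hΔ.self, hs0, hA]
  have hstat : ∀ w, ¬ T.SDesc v w → graft T v A o Γ Δ w = Γ w := by
    intro w hw
    by_cases hvw : w = v
    · rw [hvw, hv]
    · exact graft_of_not fun h => hw ⟨h, hvw⟩
  have hup : ∀ w, T.AncEq v (T.parent w) → T.AncEq v w := fun w h => h.trans (OTree.ancEq_parent T w)
  have hstat' : ∀ w, ¬ T.SDesc v w → graft T v A o Γ Δ (T.parent w) = Γ (T.parent w) := by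
    intro w hw
    by_cases hvw : T.AncEq v (T.parent w)
    · by_cases hwv : w = v
      · subst hwv
        by_cases hr : w = T.root
        · rw [hr, T.parent_root, ← hr, hv]
        · refine hstat _ fun h => ?_
          have h1 := T.depth_eq_succ hr
          have h2 := (OTree.AncEq.depth_le h.1).1
          omega
      · exact absurd ⟨hup w hvw, hwv⟩ hw
    · exact graft_of_not hvw
  constructor
  · intro a w he
    by_cases ha : T.AncEq v a <;> by_cases hw : T.AncEq v w
    · rw [graft_of_ancEq ha, graft_of_ancEq hw] at he
      exact hΔ.inj a w ha hw (sim_injective A ho he)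
    · by_cases hav : a = v
      · rw [hav, hv, graft_of_not hw] at he
        exact hav.trans (hinj he)
      · rw [graft_of_not hw] at he
        exact absurd he (hnode w a ⟨ha, hav⟩ hw)
    · by_cases hwv : w = v
      · rw [hwv, hv, graft_of_not ha] at he
        exact (hinj he).trans hwv.symm
      · rw [graft_of_not ha] at he
        exact absurd he.symm (hnode a w ⟨hw, hwv⟩ ha)
    · rw [graft_of_not ha, graft_of_not hw] at he
      exact hinj he
  · have key : ∀ a w, a ≠ T.root → w ≠ T.root → a ≠ w → T.SDesc v w →
        EdgesMeet T (graft T v A o Γ Δ) w a := by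
      intro a w har hwr haw hw
      by_cases ha : T.SDesc v a
      · exact (hΔ.meet w a hw ha haw.symm).sim A ho (graft_of_ancEq hw.1)
          (graft_of_ancEq hw.parent) (graft_of_ancEq ha.1) (graft_of_ancEq ha.parent)
      · intro p hp hp'
        rw [hstat a ha, hstat' a ha] at hp'
        by_cases hav : T.AncEq v a
        · have hav' : a = v := by
            by_contra hne
            exact ha ⟨hav, hne⟩
          subst hav'
          rw [graft_of_ancEq hw.1, graft_of_ancEq hw.parent] at hp
          obtain ⟨y, hy, rfl⟩ := mem_segment_sim hp
          rw [hA, hu har] at hp'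
          have hp'' : sim A o y ∈ segment ℝ (sim A o 0) (sim A o (B • u)) := by rwa [hs0]
          obtain ⟨y', hy', he⟩ := mem_segment_sim hp''
          rw [← sim_injective A ho he] at hy'
          obtain ⟨t, h0, h1, hyt⟩ := mem_segment_iff.1 hy'
          have hyu : y = (t * B) • u := by rw [hyt]; ext <;> simp <;> ring
          obtain ⟨e1, e2⟩ := hΔ.axis har w hw y hy (t * B) (mul_nonneg h0 hB) hyu
          refine ⟨a, Or.inr e2.symm, Or.inl rfl, ?_⟩
          rw [hv, e1, hs0, hA]
        · exact absurd hp' (hedge a w hw hav har p hp)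
    intro a w ha hw haw
    by_cases h1 : T.SDesc v a
    · exact key w a hw ha haw.symm h1
    · by_cases h2 : T.SDesc v w
      · exact (key a w ha hw haw h2).symm
      · exact (hmeet a w ha hw haw).congr (hstat a h1) (hstat' a h1) (hstat w h2) (hstat' w h2)

end Graft

theorem IsGridD.isIntPt {W : Type} {Γ : W → ℝ × ℝ} (h : IsGridD Γ) (v : W) : IsIntPt (Γ v) := by
  obtain ⟨⟨a, ha⟩, b, hb⟩ := h v
  exact ⟨a, b, Prod.ext ha hb⟩

theorem isGridD_of_isIntPt {W : Type} {Γ : W → ℝ × ℝ} (h : ∀ v, IsIntPt (Γ v)) : IsGridD Γ := by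
  intro v
  obtain ⟨a, b, he⟩ := h v
  exact ⟨⟨a, by rw [he]⟩, b, by rw [he]⟩

theorem IsIntPt.add {p q : ℝ × ℝ} (hp : IsIntPt p) (hq : IsIntPt q) : IsIntPt (p + q) := by
  obtain ⟨a, b, rfl⟩ := hp
  obtain ⟨c, d, rfl⟩ := hq
  exact ⟨a + c, b + d, by ext <;> simp⟩

theorem IsIntPt.sub {p q : ℝ × ℝ} (hp : IsIntPt p) (hq : IsIntPt q) : IsIntPt (p - q) := by
  obtain ⟨a, b, rfl⟩ := hp
  obtain ⟨c, d, rfl⟩ := hq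
  exact ⟨a - c, b - d, by ext <;> simp⟩

theorem IsIntPt.natCast_smul {p : ℝ × ℝ} (hp : IsIntPt p) (n : ℕ) : IsIntPt ((n : ℝ) • p) := by
  obtain ⟨a, b, rfl⟩ := hp
  exact ⟨n * a, n * b, by ext <;> simp⟩

theorem IsDir.isIntPt {o : ℝ × ℝ} (h : IsDir o) : IsIntPt o := by
  rcases h with rfl | rfl | rfl | rfl
  exacts [⟨1, 0, by simp⟩, ⟨0, 1, by simp⟩, ⟨-1, 0, by simp⟩, ⟨0, -1, by simp⟩]

theorem IsIntPt.rot {o p : ℝ × ℝ} (ho : IsIntPt o) (hp : IsIntPt p) : IsIntPt (rot o p) := by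
  obtain ⟨a, b, rfl⟩ := ho
  obtain ⟨c, d, rfl⟩ := hp
  exact ⟨a * c - b * d, b * c + a * d, by ext <;> simp [_root_.rot]⟩

theorem IsDir.ne_zero {o : ℝ × ℝ} (h : IsDir o) : o ≠ 0 := by
  rintro rfl
  have := h.sq
  simp at this

theorem rot_sub (o p q : ℝ × ℝ) : rot o (p - q) = rot o p - rot o q := by
  ext <;> simp [rot] <;> ring

theorem rot_smul (o p : ℝ × ℝ) (s : ℝ) : rot o (s • p) = s • rot o p := by
  ext <;> simp [rot] <;> ring

theorem isIntPt_canon (T : OTree V) (v : V) : IsIntPt (T.canon v) :=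
  ⟨T.col v, -T.depth v, by ext <;> simp [OTree.canon]⟩

/-- For each node, the direction `u v` separating the last child from the first one, and
an orientation `o v` that turns the vertical direction roughly to `u v`. -/
structure Frame (T : OTree V) (G u o : V → ℝ × ℝ) : Prop where
  dir : ∀ v, IsDir (o v)
  cone : ∀ v, UpCone (rot (conj2 (o v)) (u v))
  par : ∀ v, v ≠ T.root → u v = G (T.parent v) - G v
  before : ∀ v c c', T.IsChild c v → T.IsChild c' v → T.rank c < T.rank c' →
    Before (u v) (G c - G v) (G c' - G v)

theorem OTree.IsChild.ne {T : OTree V} {c v : V} (h : T.IsChild c v) : c ≠ v := h.sdesc.2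

theorem OTree.parent_ne {T : OTree V} {v : V} (h : v ≠ T.root) : T.parent v ≠ v :=
  (OTree.IsChild.ne ⟨h, rfl⟩).symm

theorem exists_frame {T : OTree V} {G : V → ℝ × ℝ} (hp : IsPlanarD T G)
    (ho : IsOrderPreservingD T G) : ∃ u o, Frame T G u o := by
  have key : ∀ v, ∃ x : ℝ × ℝ, x ≠ 0 ∧ (v ≠ T.root → x = G (T.parent v) - G v) ∧
      ∀ c c', T.IsChild c v → T.IsChild c' v → T.rank c < T.rank c' →
        Before x (G c - G v) (G c' - G v) := by
    intro v
    obtain ⟨a, h1, h2⟩ := ho v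
    by_cases hv : v = T.root
    · by_cases hex : ∃ c, T.IsChild c v
      · classical
        obtain ⟨c, hc⟩ := hex
        obtain ⟨m, hm, hmin⟩ := Finset.exists_min_image
          (Finset.univ.filter fun c => T.IsChild c v) T.rank ⟨c, by simpa using hc⟩
        simp only [Finset.mem_filter, Finset.mem_univ, true_and] at hm hmin
        refine ⟨G m - G v, sub_ne_zero.2 (hp.1.ne hm.ne), fun h => absurd hv h, ?_⟩
        intro c c' hc hc' hr
        refine before_of_angFrom hp.1 hm.ne hc.ne hc'.ne ?_ (h1 c c' hc hc' hr)
        by_cases hmc : m = c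
        · rw [hmc]
        · refine (h1 m c hm hc (lt_of_le_of_ne (hmin c hc) ?_)).le
          exact mt (T.rank_inj m c hm.1 hc.1 (hm.2.trans hc.2.symm)) hmc
      · exact ⟨(0, 1), by simp, fun h => absurd hv h, fun c _ hc => absurd ⟨c, hc⟩ hex⟩
    · have hpv := OTree.parent_ne hv
      exact ⟨_, sub_ne_zero.2 (hp.1.ne hpv), fun _ => rfl, fun c c' hc hc' hr =>
        before_of_angFrom hp.1 hpv hc.ne hc'.ne (h2 hv c hc).le (h1 c c' hc hc' hr)⟩
  choose u hu0 hu1 hu2 using key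
  choose o ho1 ho2 using fun v => exists_dir_upCone (hu0 v)
  exact ⟨u, o, ho1, ho2, hu1, hu2⟩

theorem mem_segment_of_sameDir {p a b : ℝ × ℝ} (h : SameDir (a - p) (b - p)) :
    a ∈ segment ℝ p b ∨ b ∈ segment ℝ p a := by
  obtain ⟨h1, h2⟩ := h
  simp only [cross2, dot2, Prod.fst_sub, Prod.snd_sub] at h1 h2
  have aux : ∀ x y : ℝ × ℝ, (x.1 - p.1) * (y.2 - p.2) - (x.2 - p.2) * (y.1 - p.1) = 0 →
      0 < (x.1 - p.1) * (y.1 - p.1) + (x.2 - p.2) * (y.2 - p.2) →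
      (x.1 - p.1) * (y.1 - p.1) + (x.2 - p.2) * (y.2 - p.2) ≤
        (y.1 - p.1) ^ 2 + (y.2 - p.2) ^ 2 → x ∈ segment ℝ p y := by
    intro x y hc hd hle
    have hpos : 0 < (y.1 - p.1) ^ 2 + (y.2 - p.2) ^ 2 := hd.trans_le hle
    refine mem_segment_iff.2 ⟨_, div_nonneg hd.le hpos.le, (div_le_one hpos).2 hle, ?_⟩
    ext
    · simp only
      field_simp
      linear_combination (y.2 - p.2) * hc
    · simp only
      field_simp
      linear_combination -(y.1 - p.1) * hc
  rcases le_total ((a.1 - p.1) * (b.1 - p.1) + (a.2 - p.2) * (b.2 - p.2))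
    ((b.1 - p.1) ^ 2 + (b.2 - p.2) ^ 2) with h | h
  · exact Or.inl (aux a b h1 h2 h)
  · refine Or.inr (aux b a (by linarith) (by linarith) ?_)
    nlinarith [sq_nonneg (a.1 - b.1), sq_nonneg (a.2 - b.2)]

/-- The two edges `vx` and `vy` of a planar drawing do not overlap. -/
theorem IsPlanarD.not_sameDir {T : OTree V} {G : V → ℝ × ℝ} (hp : IsPlanarD T G) {a b v x y : V}
    (ha : a ≠ T.root) (hb : b ≠ T.root) (hab : a ≠ b) (hax : ∀ z, z = a ∨ z = T.parent a ↔ z = v ∨ z = x)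
    (hby : ∀ z, z = b ∨ z = T.parent b ↔ z = v ∨ z = y)
    (hsa : segment ℝ (G a) (G (T.parent a)) = segment ℝ (G v) (G x))
    (hsb : segment ℝ (G b) (G (T.parent b)) = segment ℝ (G v) (G y)) (hxy : x ≠ y) (hx : x ≠ v)
    (hy : y ≠ v) : ¬ SameDir (G x - G v) (G y - G v) := by
  intro hs
  have hm := ((isPlanarD_iff T G).1 hp).2 a b ha hb hab
  rw [EdgesMeet, hsa, hsb] at hm
  rcases mem_segment_of_sameDir hs with h | h
  · obtain ⟨z, -, h2, h3⟩ := hm _ (right_mem_segment ℝ _ _) h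
    rcases (hby z).1 h2 with rfl | rfl
    · exact hx (hp.1 h3).symm
    · exact hxy (hp.1 h3).symm
  · obtain ⟨z, h2, -, h3⟩ := hm _ h (right_mem_segment ℝ _ _)
    rcases (hax z).1 h2 with rfl | rfl
    · exact hy (hp.1 h3).symm
    · exact hxy (hp.1 h3)

theorem Frame.latticeStar {T : OTree V} {G u o : V → ℝ × ℝ} (h : Frame T G u o)
    (hp : IsPlanarD T G) (hg : IsGridD G) {N : ℝ} (hN : 1 ≤ N)
    (hb : ∀ v w, Bdd N (G v - G w)) (v : V) :
    LatticeStar (T.IsChild · v) (v ≠ T.root) N (rot (conj2 (o v)) (u v))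
      (fun c => rot (conj2 (o v)) (G c - G v)) (fun c => rot (conj2 (o v)) (o c)) := by
  have hd := (h.dir v).conj
  have hne : ∀ c, T.IsChild c v → rot (conj2 (o v)) (G c - G v) ≠ 0 := by
    intro c hc h0
    have h1 : rot (conj2 (o v)) 0 = 0 := by ext <;> simp [rot]
    exact hc.ne (hp.1 (sub_eq_zero.1 (rot_injective hd.ne_zero (h0.trans h1.symm))))
  have hbd : ∀ a b, Bdd N (rot (conj2 (o v)) (G a - G b)) := fun a b =>
    abs_rot_le hd.abs_add.le (hb a b).1 (hb a b).2
  have hlat : ∀ a b, IsIntPt (rot (conj2 (o v)) (G a - G b)) := fun a b =>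
    hd.isIntPt.rot ((hg.isIntPt a).sub (hg.isIntPt b))
  have hends : ∀ c, T.IsChild c v → ∀ z, z = c ∨ z = T.parent c ↔ z = v ∨ z = c := by
    intro c hc z
    rw [hc.2, or_comm]
  have hseg : ∀ c, T.IsChild c v →
      segment ℝ (G c) (G (T.parent c)) = segment ℝ (G v) (G c) := by
    intro c hc
    rw [hc.2, segment_symm]
  refine ⟨h.cone v, hN, fun c _ => hlat c v, hne, fun c _ => hbd c v,
    fun c _ => hd.rot (h.dir c), ?_, ?_, ?_, ?_⟩
  · intro c hc
    have h1 := h.cone c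
    rw [h.par c hc.1, hc.2] at h1
    have h2 : rot (conj2 (rot (conj2 (o v)) (o c))) (-rot (conj2 (o v)) (G c - G v)) =
        rot (conj2 (o c)) (rot (o v) (rot (conj2 (o v)) (G v - G c))) := by
      ext <;> simp [rot, conj2] <;> ring
    rw [Attached, h2, rot_rot_conj (h.dir v)]
    exact h1
  · intro c c' hc hc' hcc hs
    exact hp.not_sameDir hc.1 hc'.1 hcc (hends c hc) (hends c' hc') (hseg c hc) (hseg c' hc') hcc
      hc.ne hc'.ne (hs.of_rot hd)
  · intro hv
    rw [h.par v hv]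
    exact ⟨hlat _ _, hbd _ _⟩
  · intro hv c hc hs
    rw [h.par v hv] at hs
    have hcp : c ≠ T.parent v := by
      rintro rfl
      have h1 := T.depth_eq_succ hv
      have h2 := hc.depth
      omega
    exact hp.not_sameDir hc.1 hv hc.ne (hends c hc) (fun z => Iff.rfl) (hseg c hc) rfl hcp hc.ne
      (OTree.parent_ne hv) (hs.of_rot hd)

theorem mem_segment_smul {B : ℝ} {a b x : ℝ × ℝ} (h : x ∈ segment ℝ (B • a) (B • b)) :
    ∃ y ∈ segment ℝ a b, x = B • y := by
  obtain ⟨s, t, hs, ht, hst, rfl⟩ := h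
  exact ⟨_, ⟨s, t, hs, ht, hst, rfl⟩, by rw [smul_add, smul_comm s B, smul_comm t B]⟩

theorem Near.of_smul {B r : ℝ} (hB : 0 < B) {p q : ℝ × ℝ} (h : Near r (B • p) (B • q)) :
    Near (r / B) p q := by
  have := near_inv_smul hB h
  rwa [smul_smul, one_div_mul_cancel hB.ne', one_smul] at this

section Clearance

variable {T : OTree V} {G : V → ℝ × ℝ} {N B r : ℝ} {c v a : V}

/-- Points close to an edge above the subtree of `v` are far from the edges out of `v`. -/
theorem not_near_edge (hp : IsPlanarD T G) (hg : IsGridD G) (hb : ∀ v w, Bdd N (G v - G w))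
    (hB : 0 < B) (hr : 2 * N * (r / B) < 1) (hc : T.IsChild c v) (ha : a ≠ T.root)
    (hav : ¬ T.AncEq v a) {x y : ℝ × ℝ} (hx : x ∈ segment ℝ (B • G v) (B • G c))
    (hy : y ∈ segment ℝ (B • G a) (B • G (T.parent a))) : ¬ Near r x y := by
  intro hxy
  obtain ⟨x, hx', rfl⟩ := mem_segment_smul hx
  obtain ⟨y, hy', rfl⟩ := mem_segment_smul hy
  have hup : ¬ T.AncEq v (T.parent a) := fun h => hav (h.trans (OTree.ancEq_parent T a))
  refine lattice_segments_clearance (hg.isIntPt v) (hg.isIntPt c) (hg.isIntPt a)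
    (hg.isIntPt (T.parent a)) (hp.1.ne hc.ne.symm) (hb c v).1 (hb c v).2 (hb _ a).1 (hb _ a).2 hr
    ?_ hx' hy' (hxy.of_smul hB)
  intro z hz hz'
  have hca : c ≠ a := by
    rintro rfl
    exact hav hc.sdesc.1
  have hm := ((isPlanarD_iff T G).1 hp).2 c a hc.1 ha hca
  rw [EdgesMeet, hc.2, segment_symm] at hm
  obtain ⟨w, hw, hw', -⟩ := hm z hz hz'
  have hvw : T.AncEq v w := by
    rcases hw with rfl | rfl
    · exact hc.sdesc.1
    · exact OTree.AncEq.refl T _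
  rcases hw' with rfl | rfl
  · exact hav hvw
  · exact hup hvw

theorem not_near_node (hp : IsPlanarD T G) (hg : IsGridD G) (hN : 0 ≤ N)
    (hb : ∀ v w, Bdd N (G v - G w)) (hB : 0 < B) (hr : 2 * N * (r / B) < 1) (hc : T.IsChild c v)
    (hav : ¬ T.AncEq v a) {x : ℝ × ℝ} (hx : x ∈ segment ℝ (B • G v) (B • G c)) :
    ¬ Near r x (B • G a) := by
  intro hxy
  obtain ⟨x, hx', rfl⟩ := mem_segment_smul hx
  refine lattice_segments_clearance (hg.isIntPt v) (hg.isIntPt c) (hg.isIntPt a)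
    (hg.isIntPt a) (hp.1.ne hc.ne.symm) (hb c v).1 (hb c v).2 (by simpa using hN)
    (by simpa using hN) hr ?_ hx' (left_mem_segment ℝ _ _) (hxy.of_smul hB)
  intro z hz hz'
  rw [segment_same] at hz'
  obtain rfl : z = G a := hz'
  have hpl := (isPlanarD_iff T G).1 hp
  by_cases ha : a = T.root
  · subst ha
    have hv : T.SDesc T.root v := ⟨T.ancEq_root v, fun h => hav (h ▸ OTree.AncEq.refl T v)⟩
    have hbr := hv.branch_spec
    have hd := OTree.AncEq.depth_le hbr.2
    have hd' := hc.depth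
    have hne : T.branch T.root v ≠ c := by
      intro h
      rw [h] at hd
      omega
    have hm := hpl.2 _ c hbr.1.1 hc.1 hne
    rw [EdgesMeet, hbr.1.2, hc.2, segment_symm _ (G c)] at hm
    obtain ⟨w, -, hw, hw'⟩ := hm _ (right_mem_segment ℝ _ _) hz
    rw [hp.1 hw'] at hw
    rcases hw with h | h
    · exact hc.1 h.symm
    · exact hv.2 h.symm
  · have hca : c ≠ a := by
      rintro rfl
      exact hav hc.sdesc.1
    have hm := hpl.2 c a hc.1 ha hca
    rw [EdgesMeet, hc.2, segment_symm] at hm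
    obtain ⟨w, hw, -, hw'⟩ := hm _ hz (left_mem_segment ℝ _ _)
    rw [hp.1 hw'] at hw
    rcases hw with rfl | rfl
    · exact hav hc.sdesc.1
    · exact hav (OTree.AncEq.refl T _)

end Clearance

/-- The subtrees rooted in `S` have been replaced by canonical drawings, all other nodes are
at `B` times their position in `G`. -/
structure Placed (T : OTree V) (G o : V → ℝ × ℝ) (B : ℝ) (S : Finset V) (Γ : V → ℝ × ℝ) :
    Prop where
  off : ∀ w ∉ S, Γ w = B • G w
  blob : ∀ a ∈ S, (a = T.root ∨ T.parent a ∉ S) → ∀ w, T.AncEq a w →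
    Γ w = B • G a + rot (o a) (T.canon w - T.canon a)

/-- Every node is close to a segment between two nodes of a scaled copy of `G`. -/
def Hugs (G : V → ℝ × ℝ) (B r : ℝ) (Γ : V → ℝ × ℝ) : Prop :=
  ∀ w, ∃ a b, ∃ q ∈ segment ℝ (B • G a) (B • G b), Near r (Γ w) q

section Placed

variable {T : OTree V} {G u o Γ : V → ℝ × ℝ} {B : ℝ} {S : Finset V}

theorem exists_top {w : V} (hw : w ∈ S) :
    ∃ a ∈ S, (a = T.root ∨ T.parent a ∉ S) ∧ T.AncEq a w := by
  induction hd : T.depth w generalizing w with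
  | zero =>
    refine ⟨w, hw, Or.inl ?_, OTree.AncEq.refl T w⟩
    by_contra h
    have := T.depth_eq_succ h
    omega
  | succ k ih =>
    by_cases h : w = T.root ∨ T.parent w ∉ S
    · exact ⟨w, hw, h, OTree.AncEq.refl T w⟩
    · push Not at h
      have := T.depth_eq_succ h.1
      obtain ⟨a, h1, h2, h3⟩ := ih h.2 (by omega)
      exact ⟨a, h1, h2, h3.trans (OTree.ancEq_parent T w)⟩

theorem Placed.near_of_blob (h : Placed T G o B S Γ) (ho : ∀ v, IsDir (o v)) {a w : V}
    (ha : a ∈ S) (ht : a = T.root ∨ T.parent a ∉ S) (hw : T.AncEq a w) :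
    Near (Fintype.card V) (Γ w) (B • G a) := by
  rw [h.blob a ha ht w hw]
  have hc := T.canon_sub_le w a
  have := abs_rot_le (ho a).abs_add.le hc.1 hc.2
  exact ⟨by simpa using this.1, by simpa using this.2⟩

theorem Placed.near_node (h : Placed T G o B S Γ) (ho : ∀ v, IsDir (o v)) (w : V) :
    ∃ a, T.AncEq a w ∧ Near (Fintype.card V) (Γ w) (B • G a) := by
  by_cases hw : w ∈ S
  · obtain ⟨a, ha, ht, haw⟩ := exists_top (T := T) hw
    exact ⟨a, haw, h.near_of_blob ho ha ht haw⟩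
  · exact ⟨w, OTree.AncEq.refl T w, by rw [h.off w hw]; exact near_self (Nat.cast_nonneg _) _⟩

theorem Placed.near_edge (h : Placed T G o B S Γ) (ho : ∀ v, IsDir (o v)) (hroot : T.root ∉ S)
    {w : V} (hw : w ≠ T.root)
    {p : ℝ × ℝ} (hp : p ∈ segment ℝ (Γ w) (Γ (T.parent w))) :
    ∃ a, a ≠ T.root ∧ T.AncEq a w ∧
      ∃ q ∈ segment ℝ (B • G a) (B • G (T.parent a)), Near (Fintype.card V) p q := by
  by_cases hpS : T.parent w ∈ S
  · obtain ⟨a, ha, ht, haw⟩ := exists_top (T := T) hpS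
    have haw' := haw.trans (OTree.ancEq_parent T w)
    refine ⟨a, fun h => hroot (h ▸ ha), haw', _, left_mem_segment ℝ _ _, ?_⟩
    exact near_of_mem_segment (h.near_of_blob ho ha ht haw') (h.near_of_blob ho ha ht haw) hp
  · have hwe : Γ w = B • G w := by
      by_cases hwS : w ∈ S
      · rw [h.blob w hwS (Or.inr hpS) w (OTree.AncEq.refl T w)]
        ext <;> simp [rot]
      · exact h.off w hwS
    rw [hwe, h.off _ hpS] at hp
    exact ⟨w, hw, OTree.AncEq.refl T w, p, hp, near_self (Nat.cast_nonneg _) _⟩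

variable {v : V} {P q : V → ℝ × ℝ} {r : ℝ}

theorem near_graft (ho : IsDir (o v)) (hq : ∀ c, T.IsChild c v → |(q c).1| + |(q c).2| ≤ 1)
    (hP : ∀ c, T.IsChild c v → ∃ s : ℝ, 0 ≤ s ∧ s ≤ 1 ∧
      Near r (P c) (s • B • rot (conj2 (o v)) (G c - G v))) {w : V} (hw : T.SDesc v w) :
    ∃ s : ℝ, 0 ≤ s ∧ s ≤ 1 ∧
      Near (r + Fintype.card V) (graft T v (B • G v) (o v) Γ (starD T v P q) w)
        (B • G v + s • B • (G (T.branch v w) - G v)) := by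
  have hb := hw.branch_spec
  obtain ⟨s, h0, h1, hs⟩ := hP _ hb.1
  refine ⟨s, h0, h1, ?_⟩
  rw [graft_of_ancEq hw.1, starD_of_sdesc hw]
  have hc := T.canon_sub_le w (T.branch v w)
  have hn := abs_rot_le (hq _ hb.1) hc.1 hc.2
  set x := rot (q (T.branch v w)) (T.canon w - T.canon (T.branch v w))
  set y := s • B • rot (conj2 (o v)) (G (T.branch v w) - G v) with hy
  have h2 : |(P (T.branch v w) + x - y).1| ≤ r + Fintype.card V := by
    have e : (P (T.branch v w) + x - y).1 = ((P (T.branch v w)).1 - y.1) + x.1 := by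
      simp only [Prod.fst_add, Prod.fst_sub]; ring
    rw [e]
    exact (abs_add_le _ _).trans (add_le_add hs.1 hn.1)
  have h3 : |(P (T.branch v w) + x - y).2| ≤ r + Fintype.card V := by
    have e : (P (T.branch v w) + x - y).2 = ((P (T.branch v w)).2 - y.2) + x.2 := by
      simp only [Prod.snd_add, Prod.snd_sub]; ring
    rw [e]
    exact (abs_add_le _ _).trans (add_le_add hs.2 hn.2)
  have h4 := abs_rot_le ho.abs_add.le h2 h3
  have h5 : s • B • (G (T.branch v w) - G v) = rot (o v) y := by
    rw [hy, rot_smul, rot_smul, rot_rot_conj ho]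
  rw [h5]
  rw [rot_sub] at h4
  unfold Near sim
  simpa only [Prod.fst_add, Prod.snd_add, Prod.fst_sub, Prod.snd_sub, add_sub_add_left_eq_sub]
    using h4

theorem add_smul_mem_segment {s : ℝ} (h0 : 0 ≤ s) (h1 : s ≤ 1) (a b : ℝ × ℝ) :
    B • a + s • B • (b - a) ∈ segment ℝ (B • a) (B • b) :=
  mem_segment_iff.2 ⟨s, h0, h1, by
    simp only [Prod.ext_iff, Prod.fst_add, Prod.snd_add, Prod.smul_fst, Prod.smul_snd,
      Prod.fst_sub, Prod.snd_sub, smul_eq_mul, mul_sub, true_and]⟩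

theorem Placed.graft_planar (h : Placed T G o B S Γ) (hF : Frame T G u o) (hp : IsPlanarD T G)
    (hg : IsGridD G) {N : ℝ} (hN : 0 ≤ N) (hb : ∀ v w, Bdd N (G v - G w)) (hB : 0 < B)
    (hr : 2 * N * ((r + 2 * Fintype.card V) / B) < 1) (hS : ∀ a ∈ S, ∀ w, T.AncEq a w → w ∈ S)
    (hΓ : IsPlanarD T Γ) (hv : v ∉ S) (hr0 : 0 ≤ r)
    (hloc : LocalOK T v (v ≠ T.root) (rot (conj2 (o v)) (u v)) (starD T v P q))
    (hq : ∀ c, T.IsChild c v → |(q c).1| + |(q c).2| ≤ 1)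
    (hP : ∀ c, T.IsChild c v → ∃ s : ℝ, 0 ≤ s ∧ s ≤ 1 ∧
      Near r (P c) (s • B • rot (conj2 (o v)) (G c - G v))) :
    IsPlanarD T (graft T v (B • G v) (o v) Γ (starD T v P q)) := by
  have hd := hF.dir v
  have hn : (0 : ℝ) ≤ Fintype.card V := Nat.cast_nonneg _
  have hroot : T.root ∉ S := fun hr => hv (hS _ hr v (T.ancEq_root v))
  refine _root_.graft_planar hΓ (h.off v hv) hd.ne_zero hB.le hloc ?_ ?_ ?_
  · intro hvr
    have hpv : T.parent v ∉ S := fun hr => hv (hS _ hr v (OTree.ancEq_parent T v))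
    rw [h.off _ hpv, hF.par v hvr, sim, rot_smul, rot_rot_conj hd, smul_sub,
      add_sub_cancel]
  · intro a w hw ha har p hpw hpa
    obtain ⟨t, ht, hta, y, hy, hpy⟩ := h.near_edge hF.dir hroot har hpa
    have hc := hw.branch_spec.1
    have hkey : ∃ s : ℝ, 0 ≤ s ∧ s ≤ 1 ∧
        Near (r + Fintype.card V) p (B • G v + s • B • (G (T.branch v w) - G v)) := by
      obtain ⟨s, s0, s1, hs⟩ := near_graft (Γ := Γ) hd hq hP hw
      have hpar : ∃ s : ℝ, 0 ≤ s ∧ s ≤ 1 ∧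
          Near (r + Fintype.card V) (graft T v (B • G v) (o v) Γ (starD T v P q) (T.parent w))
            (B • G v + s • B • (G (T.branch v w) - G v)) := by
        by_cases hpv : T.parent w = v
        · refine ⟨0, le_rfl, zero_le_one, ?_⟩
          rw [hpv, graft_of_ancEq (OTree.AncEq.refl T v), starD_self, zero_smul, add_zero]
          have : sim (B • G v) (o v) 0 = B • G v := by ext <;> simp [sim, rot]
          rw [this]
          exact near_self (add_nonneg hr0 hn) _
        · have hne : T.branch v w ≠ w := fun he => hpv (hw.parent_eq he)
          obtain ⟨k1, k2, -⟩ := hw.branch_parent hne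
          rw [← k2]
          exact near_graft hd hq hP k1
      obtain ⟨s', s0', s1', hs'⟩ := hpar
      obtain ⟨x, y, hx, hy, hxy, rfl⟩ := hpw
      have hy1 : y ≤ 1 := by linarith
      have hxe : x = 1 - y := by linarith
      subst hxe
      refine ⟨(1 - y) * s + y * s', by positivity, ?_, ?_⟩
      · nlinarith
      · have := hs.lerp hy hy1 hs'
        convert this using 1
        ext <;> simp <;> ring
    obtain ⟨s, s0, s1, hs⟩ := hkey
    refine not_near_edge hp hg hb hB hr hc ht (fun hvt => ha (hvt.trans hta))
      (add_smul_mem_segment s0 s1 (G v) (G (T.branch v w))) hy ?_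
    exact (hs.symm.triangle hpy).weaken (by linarith)
  · intro a w hw ha he
    obtain ⟨t, hta, hpt⟩ := h.near_node hF.dir a
    obtain ⟨s, s0, s1, hs⟩ := near_graft (Γ := Γ) hd hq hP hw
    rw [he] at hs
    refine not_near_node hp hg hN hb hB hr hw.branch_spec.1 (fun hvt => ha (hvt.trans hta))
      (add_smul_mem_segment s0 s1 (G v) (G (T.branch v w))) ?_
    exact (hs.symm.triangle hpt).weaken (by linarith)

theorem Placed.graft_hugs (h : Placed T G o B S Γ) (ho : ∀ v, IsDir (o v)) (hr0 : 0 ≤ r)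
    (hq : ∀ c, T.IsChild c v → |(q c).1| + |(q c).2| ≤ 1)
    (hP : ∀ c, T.IsChild c v → ∃ s : ℝ, 0 ≤ s ∧ s ≤ 1 ∧
      Near r (P c) (s • B • rot (conj2 (o v)) (G c - G v))) :
    Hugs G B (r + Fintype.card V) (graft T v (B • G v) (o v) Γ (starD T v P q)) := by
  have hn : (0 : ℝ) ≤ Fintype.card V := Nat.cast_nonneg _
  intro w
  by_cases hw : T.AncEq v w
  · by_cases hwv : w = v
    · subst hwv
      refine ⟨w, w, _, left_mem_segment ℝ _ _, ?_⟩
      have : sim (B • G w) (o w) 0 = B • G w := by ext <;> simp [sim, rot]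
      rw [graft_of_ancEq hw, starD_self, this]
      exact near_self (add_nonneg hr0 hn) _
    · obtain ⟨s, s0, s1, hs⟩ := near_graft (Γ := Γ) (ho v) hq hP ⟨hw, hwv⟩
      exact ⟨_, _, _, add_smul_mem_segment s0 s1 (G v) _, hs⟩
  · obtain ⟨a, -, ha⟩ := h.near_node ho w
    rw [graft_of_not hw]
    exact ⟨a, a, _, left_mem_segment ℝ _ _, ha.weaken (by linarith)⟩

end Placed

/-- Drawings `Γ` and `Γ'` are joined by a planar morph with `k` steps through drawings
satisfying `good`. -/
def Chain (T : OTree V) (good : (V → ℝ × ℝ) → Prop) (k : ℕ) (Γ Γ' : V → ℝ × ℝ) : Prop :=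
  ∃ f : ℕ → V → ℝ × ℝ, f 0 = Γ ∧ f k = Γ' ∧ (∀ i ≤ k, good (f i)) ∧
    ∀ i < k, PlanarStep T (f i) (f (i + 1))

section Chain

variable {T : OTree V} {good good' : (V → ℝ × ℝ) → Prop} {k l : ℕ} {Γ Γ' Γ'' : V → ℝ × ℝ}

theorem Chain.refl (h : good Γ) : Chain T good 0 Γ Γ :=
  ⟨fun _ => Γ, rfl, rfl, fun _ _ => h, fun _ hi => absurd hi (Nat.not_lt_zero _)⟩

theorem Chain.single (h : good Γ) (h' : good Γ') (hs : PlanarStep T Γ Γ') :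
    Chain T good 1 Γ Γ' := by
  refine ⟨fun i => if i = 0 then Γ else Γ', rfl, rfl, ?_, ?_⟩
  · intro i _
    simp only
    split_ifs
    exacts [h, h']
  · intro i hi
    obtain rfl : i = 0 := by omega
    exact hs

theorem Chain.trans (h : Chain T good k Γ Γ') (h' : Chain T good l Γ' Γ'') :
    Chain T good (k + l) Γ Γ'' := by
  obtain ⟨f, f0, fk, fg, fs⟩ := h
  obtain ⟨g, g0, gl, gg, gs⟩ := h'
  refine ⟨fun i => if i ≤ k then f i else g (i - k), by simpa using f0, ?_, ?_, ?_⟩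
  · simp only
    split_ifs with hl
    · obtain rfl : l = 0 := by omega
      rw [add_zero, fk, ← g0, gl]
    · rw [Nat.add_sub_cancel_left, gl]
  · intro i hi
    simp only
    split_ifs with hk
    · exact fg i hk
    · exact gg _ (by omega)
  · intro i hi
    simp only
    rcases lt_trichotomy i k with hk | rfl | hk
    · rw [if_pos hk.le, if_pos (Nat.succ_le_of_lt hk)]
      exact fs i hk
    · rw [if_pos le_rfl, if_neg (by omega), fk, ← g0, Nat.add_sub_cancel_left]
      exact gs 0 (by omega)
    · rw [if_neg (by omega), if_neg (by omega), show i + 1 - k = i - k + 1 by omega]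
      exact gs _ (by omega)

theorem PlanarStep.symm (h : PlanarStep T Γ Γ') : PlanarStep T Γ' Γ := by
  intro t ht
  have := h (1 - t) ⟨sub_nonneg.2 ht.2, sub_le_self _ ht.1⟩
  convert this using 1
  funext v
  simp only [lerpD, sub_sub_cancel]
  exact add_comm _ _

theorem Chain.symm (h : Chain T good k Γ Γ') : Chain T good k Γ' Γ := by
  obtain ⟨f, f0, fk, fg, fs⟩ := h
  refine ⟨fun i => f (k - i), by simpa using fk, by simpa using f0, fun i _ => fg _ (by omega), ?_⟩
  intro i hi
  have := (fs (k - (i + 1)) (by omega)).symm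
  rwa [show k - (i + 1) + 1 = k - i by omega] at this

theorem Chain.mono (h : Chain T good k Γ Γ') (hg : ∀ Δ, good Δ → good' Δ) :
    Chain T good' k Γ Γ' := by
  obtain ⟨f, f0, fk, fg, fs⟩ := h
  exact ⟨f, f0, fk, fun i hi => hg _ (fg i hi), fs⟩

theorem PlanarStep.left (h : PlanarStep T Γ Γ') : IsPlanarD T Γ := by
  have := h 0 ⟨le_rfl, zero_le_one⟩
  convert this using 1
  funext v
  simp [lerpD]

theorem PlanarStep.right (h : PlanarStep T Γ Γ') : IsPlanarD T Γ' := h.symm.left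

end Chain

/-- A framed planar grid drawing together with the parameters of its transformation into a
canonical drawing. -/
structure Setup (T : OTree V) (G u o : V → ℝ × ℝ) (N : ℝ) (B Y : ℕ) : Prop where
  frame : Frame T G u o
  planar : IsPlanarD T G
  grid : IsGridD G
  one_le : 1 ≤ N
  bdd : ∀ v w, Bdd N (G v - G w)
  depth_le : 280 * N ^ 2 * (Fintype.card V + 1) ≤ Y
  scale : 2 * N * (6 * Y + 2 * Fintype.card V) < B

section NodeStep

variable {T : OTree V} {G u o Γ : V → ℝ × ℝ} {N : ℝ} {B Y : ℕ} {S : Finset V} {v : V}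

/-- Positions of the child `c` relative to `v` while the subtree of `v` is made canonical. -/
noncomputable def nodePos (T : OTree V) (G u o : V → ℝ × ℝ) (B Y : ℕ) (v : V) (i : ℕ) (c : V) :
    ℝ × ℝ :=
  if i ≤ 5 then stagePos (rot (conj2 (o v)) (u v)) B Y (rot (conj2 (o v)) (G c - G v)) i
  else T.canon c - T.canon v

/-- Orientations of the child `c` relative to `v` while the subtree of `v` is made canonical. -/
noncomputable def nodeDir (G u o : V → ℝ × ℝ) (v : V) (i : ℕ) (c : V) : ℝ × ℝ :=
  stageDir (rot (conj2 (o v)) (u v)) (rot (conj2 (o v)) (G c - G v)) (rot (conj2 (o v)) (o c)) i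

/-- The drawing obtained from `Γ` after `i` steps of making the subtree of `v` canonical. -/
noncomputable def nodeStage (T : OTree V) (G u o : V → ℝ × ℝ) (B Y : ℕ) (v : V)
    (Γ : V → ℝ × ℝ) (i : ℕ) : V → ℝ × ℝ :=
  graft T v ((B : ℝ) • G v) (o v) Γ (starD T v (nodePos T G u o B Y v i) (nodeDir G u o v i))

theorem Setup.star (h : Setup T G u o N B Y) (v : V) :
    LatticeStar (T.IsChild · v) (v ≠ T.root) N (rot (conj2 (o v)) (u v))
      (fun c => rot (conj2 (o v)) (G c - G v)) (fun c => rot (conj2 (o v)) (o c)) :=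
  h.frame.latticeStar h.planar h.grid h.one_le h.bdd v

theorem Setup.card_le (h : Setup T G u o N B Y) : (Fintype.card V : ℝ) + 1 ≤ Y := by
  have h1 := h.one_le
  have h2 : (0 : ℝ) ≤ Fintype.card V := Nat.cast_nonneg _
  have h3 : (1 : ℝ) ≤ N ^ 2 := one_le_pow₀ h1
  have := h.depth_le
  nlinarith

theorem Setup.le_scale (h : Setup T G u o N B Y) : (Y : ℝ) ≤ B := by
  have h1 := h.one_le
  have h2 : (0 : ℝ) ≤ Fintype.card V := Nat.cast_nonneg _
  have h3 := h.card_le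
  have := h.scale
  nlinarith

theorem Setup.scale_pos (h : Setup T G u o N B Y) : (0 : ℝ) < B := by
  have h2 : (0 : ℝ) ≤ Fintype.card V := Nat.cast_nonneg _
  linarith [h.card_le, h.le_scale]

theorem Setup.isDir_nodeDir (h : Setup T G u o N B Y) {c : V} (hc : T.IsChild c v) (i : ℕ) :
    IsDir (nodeDir G u o v i c) := by
  have hs := h.star v
  have h1 := hs.dir c hc
  have h2 := isDir_tilt (u := rot (conj2 (o v)) (u v)) h1 (hs.attached c hc)
  unfold nodeDir stageDir
  split
  exacts [h1, h1, h1, h2, h2, Or.inl rfl]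

theorem Setup.isIntPt_nodePos (h : Setup T G u o N B Y) {c : V} (hc : T.IsChild c v) (i : ℕ) :
    IsIntPt (nodePos T G u o B Y v i c) := by
  unfold nodePos
  split_ifs
  · unfold stagePos
    split
    · exact ((h.star v).int c hc).natCast_smul B
    all_goals exact isIntPt_flr _
  · exact (isIntPt_canon T c).sub (isIntPt_canon T v)

theorem Setup.nodePos_near (h : Setup T G u o N B Y) {c : V} (hc : T.IsChild c v) (i : ℕ) :
    ∃ s : ℝ, 0 ≤ s ∧ s ≤ 1 ∧ Near (6 * (Y : ℝ)) (nodePos T G u o B Y v i c)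
      (s • (B : ℝ) • rot (conj2 (o v)) (G c - G v)) := by
  have h1 := h.card_le
  have h2 : (0 : ℝ) ≤ Fintype.card V := Nat.cast_nonneg _
  unfold nodePos
  split_ifs
  · exact (h.star v).stagePos_near B (by linarith) hc i
  · refine ⟨0, le_rfl, zero_le_one, ?_⟩
    have := T.canon_sub_le c v
    rw [zero_smul]
    refine Near.weaken (r := Fintype.card V) ⟨?_, ?_⟩ (by linarith)
    · simpa using this.1
    · simpa using this.2

theorem Setup.nodeStage_zero (h : Setup T G u o N B Y) (hpl : Placed T G o B S Γ) (hv : v ∉ S)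
    (hsub : ∀ w, T.SDesc v w → w ∈ S) : nodeStage T G u o B Y v Γ 0 = Γ := by
  funext w
  unfold nodeStage
  by_cases hw : T.AncEq v w
  · rw [graft_of_ancEq hw]
    by_cases hwv : w = v
    · subst hwv
      rw [starD_self, hpl.off w hv]
      ext <;> simp [sim, rot]
    · have hs : T.SDesc v w := ⟨hw, hwv⟩
      have hb := hs.branch_spec
      rw [starD_of_sdesc hs, hpl.blob _ (hsub _ hb.1.sdesc) (Or.inr (by rw [hb.1.2]; exact hv)) w hb.2]
      have hd := h.frame.dir v
      have e1 : nodePos T G u o B Y v 0 (T.branch v w) =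
          (B : ℝ) • rot (conj2 (o v)) (G (T.branch v w) - G v) := rfl
      have e2 : nodeDir G u o v 0 (T.branch v w) = rot (conj2 (o v)) (o (T.branch v w)) := rfl
      have radd : ∀ x y z : ℝ × ℝ, rot x (y + z) = rot x y + rot x z := by
        intro x y z
        ext <;> simp [rot] <;> ring
      rw [e1, e2, sim, radd, rot_smul, rot_rot_conj hd, rot_rot, rot_rot_conj hd, smul_sub, ← add_assoc,
        add_sub_cancel]
  · exact graft_of_not hw

theorem Setup.nodeStage_six (hpl : Placed T G o B S Γ) (hS : ∀ a ∈ S, ∀ w, T.AncEq a w → w ∈ S)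
    (hv : v ∉ S) (hsub : ∀ w, T.SDesc v w → w ∈ S) :
    Placed T G o B (insert v S) (nodeStage T G u o B Y v Γ 6) := by
  have hval : ∀ w, T.AncEq v w → nodeStage T G u o B Y v Γ 6 w =
      (B : ℝ) • G v + rot (o v) (T.canon w - T.canon v) := by
    intro w hw
    unfold nodeStage
    rw [graft_of_ancEq hw]
    by_cases hwv : w = v
    · subst hwv
      rw [starD_self, sub_self]; rfl
    · have hs : T.SDesc v w := ⟨hw, hwv⟩
      rw [starD_of_sdesc hs]
      have e1 : nodePos T G u o B Y v 6 (T.branch v w) =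
          T.canon (T.branch v w) - T.canon v := rfl
      have e2 : nodeDir G u o v 6 (T.branch v w) = (1, 0) := rfl
      rw [e1, e2]
      ext <;> simp [sim, rot]
  constructor
  · intro w hw
    rw [Finset.mem_insert, not_or] at hw
    have hvw : ¬ T.AncEq v w := fun hvw => hw.2 (hsub w ⟨hvw, hw.1⟩)
    rw [nodeStage, graft_of_not hvw, hpl.off w hw.2]
  · intro a ha ht w haw
    by_cases hav : a = v
    · subst hav
      exact hval w haw
    · have haS := Finset.mem_of_mem_insert_of_ne ha hav
      have hvp : a ≠ T.root → T.parent a ∉ insert v S := fun har => ht.resolve_left har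
      have hva : ¬ T.AncEq v a := by
        intro hva
        have hs : T.SDesc v a := ⟨hva, hav⟩
        refine hvp hs.ne_root ?_
        by_cases hpv : T.parent a = v
        · rw [hpv]; exact Finset.mem_insert_self _ _
        · exact Finset.mem_insert_of_mem (hsub _ ⟨hs.parent, hpv⟩)
      have hvw : ¬ T.AncEq v w := by
        intro hvw
        rcases haw.comparable hvw with h1 | h1
        · exact hv (hS a haS v h1)
        · exact hva h1
      rw [nodeStage, graft_of_not hvw]
      refine hpl.blob a haS (ht.imp_right fun h1 h2 => h1 (Finset.mem_insert_of_mem h2)) w haw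

theorem Setup.localOK_stage (h : Setup T G u o N B Y) {i : ℕ} (hi : i < 6) {t : ℝ} (h0 : 0 ≤ t)
    (h1 : t ≤ 1) :
    LocalOK T v (v ≠ T.root) (rot (conj2 (o v)) (u v)) (starD T v
      (fun c => (1 - t) • nodePos T G u o B Y v i c + t • nodePos T G u o B Y v (i + 1) c)
      (fun c => (1 - t) • nodeDir G u o v i c + t • nodeDir G u o v (i + 1) c)) := by
  have hn : (0 : ℝ) ≤ Fintype.card V := Nat.cast_nonneg _
  have hK : 56 * N * ((Fintype.card V : ℝ) + 1) ≤ 56 * N * ((Fintype.card V : ℝ) + 1) := le_rfl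
  have hY : 5 * N * (56 * N * ((Fintype.card V : ℝ) + 1)) ≤ Y := by
    refine le_trans (le_of_eq ?_) h.depth_le
    ring
  have hs := h.star v
  rcases Nat.lt_or_ge i 5 with hi5 | hi5
  · refine StarOK.localOK ?_
    have := hs.stage_starOK hn hK hY h.le_scale (Nat.le_of_lt_succ hi5) h0 h1
    simp only [nodePos, if_pos hi5.le, if_pos (Nat.succ_le_of_lt hi5)]
    exact this
  · obtain rfl : i = 5 := by omega
    have hYn := h.card_le
    refine localOK_of_layered (y := (1 - t) * Y + t) (by nlinarith) hs.cone.pos ?_ ?_ ?_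
    · intro c hc
      ext <;> simp [nodeDir, stageDir]
    · intro c hc
      have hd : (T.depth c : ℝ) = T.depth v + 1 := by exact_mod_cast hc.depth
      have h5 := hs.stagePos_five B Y hc
      simp only [nodePos, le_refl, if_true, Nat.reduceLeDiff, if_false, Prod.snd_add, Prod.smul_snd, Prod.snd_sub,
        smul_eq_mul, OTree.canon, hd]
      rw [h5]
      ring
    · intro c c' w w' hc hc' hr hw hw'
      have hne : c ≠ c' := by
        rintro rfl
        exact lt_irrefl _ hr
      have hgap := hs.stagePos_gap hn hK hY h.le_scale hc hc' hne
        ((h.frame.before v c c' hc hc' hr).rot (h.frame.dir v).conj)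
      have hcol : (T.col w : ℝ) < T.col w' := by
        exact_mod_cast OTree.LeftOf.col_lt
          ⟨c, c', hc.1, hc'.1, hc.2.trans hc'.2.symm, hr, hw, hw'⟩
      have b1 := abs_le.1 (T.canon_sub_le w c).1
      have b2 := abs_le.1 (T.canon_sub_le w' c').1
      simp only [Prod.fst_sub, OTree.canon] at b1 b2
      simp only [nodePos, le_refl, if_true, Nat.reduceLeDiff, if_false, Prod.fst_add, Prod.smul_fst, Prod.fst_sub,
        smul_eq_mul, OTree.canon]
      rcases h1.lt_or_eq with ht | rfl
      · have := mul_lt_mul_of_pos_left hgap (sub_pos.2 ht)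
        nlinarith
      · linarith

theorem Setup.nodeStage_planarStep (h : Setup T G u o N B Y) (hpl : Placed T G o B S Γ)
    (hS : ∀ a ∈ S, ∀ w, T.AncEq a w → w ∈ S) (hv : v ∉ S) (hΓ : IsPlanarD T Γ) {i : ℕ}
    (hi : i < 6) :
    PlanarStep T (nodeStage T G u o B Y v Γ i) (nodeStage T G u o B Y v Γ (i + 1)) := by
  rintro t ⟨h0, h1⟩
  have hY := h.card_le
  have hn : (0 : ℝ) ≤ Fintype.card V := Nat.cast_nonneg _
  have hB := h.scale_pos
  unfold nodeStage
  rw [lerpD_graft]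
  have he : ∀ P P' q q' : V → ℝ × ℝ, lerpD t (starD T v P q) (starD T v P' q') =
      starD T v (fun c => (1 - t) • P c + t • P' c) (fun c => (1 - t) • q c + t • q' c) :=
    fun P P' q q' => funext fun w => starD_lerp P' q' t w
  rw [he]
  refine hpl.graft_planar h.frame h.planar h.grid (zero_le_one.trans h.one_le) h.bdd hB (r := 6 * Y)
    ?_ hS hΓ hv (by linarith) (h.localOK_stage hi h0 h1) ?_ ?_
  · rw [← mul_div_assoc, div_lt_one hB]
    exact h.scale
  · intro c hc
    exact lerp_dir (h.isDir_nodeDir hc i) (h.isDir_nodeDir hc (i + 1)) h0 h1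
  · intro c hc
    obtain ⟨s, s0, s1, hs⟩ := h.nodePos_near hc i
    obtain ⟨s', s0', s1', hs'⟩ := h.nodePos_near hc (i + 1)
    refine ⟨(1 - t) * s + t * s', ?_, ?_, ?_⟩
    · have := sub_nonneg.2 h1
      positivity
    · nlinarith
    · rw [add_smul, mul_smul, mul_smul]
      exact hs.lerp h0 h1 hs'

theorem Setup.nodeStage_hugs (h : Setup T G u o N B Y) (hpl : Placed T G o B S Γ) (i : ℕ) :
    Hugs G B (6 * Y + Fintype.card V) (nodeStage T G u o B Y v Γ i) :=
  hpl.graft_hugs h.frame.dir (by positivity)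
    (fun _ hc => (h.isDir_nodeDir hc i).abs_add.le) fun _ hc => h.nodePos_near hc i

theorem Setup.nodeStage_grid (h : Setup T G u o N B Y) (hΓ : IsGridD Γ) (i : ℕ) :
    IsGridD (nodeStage T G u o B Y v Γ i) := by
  refine isGridD_of_isIntPt fun w => ?_
  unfold nodeStage
  by_cases hw : T.AncEq v w
  · rw [graft_of_ancEq hw]
    refine ((h.grid.isIntPt v).natCast_smul B).add ((h.frame.dir v).isIntPt.rot ?_)
    by_cases hwv : w = v
    · subst hwv
      rw [starD_self]
      exact ⟨0, 0, by ext <;> simp⟩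
    · have hs : T.SDesc v w := ⟨hw, hwv⟩
      have hc := hs.branch_spec.1
      rw [starD_of_sdesc hs]
      exact (h.isIntPt_nodePos hc i).add ((h.isDir_nodeDir hc i).isIntPt.rot
        ((isIntPt_canon T _).sub (isIntPt_canon T _)))
  · rw [graft_of_not hw]
    exact hΓ.isIntPt w

/-- The subtree of `v` can be made canonical once this has been done for its children. -/
theorem Setup.node_chain (h : Setup T G u o N B Y) (hpl : Placed T G o B S Γ)
    (hS : ∀ a ∈ S, ∀ w, T.AncEq a w → w ∈ S) (hv : v ∉ S) (hsub : ∀ w, T.SDesc v w → w ∈ S)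
    (hΓ : IsPlanarD T Γ) (hg : IsGridD Γ) :
    ∃ Γ', Chain T (fun Δ => IsGridD Δ ∧ Hugs G B (6 * Y + Fintype.card V) Δ) 6 Γ Γ' ∧
      Placed T G o B (insert v S) Γ' ∧ IsPlanarD T Γ' ∧ IsGridD Γ' :=
  ⟨_, ⟨nodeStage T G u o B Y v Γ, h.nodeStage_zero hpl hv hsub, rfl,
    fun i _ => ⟨h.nodeStage_grid hg i, h.nodeStage_hugs hpl i⟩,
    fun _ hi => h.nodeStage_planarStep hpl hS hv hΓ hi⟩, Setup.nodeStage_six hpl hS hv hsub,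
    (h.nodeStage_planarStep hpl hS hv hΓ (Nat.lt_succ_self 5)).right, h.nodeStage_grid hg 6⟩

end NodeStep

section Canonical

variable {T : OTree V} {G u o Γ : V → ℝ × ℝ} {N : ℝ} {B Y : ℕ}

theorem smul_eq_sim (s : ℝ) (p : ℝ × ℝ) : s • p = sim 0 (s, 0) p := by
  ext <;> simp [sim, rot]

theorem IsPlanarD.smul (h : IsPlanarD T G) {s : ℝ} (hs : s ≠ 0) :
    IsPlanarD T fun w => s • G w := by
  simp only [smul_eq_sim]
  exact h.sim 0 fun h0 => hs (congrArg Prod.fst h0)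

/-- The canonical drawing with its root moved to the origin. -/
noncomputable def OTree.centered (T : OTree V) (w : V) : ℝ × ℝ := T.canon w - T.canon T.root

theorem OTree.centered_planar (T : OTree V) : IsPlanarD T T.centered := by
  have h : IsPlanarD T T.canon :=
    (isPlanarD_iff T _).2 ⟨canon_injective T, fun _ _ hu hw huw => canon_edgesMeet T hu hw huw⟩
  convert h.sim (-T.canon T.root) (o := (1, 0)) (by simp) using 1
  funext w
  ext <;> simp [sim, rot, OTree.centered] <;> ring

/-- Motions of a drawing by similarities that never degenerate are planar. -/
theorem IsPlanarD.sim_planarStep (h : IsPlanarD T G) (A A' : ℝ × ℝ) {p p' : ℝ × ℝ}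
    (hp : ∀ t ∈ Icc (0 : ℝ) 1, (1 - t) • p + t • p' ≠ 0) :
    PlanarStep T (fun w => _root_.sim A p (G w)) fun w => _root_.sim A' p' (G w) := by
  intro t ht
  convert h.sim ((1 - t) • A + t • A') (hp t ht) using 1
  funext w
  ext <;> simp [lerpD, _root_.sim, rot] <;> ring

theorem OTree.exists_deepest (T : OTree V) {S : Finset V} (hS : S ≠ Finset.univ) :
    ∃ v ∉ S, ∀ w, T.SDesc v w → w ∈ S := by
  have hne : Sᶜ.Nonempty := by rwa [Finset.nonempty_iff_ne_empty, Ne, Finset.compl_eq_empty_iff]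
  obtain ⟨v, hv, hmax⟩ := Sᶜ.exists_max_image T.depth hne
  refine ⟨v, Finset.mem_compl.1 hv, fun w hw => ?_⟩
  by_contra hwS
  have h1 := hmax w (Finset.mem_compl.2 hwS)
  have h2 := hw.parent.depth_le
  have h3 := T.depth_eq_succ hw.ne_root
  omega

/-- The scaled drawing can be made canonical subtree by subtree. -/
theorem Setup.exists_placed (h : Setup T G u o N B Y) {k : ℕ} (hk : k ≤ Fintype.card V) :
    ∃ S : Finset V, S.card = k ∧ (∀ a ∈ S, ∀ w, T.AncEq a w → w ∈ S) ∧
      ∃ Γ, Chain T (fun Δ => IsGridD Δ ∧ Hugs G B (6 * Y + Fintype.card V) Δ) (6 * k)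
          (fun w => (B : ℝ) • G w) Γ ∧
        Placed T G o B S Γ ∧ IsPlanarD T Γ ∧ IsGridD Γ := by
  induction k with
  | zero =>
    have hg : IsGridD fun w => (B : ℝ) • G w :=
      isGridD_of_isIntPt fun w => (h.grid.isIntPt w).natCast_smul B
    refine ⟨∅, rfl, by simp, _, Chain.refl ⟨hg, fun w => ?_⟩, ⟨fun _ _ => rfl, by simp⟩,
      h.planar.smul h.scale_pos.ne', hg⟩
    exact ⟨w, w, _, left_mem_segment ℝ _ _, near_self (by positivity) _⟩
  | succ k ih =>
    obtain ⟨S, hc, hS, Γ, hch, hpl, hΓ, hg⟩ := ih (by omega)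
    obtain ⟨v, hv, hsub⟩ := T.exists_deepest (S := S) fun hu => by
      rw [hu, Finset.card_univ] at hc
      omega
    obtain ⟨Γ', hch', hpl', hΓ', hg'⟩ := h.node_chain hpl hS hv hsub hΓ hg
    refine ⟨insert v S, by rw [Finset.card_insert_of_notMem hv, hc], ?_, Γ', ?_, hpl', hΓ', hg'⟩
    · intro a ha w haw
      rcases Finset.mem_insert.1 ha with rfl | ha
      · by_cases hw : w = a
        · exact hw ▸ Finset.mem_insert_self _ _
        · exact Finset.mem_insert_of_mem (hsub w ⟨haw, hw⟩)
      · exact Finset.mem_insert_of_mem (hS a ha w haw)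
    · exact hch.trans hch'

theorem Setup.sim_good (h : Setup T G u o N B Y) {p : ℝ × ℝ} (hp : IsDir p) :
    IsGridD (fun w => sim ((B : ℝ) • G T.root) p (T.centered w)) ∧
      Hugs G B (6 * Y + Fintype.card V) fun w => sim ((B : ℝ) • G T.root) p (T.centered w) := by
  refine ⟨isGridD_of_isIntPt fun w => ((h.grid.isIntPt _).natCast_smul B).add
    (hp.isIntPt.rot ((isIntPt_canon T w).sub (isIntPt_canon T _))), fun w =>
      ⟨T.root, T.root, _, left_mem_segment ℝ _ _, ?_⟩⟩
  refine Near.weaken (r := Fintype.card V) ?_ (by linarith [Nat.cast_nonneg (α := ℝ) Y])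
  have hc := T.canon_sub_le w T.root
  have := abs_rot_le hp.abs_add.le hc.1 hc.2
  exact ⟨by simpa [sim, OTree.centered] using this.1, by simpa [sim, OTree.centered] using this.2⟩

/-- The scaled drawing can be turned into a canonical drawing of prescribed orientation. -/
theorem Setup.canonical_chain (h : Setup T G u o N B Y) {p : ℝ × ℝ} (hp : IsDir p)
    (hne : o T.root ≠ -p) :
    Chain T (fun Δ => IsGridD Δ ∧ Hugs G B (6 * Y + Fintype.card V) Δ) (6 * Fintype.card V + 1)
      (fun w => (B : ℝ) • G w) fun w => sim ((B : ℝ) • G T.root) p (T.centered w) := by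
  obtain ⟨S, hc, -, Γ, hch, hpl, -, -⟩ := h.exists_placed le_rfl
  obtain rfl := (Finset.card_eq_iff_eq_univ S).1 hc
  have he : Γ = fun w => sim ((B : ℝ) • G T.root) (o T.root) (T.centered w) :=
    funext fun w => hpl.blob T.root (Finset.mem_univ _) (Or.inl rfl) w (T.ancEq_root w)
  subst he
  exact hch.trans (Chain.single (h.sim_good (h.frame.dir _)) (h.sim_good hp)
    (T.centered_planar.sim_planarStep _ _ fun t _ => lerp_dir_ne (h.frame.dir _) hp hne))

theorem Setup.scale_planarStep (h : Setup T G u o N B Y) :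
    PlanarStep T G fun w => (B : ℝ) • G w := by
  have h0 : G = fun w => sim 0 (1, 0) (G w) := by simp only [← smul_eq_sim, one_smul]
  have h1 : (fun w => (B : ℝ) • G w) = fun w => sim 0 ((B : ℝ), 0) (G w) := by
    simp only [← smul_eq_sim]
  rw [h1]
  nth_rw 1 [h0]
  refine h.planar.sim_planarStep 0 0 fun t ht he => ?_
  have h2 := congrArg Prod.fst he
  have hB := h.scale_pos
  have hB1 : (1 : ℝ) ≤ B := by exact_mod_cast Nat.cast_pos.1 hB
  simp at h2
  nlinarith [ht.1, ht.2]

theorem exists_dir_between {p : ℝ × ℝ} (hp : IsDir p) (q : ℝ × ℝ) :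
    ∃ r, IsDir r ∧ p ≠ -r ∧ r ≠ -q := by
  by_cases h : p = -q
  · refine ⟨rot (0, 1) p, ?_, ?_, ?_⟩
    · rcases hp with rfl | rfl | rfl | rfl <;> simp [IsDir, rot]
    · rcases hp with rfl | rfl | rfl | rfl <;> simp [rot]
    · rw [← h]
      rcases hp with rfl | rfl | rfl | rfl <;> simp [rot]
  · refine ⟨p, hp, ?_, h⟩
    rcases hp with rfl | rfl | rfl | rfl <;> simp [Prod.ext_iff] <;> norm_num

/-- Two framed drawings of a tree are joined by a linear number of planar steps. -/
theorem Setup.chain_between {G' u' o' : V → ℝ × ℝ} {good : (V → ℝ × ℝ) → Prop}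
    (h : Setup T G u o N B Y) (h' : Setup T G' u' o' N B Y) (hG : good G) (hG' : good G')
    (hgood : ∀ Δ, IsGridD Δ → Hugs G B (6 * Y + Fintype.card V) Δ → good Δ)
    (hgood' : ∀ Δ, IsGridD Δ → Hugs G' B (6 * Y + Fintype.card V) Δ → good Δ) :
    Chain T good (12 * Fintype.card V + 5) G G' := by
  obtain ⟨p, hp, hp1, hp2⟩ := exists_dir_between (h.frame.dir T.root) (o' T.root)
  have hp3 : o' T.root ≠ -p := fun he => hp2 (by rw [he, neg_neg])
  have hpp : o' T.root ≠ -(o' T.root) := by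
    rcases h'.frame.dir T.root with he | he | he | he <;> rw [he] <;> simp [Prod.ext_iff] <;>
      norm_num
  have hl : ∀ {G u o : V → ℝ × ℝ} (h : Setup T G u o N B Y) {p : ℝ × ℝ} (_ : IsDir p)
      (_ : o T.root ≠ -p) (_ : good G)
      (_ : ∀ Δ, IsGridD Δ → Hugs G B (6 * Y + Fintype.card V) Δ → good Δ),
      Chain T good (1 + (6 * Fintype.card V + 1)) G
        fun w => sim ((B : ℝ) • G T.root) p (T.centered w) := by
    intro G u o h p hp hne hG hgood
    have hc := (h.canonical_chain hp hne).mono fun Δ hΔ => hgood Δ hΔ.1 hΔ.2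
    refine Chain.trans (Chain.single hG ?_ h.scale_planarStep) hc
    obtain ⟨f, f0, -, fg, -⟩ := hc
    exact f0 ▸ fg 0 (Nat.zero_le _)
  have c1 := hl h hp hp1 hG hgood
  have c2 := hl h' hp hp3 hG' hgood'
  have hg : ∀ {G u o : V → ℝ × ℝ} (h : Setup T G u o N B Y)
      (_ : ∀ Δ, IsGridD Δ → Hugs G B (6 * Y + Fintype.card V) Δ → good Δ),
      good fun w => sim ((B : ℝ) • G T.root) p (T.centered w) := fun h hg =>
    hg _ (h.sim_good hp).1 (h.sim_good hp).2
  have c3 := (c1.trans (Chain.single (hg h hgood) (hg h' hgood')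
    (T.centered_planar.sim_planarStep _ _ fun t _ => by
      rw [← add_smul, sub_add_cancel, one_smul]; exact hp.ne_zero))).trans c2.symm
  convert c3 using 1
  ring

end Canonical

section Extent

variable {W : Type} [Finite W]

/-- The extent of a function: the difference between its largest and its smallest value. -/
noncomputable def extent {W : Type} (f : W → ℝ) : ℝ := sSup (range f) - sInf (range f)

theorem le_extent (f : W → ℝ) (a b : W) : f a - f b ≤ extent f :=
  sub_le_sub (le_csSup (finite_range f).bddAbove ⟨a, rfl⟩)
    (csInf_le (finite_range f).bddBelow ⟨b, rfl⟩)

variable [Nonempty W]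

theorem extent_le {f : W → ℝ} {c : ℝ} (h : ∀ a b, f a - f b ≤ c) : extent f ≤ c := by
  obtain ⟨a, ha⟩ := (range_nonempty f).csSup_mem (finite_range f)
  obtain ⟨b, hb⟩ := (range_nonempty f).csInf_mem (finite_range f)
  rw [extent, ← ha, ← hb]
  exact h a b

theorem extent_nonneg (f : W → ℝ) : 0 ≤ extent f :=
  (Classical.arbitrary W |> fun a => (sub_self (f a)).symm.le.trans (le_extent f a a))

/-- Values close to convex combinations of values of `B * g` are spread at most slightly more
than those of `B * g`. -/
theorem extent_le_of_hugs {f g : W → ℝ} {B r : ℝ} (hB : 0 ≤ B)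
    (h : ∀ w, ∃ a b t, 0 ≤ t ∧ t ≤ 1 ∧ |f w - (B * g a + t * (B * g b - B * g a))| ≤ r) :
    extent f ≤ B * extent g + 2 * r := by
  refine extent_le fun v w => ?_
  obtain ⟨a, b, t, h0, h1, hv⟩ := h v
  obtain ⟨a', b', t', h0', h1', hw⟩ := h w
  rw [abs_le] at hv hw
  have e1 := mul_le_mul_of_nonneg_left (le_extent g a a') hB
  have e2 := mul_le_mul_of_nonneg_left (le_extent g a b') hB
  have e3 := mul_le_mul_of_nonneg_left (le_extent g b a') hB
  have e4 := mul_le_mul_of_nonneg_left (le_extent g b b') hB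
  have key : ∀ x y : ℝ, B * g a - x ≤ B * extent g → B * g b - x ≤ B * extent g →
      B * g a + t * (B * g b - B * g a) - x ≤ B * extent g := by
    intro x _ p q
    nlinarith [mul_le_mul_of_nonneg_left p (sub_nonneg.2 h1), mul_le_mul_of_nonneg_left q h0]
  have k1 := key (B * g a') 0 (by linarith) (by linarith)
  have k2 := key (B * g b') 0 (by linarith) (by linarith)
  have k3 := mul_le_mul_of_nonneg_left k1 (sub_nonneg.2 h1')
  have k4 := mul_le_mul_of_nonneg_left k2 h0'
  nlinarith

end Extent

section Bounds

variable {W : Type} [Finite W] {G Γ : W → ℝ × ℝ} {B r : ℝ}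

theorem bdd_sub_of_le {N : ℝ} (hW : gW G ≤ N) (hH : gH G ≤ N) (v w : W) :
    Bdd N (G v - G w) := by
  have h1 := le_extent (fun v => (G v).1) v w
  have h2 := le_extent (fun v => (G v).1) w v
  have h3 := le_extent (fun v => (G v).2) v w
  have h4 := le_extent (fun v => (G v).2) w v
  simp only [extent] at h1 h2 h3 h4
  unfold gW at hW
  unfold gH at hH
  constructor <;> rw [abs_le] <;> simp <;> constructor <;> linarith

variable [Nonempty W]

theorem Hugs.gW_le (h : Hugs G B r Γ) (hB : 0 ≤ B) :
    gW Γ ≤ B * (gW G - 1) + 2 * r + 1 := by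
  have := extent_le_of_hugs (f := fun v => (Γ v).1) (g := fun v => (G v).1) (r := r) hB
    fun w => by
      obtain ⟨a, b, q, hq, hn⟩ := h w
      obtain ⟨t, h0, h1, rfl⟩ := mem_segment_iff.1 hq
      exact ⟨a, b, t, h0, h1, hn.1⟩
  simp only [extent] at this
  unfold gW
  linarith

theorem Hugs.gH_le (h : Hugs G B r Γ) (hB : 0 ≤ B) :
    gH Γ ≤ B * (gH G - 1) + 2 * r + 1 := by
  have := extent_le_of_hugs (f := fun v => (Γ v).2) (g := fun v => (G v).2) (r := r) hB
    fun w => by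
      obtain ⟨a, b, q, hq, hn⟩ := h w
      obtain ⟨t, h0, h1, rfl⟩ := mem_segment_iff.1 hq
      exact ⟨a, b, t, h0, h1, hn.2⟩
  simp only [extent] at this
  unfold gH
  linarith

theorem one_le_gW (G : W → ℝ × ℝ) : 1 ≤ gW G :=
  le_add_of_nonneg_left (extent_nonneg fun v => (G v).1)

theorem one_le_gH (G : W → ℝ × ℝ) : 1 ≤ gH G :=
  le_add_of_nonneg_left (extent_nonneg fun v => (G v).2)

end Bounds

/-- The depth at which stars are flattened. -/
def flatDepth (N n : ℕ) : ℕ := 280 * N ^ 2 * (n + 1)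

/-- The scaling factor that makes room for all stars. -/
def roomScale (N n : ℕ) : ℕ := 2 * N * (6 * flatDepth N n + 2 * n) + 1

theorem roomScale_bound {N n : ℕ} {D g M m : ℝ} (hN : 1 ≤ N) (hn : 1 ≤ n) (hND : (N : ℝ) ≤ 2 * D)
    (hg : 1 ≤ g) (hgM : g ≤ M)
    (hm : m ≤ roomScale N n * (g - 1) + 2 * (6 * flatDepth N n + n) + 1) :
    m ≤ 200000 * D ^ 3 * n * M := by
  have hN' : (1 : ℝ) ≤ N := by exact_mod_cast hN
  have hn' : (1 : ℝ) ≤ n := by exact_mod_cast hn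
  have h2 : (1 : ℝ) ≤ (N : ℝ) ^ 2 := one_le_pow₀ hN'
  have h3 : (N : ℝ) ^ 2 ≤ (N : ℝ) ^ 3 := pow_le_pow_right₀ hN' (by norm_num)
  have hD : (N : ℝ) ^ 3 ≤ 8 * D ^ 3 := by
    have := pow_le_pow_left₀ (by linarith) hND 3
    linarith [mul_pow 2 D 3]
  set X : ℝ := (N : ℝ) ^ 3 * n with hX
  have hXn : (n : ℝ) ≤ X := by nlinarith
  have hX1 : (1 : ℝ) ≤ X := hn'.trans hXn
  have hY : (flatDepth N n : ℝ) ≤ 560 * ((N : ℝ) ^ 2 * n) := by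
    simp only [flatDepth]
    push_cast
    nlinarith
  have hYX : (flatDepth N n : ℝ) ≤ 560 * X := by nlinarith
  have hNY : (N : ℝ) * flatDepth N n ≤ 560 * X := by
    have := mul_le_mul_of_nonneg_left hY (by linarith : (0 : ℝ) ≤ N)
    refine this.trans (le_of_eq ?_)
    rw [hX]
    ring
  have hNn : (N : ℝ) * n ≤ X := by
    have : (N : ℝ) ≤ N ^ 3 := le_self_pow₀ hN' (by norm_num)
    exact mul_le_mul_of_nonneg_right this (by linarith)
  have hB : (roomScale N n : ℝ) ≤ 6725 * X := by
    simp only [roomScale]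
    push_cast
    nlinarith
  have hXD : X ≤ 8 * (D ^ 3 * n) := by
    rw [hX]
    nlinarith
  have k1 : m ≤ 6725 * X * (g - 1) + 6723 * X := by
    have := mul_le_mul_of_nonneg_right hB (sub_nonneg.2 hg)
    linarith
  have k2 : m ≤ 6725 * X * g := by nlinarith
  calc m ≤ 6725 * X * g := k2
    _ ≤ 53800 * (D ^ 3 * n) * M :=
      mul_le_mul (by linarith) hgM (by linarith) (by linarith)
    _ ≤ 200000 * D ^ 3 * n * M := by
      have : 0 ≤ D ^ 3 * n * M := by
        have : 0 ≤ D ^ 3 * n := by linarith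
        exact mul_nonneg this (by linarith)
      linarith

theorem exists_setup {T : OTree V} {G : V → ℝ × ℝ} (ho : IsOrderPreservingD T G)
    (hp : IsPlanarD T G) (hg : IsGridD G) {N : ℕ} (hN : 1 ≤ N) (hW : gW G ≤ N) (hH : gH G ≤ N) :
    ∃ u o, Setup T G u o N (roomScale N (Fintype.card V)) (flatDepth N (Fintype.card V)) := by
  have : Nonempty V := ⟨T.root⟩
  obtain ⟨u, o, hF⟩ := exists_frame hp ho
  refine ⟨u, o, hF, hp, hg, by exact_mod_cast hN, bdd_sub_of_le hW hH, ?_, ?_⟩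
  · simp only [flatDepth]
    push_cast
    exact le_rfl
  · simp only [roomScale]
    push_cast
    exact lt_add_one _

/-- **Theorem 3.** There are absolute constants `c₁, c₂, c₃ > 0` such
that for every `n`-node ordered tree `T` and any two order-preserving straight-line
planar grid drawings `Γ₀, Γ₁` of `T`, setting `H = max {h(Γ₀), h(Γ₁)}`,
`W = max {w(Γ₀), w(Γ₁)}` and `D = max {H, W}`, there is a planar morph from `Γ₀` to
`Γ₁` with at most `c₁ · n` steps, all of whose drawings are grid drawings, whose
height is at most `c₂ · D³ · n · H` and whose width is at most `c₃ · D³ · n · W`. -/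
theorem planar_morph_polynomial_area :
    ∃ (c₁ : ℕ) (c₂ c₃ : ℝ), 0 < c₁ ∧ 0 < c₂ ∧ 0 < c₃ ∧
      ∀ (V : Type) [Fintype V] [DecidableEq V] (T : OTree V) (Γ₀ Γ₁ : V → ℝ × ℝ),
        IsOrderPreservingD T Γ₀ → IsOrderPreservingD T Γ₁ →
        IsPlanarD T Γ₀ → IsPlanarD T Γ₁ →
        IsGridD Γ₀ → IsGridD Γ₁ →
        ∃ k : ℕ, k ≤ c₁ * Fintype.card V ∧
          ∃ Δ : Fin (k + 1) → V → ℝ × ℝ,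
            Δ 0 = Γ₀ ∧ Δ (Fin.last k) = Γ₁ ∧
            (∀ i, IsGridD (Δ i)) ∧
            (∀ i : Fin k, PlanarStep T (Δ i.castSucc) (Δ i.succ)) ∧
            (∀ i, gH (Δ i) ≤
              c₂ * (max (max (gH Γ₀) (gH Γ₁)) (max (gW Γ₀) (gW Γ₁)))^3 *
                (Fintype.card V : ℝ) * max (gH Γ₀) (gH Γ₁)) ∧
            (∀ i, gW (Δ i) ≤
              c₃ * (max (max (gH Γ₀) (gH Γ₁)) (max (gW Γ₀) (gW Γ₁)))^3 *
                (Fintype.card V : ℝ) * max (gW Γ₀) (gW Γ₁)) := by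
  refine ⟨17, 200000, 200000, by norm_num, by norm_num, by norm_num, ?_⟩
  intro V _ _ T Γ₀ Γ₁ ho₀ ho₁ hp₀ hp₁ hg₀ hg₁
  have hne : Nonempty V := ⟨T.root⟩
  have hn : 1 ≤ Fintype.card V := Fintype.card_pos
  set D := max (max (gH Γ₀) (gH Γ₁)) (max (gW Γ₀) (gW Γ₁)) with hD
  have hH₀ : gH Γ₀ ≤ D := (le_max_left _ _).trans (le_max_left _ _)
  have hH₁ : gH Γ₁ ≤ D := (le_max_right _ _).trans (le_max_left _ _)
  have hW₀ : gW Γ₀ ≤ D := (le_max_left _ _).trans (le_max_right _ _)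
  have hW₁ : gW Γ₁ ≤ D := (le_max_right _ _).trans (le_max_right _ _)
  have hD1 : 1 ≤ D := (one_le_gH Γ₀).trans hH₀
  have hDN : D ≤ ⌈D⌉₊ := Nat.le_ceil D
  have hN : 1 ≤ ⌈D⌉₊ := by exact_mod_cast hD1.trans hDN
  have hND : (⌈D⌉₊ : ℝ) ≤ 2 * D := by linarith [Nat.ceil_lt_add_one (zero_le_one.trans hD1)]
  obtain ⟨u₀, o₀, s₀⟩ := exists_setup ho₀ hp₀ hg₀ hN (hW₀.trans hDN) (hH₀.trans hDN)
  obtain ⟨u₁, o₁, s₁⟩ := exists_setup ho₁ hp₁ hg₁ hN (hW₁.trans hDN) (hH₁.trans hDN)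
  have bound : ∀ {g M m : ℝ}, 1 ≤ g → g ≤ M → _ → m ≤ 200000 * D ^ 3 * Fintype.card V * M :=
    fun hg hgM hm => roomScale_bound hN hn hND hg hgM hm
  have self_le : ∀ {g M : ℝ}, 1 ≤ g → g ≤ M → g ≤ 200000 * D ^ 3 * Fintype.card V * M := by
    intro g M hg hgM
    have hn' : (1 : ℝ) ≤ Fintype.card V := by exact_mod_cast hn
    have h3 : 1 ≤ D ^ 3 := one_le_pow₀ hD1
    have h4 : 1 ≤ 200000 * D ^ 3 * Fintype.card V := by nlinarith
    exact hgM.trans (le_mul_of_one_le_left (by linarith) h4)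
  have hB := s₀.scale_pos.le
  obtain ⟨Δ, h0, h1, hgood, hstep⟩ := s₀.chain_between s₁
    (good := fun Δ => IsGridD Δ ∧
      gH Δ ≤ 200000 * D ^ 3 * Fintype.card V * max (gH Γ₀) (gH Γ₁) ∧
      gW Δ ≤ 200000 * D ^ 3 * Fintype.card V * max (gW Γ₀) (gW Γ₁))
    ⟨hg₀, self_le (one_le_gH _) (le_max_left _ _), self_le (one_le_gW _) (le_max_left _ _)⟩
    ⟨hg₁, self_le (one_le_gH _) (le_max_right _ _), self_le (one_le_gW _) (le_max_right _ _)⟩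
    (fun Δ hΔ hh => ⟨hΔ, bound (one_le_gH _) (le_max_left _ _) (hh.gH_le hB),
      bound (one_le_gW _) (le_max_left _ _) (hh.gW_le hB)⟩)
    (fun Δ hΔ hh => ⟨hΔ, bound (one_le_gH _) (le_max_right _ _) (hh.gH_le hB),
      bound (one_le_gW _) (le_max_right _ _) (hh.gW_le hB)⟩)
  have hle : ∀ i : Fin (12 * Fintype.card V + 5 + 1), i.val ≤ 12 * Fintype.card V + 5 :=
    fun i => Nat.lt_succ_iff.1 i.isLt
  exact ⟨12 * Fintype.card V + 5, by omega, fun i => Δ i.val, h0, h1, fun i => (hgood _ (hle i)).1,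
    fun i => hstep i.val i.isLt, fun i => (hgood _ (hle i)).2.1, fun i => (hgood _ (hle i)).2.2⟩
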